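/- arXiv:1912.08021 — 11 statements merged into one kernel-verified Lean document; each statement's English description precedes it below -/
import Mathlib

section
/- Let ξ ∈ F be such that the equation y^{q^2} - y = ξ^m has exactly q^2 solutions y ∈ F. Then for every η ∈ F satisfying η^{q^2} - η = ξ^m, the number of elements θ ∈ F with θ^q + θ = η^{q+1} is exactly q. -/
open Polynomial in
lemma card_roots_aux {F : Type*} [Field F] [Fintype F] (n : ℕ) (g : F[X])
    (hg : g ∈ degreeLT F n) (S : Set F) (hS : ∀ x ∈ S, x ^ n + g.eval x = 0) :
    Nat.card S ≤ n := by
  classical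
  have hg' := mem_degreeLT.1 hg
  have hmon : (X ^ n + g).Monic := monic_X_pow_add hg'
  have hdeg : (X ^ n + g).natDegree = n := by
    apply natDegree_eq_of_degree_eq_some
    rw [degree_add_eq_left_of_degree_lt (by simpa using hg')]
    simp
  have h1 : S.toFinset ⊆ (X ^ n + g).roots.toFinset := by
    intro x hx
    rw [Multiset.mem_toFinset, mem_roots hmon.ne_zero, IsRoot.def]
    simpa using hS x (by simpa using hx)
  calc Nat.card S = S.toFinset.card := by
        rw [Nat.card_eq_fintype_card, Set.toFinset_card]
    _ ≤ _ := Finset.card_le_card h1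
    _ ≤ _ := Multiset.toFinset_card_le _
    _ ≤ _ := card_roots' _
    _ = n := hdeg

open Polynomial in
lemma X_pow_mem_aux {F : Type*} [Field F] {k n : ℕ} (h : k < n) :
    (X ^ k : F[X]) ∈ degreeLT F n := by
  rw [mem_degreeLT, degree_X_pow]
  exact_mod_cast h

/-- Let `q` be a power of a prime `p`, let `F` be the finite field with `q^6` elements,
and set `m = q^2 - q + 1`. Let `ξ ∈ F` be such that the equation `y^{q^2} - y = ξ^m`
has exactly `q^2` solutions `y ∈ F`. Then for every `η ∈ F` satisfying
`η^{q^2} - η = ξ^m`, the number of elements `θ ∈ F` with `θ^q + θ = η^{q+1}` is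
exactly `q`. -/
theorem stmt_0 (p e q : ℕ) (hp : p.Prime) (he : 0 < e) (hq : q = p ^ e)
    (F : Type*) [Field F] [Fintype F] (hF : Fintype.card F = q ^ 6)
    (m : ℕ) (hm : m = q ^ 2 - q + 1) (ξ : F)
    (hξ : Nat.card {y : F // y ^ q ^ 2 - y = ξ ^ m} = q ^ 2) :
    ∀ η : F, η ^ q ^ 2 - η = ξ ^ m →
      Nat.card {θ : F // θ ^ q + θ = η ^ (q + 1)} = q := by
  intro η hη
  haveI : Fact p.Prime := ⟨hp⟩
  haveI : CharP F p := charP_of_card_eq_prime_pow (f := e * 6) (by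
    rw [hF, hq, pow_mul])
  have hq1 : 1 < q := by rw [hq]; exact Nat.one_lt_pow he.ne' hp.one_lt
  obtain ⟨φ, hφ⟩ : ∃ φ : F →+* F, ∀ x, φ x = x ^ q :=
    ⟨iterateFrobenius F p e, fun x => by rw [iterateFrobenius_def, hq]⟩
  have hφ6 : ∀ x, φ (φ (φ (φ (φ (φ x))))) = x := by
    intro x
    simp only [hφ, ← pow_mul]
    have := FiniteField.pow_card x
    rw [hF] at this
    convert this using 2
    ring
  let L : F →+ F := φ.toAddMonoidHom + AddMonoidHom.id F
  have hL : ∀ x, L x = φ x + x := fun x => rfl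
  let P : F →+ F := φ.toAddMonoidHom
  have hP : ∀ x, P x = φ x := fun x => rfl
  let T : F →+ F := P.comp (P.comp (P.comp (P.comp P))) - P.comp (P.comp (P.comp P))
    + P.comp (P.comp P) - P.comp P + P - AddMonoidHom.id F
  have hT : ∀ x, T x = φ (φ (φ (φ (φ x)))) - φ (φ (φ (φ x))) + φ (φ (φ x)) - φ (φ x) + φ x - x :=
    fun x => rfl
  have hTL : L.range ≤ T.ker := by
    rintro _ ⟨x, rfl⟩
    rw [AddMonoidHom.mem_ker, hT, hL]
    simp only [map_add, hφ6]
    ring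
  have hkL : Nat.card L.ker ≤ q := by
    apply card_roots_aux q (Polynomial.X ^ 1 : Polynomial F) (X_pow_mem_aux hq1) (L.ker : Set F)
    intro x hx
    have : L x = 0 := hx
    rw [hL, hφ] at this
    simpa using this
  have hkT : Nat.card T.ker ≤ q ^ 5 := by
    have hlt : ∀ k, k < 5 → q ^ k < q ^ 5 := fun k hk => Nat.pow_lt_pow_right hq1 hk
    apply card_roots_aux (q ^ 5)
      (-Polynomial.X ^ (q ^ 4) + Polynomial.X ^ (q ^ 3) - Polynomial.X ^ (q ^ 2)
        + Polynomial.X ^ (q ^ 1) - Polynomial.X ^ (q ^ 0) : Polynomial F) ?_ (T.ker : Set F)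
    · intro x hx
      have : T x = 0 := hx
      rw [hT] at this
      simp only [hφ, ← pow_mul] at this
      simp only [Polynomial.eval_add, Polynomial.eval_sub, Polynomial.eval_neg,
        Polynomial.eval_pow, Polynomial.eval_X]
      rw [← this]
      ring
    · exact sub_mem (add_mem (sub_mem (add_mem (neg_mem (X_pow_mem_aux (hlt 4 (by norm_num))))
        (X_pow_mem_aux (hlt 3 (by norm_num)))) (X_pow_mem_aux (hlt 2 (by norm_num))))
        (X_pow_mem_aux (hlt 1 (by norm_num)))) (X_pow_mem_aux (hlt 0 (by norm_num)))
  have hRT : Nat.card L.range ≤ Nat.card T.ker :=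
    Nat.card_le_card_of_injective _ (AddSubgroup.inclusion_injective hTL)
  have hprod : Nat.card L.ker * Nat.card L.range = q ^ 6 := by
    rw [← AddSubgroup.index_ker, AddSubgroup.card_mul_index, Nat.card_eq_fintype_card, hF]
  have hq5 : 0 < q ^ 5 := by positivity
  have hR5 : Nat.card L.range = q ^ 5 := by
    apply le_antisymm (hRT.trans hkT)
    by_contra! h
    have : Nat.card L.ker * Nat.card L.range < q * q ^ 5 :=
      lt_of_le_of_lt (Nat.mul_le_mul_right _ hkL) (Nat.mul_lt_mul_of_pos_left h (by omega))
    rw [hprod] at this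
    exact absurd this (by rw [pow_succ' q 5]; exact lt_irrefl _)
  have hker : Nat.card L.ker = q := by
    rw [hR5, pow_succ' q 5] at hprod
    exact Nat.eq_of_mul_eq_mul_right hq5 hprod
  have hEq : L.range = T.ker := by
    apply SetLike.coe_injective
    apply Set.eq_of_subset_of_ncard_le hTL
    · change Nat.card T.ker ≤ Nat.card L.range
      omega
  -- the right-hand side lies in the kernel of `T`
  have hu : φ (φ η) = η + ξ ^ m := by
    rw [← hη, hφ, hφ, ← pow_mul, ← sq]; ring
  have hN : ξ ^ m * φ (ξ ^ m) = ξ * φ (φ (φ ξ)) := by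
    simp only [hφ, ← pow_mul]
    rw [← pow_add, ← pow_succ']
    congr 1
    have : q ≤ q ^ 2 := by nlinarith
    subst hm
    zify [this]
    ring
  generalize ξ ^ m = u at *
  have hsum : u + φ (φ u) + φ (φ (φ (φ u))) = 0 := by
    have h1 := hφ6 η
    simp only [hu, map_add] at h1
    linear_combination h1
  have hN3 : u * φ u = φ (φ (φ u)) * φ (φ (φ (φ u))) := by
    have h1 := congrArg (fun x => φ (φ (φ x))) hN
    simp only [map_mul, hφ6] at h1
    rw [hN, h1, mul_comm]
  have hmem : φ η * η ∈ L.range := by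
    rw [hEq, AddMonoidHom.mem_ker, hT]
    simp only [map_mul, map_add, hu, hφ6]
    linear_combination (φ η + φ u) * hsum - hN3
  obtain ⟨θ₀, hθ₀⟩ := hmem
  refine Eq.trans ?_ hker
  apply Nat.card_congr
  refine ⟨fun θ => ⟨θ.1 - θ₀, ?_⟩, fun k => ⟨k.1 + θ₀, ?_⟩, fun θ => by simp, fun k => by simp⟩
  · rw [AddMonoidHom.mem_ker, map_sub, hθ₀, hL, hφ, hφ, θ.2]; ring
  · have hk : L k.1 = 0 := k.2
    have : L (k.1 + θ₀) = φ η * η := by rw [map_add, hk, hθ₀, zero_add]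
    rw [hL, hφ, hφ] at this
    rw [this]; ring
end

section
/- For every ξ ∈ Ξ, the number of pairs (x, y) ∈ F × F satisfying y^{q+1} = x^q + x and y^{q^2} - y = ξ^m is exactly q^3. -/
open Polynomial in
lemma aux_roots {F : Type*} [Field F] [Fintype F] (n : ℕ) (r : F[X]) (hr : r.degree < n)
    (f : F →+ F) (hf : ∀ x, f x = (X ^ n + r).eval x) : Nat.card f.ker ≤ n := by
  classical
  have hmon : (X ^ n + r).Monic := monic_X_pow_add hr
  have hdeg : (X ^ n + r).natDegree = n := by
    rw [natDegree_eq_of_degree_eq_some]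
    rw [degree_add_eq_left_of_degree_lt] <;> simp [hr]
  have h1 : (f.ker : Set F) ⊆ ((X ^ n + r).roots.toFinset : Set F) := by
    intro x hx
    have hx0 : f x = 0 := hx
    simp only [Finset.mem_coe, Multiset.mem_toFinset]
    rw [mem_roots hmon.ne_zero, IsRoot, ← hf, hx0]
  have h2 := Set.ncard_le_ncard h1 (Finset.finite_toSet _)
  rw [Set.ncard_coe_finset] at h2
  calc Nat.card f.ker = (f.ker : Set F).ncard := rfl
    _ ≤ _ := h2
    _ ≤ Multiset.card (X ^ n + r).roots := Multiset.toFinset_card_le _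
    _ ≤ _ := card_roots' _
    _ = n := hdeg

lemma aux_exact {F : Type*} [AddCommGroup F] [Fintype F] (f g : F →+ F) (a b : ℕ)
    (hF : Fintype.card F = a * b) (hb : 0 < b)
    (hgf : ∀ x, g (f x) = 0) (ha : Nat.card f.ker ≤ a) (hgb : Nat.card g.ker ≤ b)
    (z : F) (hz : g z = 0) : Nat.card {x // f x = z} = a := by
  have h1 : Nat.card f.ker * Nat.card f.range = a * b := by
    rw [← hF, ← Nat.card_eq_fintype_card, ← AddSubgroup.card_mul_index f.ker,
      AddSubgroup.index_ker]
  have hle : f.range ≤ g.ker := by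
    rintro _ ⟨x, rfl⟩
    exact hgf x
  have h2 : Nat.card f.range ≤ Nat.card g.ker := AddSubgroup.card_le_of_le hle
  have ha0 : 0 < a := by
    have : 0 < Fintype.card F := Fintype.card_pos
    rw [hF] at this
    exact Nat.pos_of_mul_pos_right this |> fun h => by
      rcases Nat.eq_zero_or_pos a with h0 | h0
      · simp [h0] at this
      · exact h0
  have h3 : Nat.card f.range = b := by
    apply le_antisymm (h2.trans hgb)
    by_contra h
    push Not at h
    have : Nat.card f.ker * Nat.card f.range < a * b :=
      lt_of_le_of_lt (Nat.mul_le_mul_right _ ha) (Nat.mul_lt_mul_of_pos_left h ha0)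
    omega
  have h4 : Nat.card f.ker = a := by
    rw [h3] at h1
    exact Nat.eq_of_mul_eq_mul_right hb h1
  have h5 : f.range = g.ker := by
    apply SetLike.coe_injective
    apply Set.eq_of_subset_of_ncard_le hle
    · change Nat.card g.ker ≤ Nat.card f.range
      omega
  obtain ⟨x0, hx0⟩ : z ∈ f.range := by rw [h5]; exact hz
  rw [← h4]
  refine Nat.card_congr ⟨fun x => ⟨x.1 - x0, ?_⟩, fun x => ⟨x.1 + x0, ?_⟩, ?_, ?_⟩
  · rw [AddMonoidHom.mem_ker, map_sub, x.2, hx0, sub_self]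
  · have := x.2
    rw [AddMonoidHom.mem_ker] at this
    rw [map_add, this, hx0, zero_add]
  · intro x; simp
  · intro x; simp

open Polynomial in
/-- Let `q` be a power of a prime `p`, `F` the finite field with `q^6` elements,
`m = q^2 - q + 1`, and `Ξ = {ξ ∈ F : ξ^{m q^4} + ξ^{m q^2} + ξ^m = 0}`.
For every `ξ ∈ Ξ`, the number of pairs `(x, y) ∈ F × F` satisfying
`y^{q+1} = x^q + x` and `y^{q^2} - y = ξ^m` is exactly `q^3`. -/
theorem stmt_1 (p e q : ℕ) (hp : p.Prime) (he : 0 < e) (hq : q = p ^ e)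
    (F : Type*) [Field F] [Fintype F] (hF : Fintype.card F = q ^ 6)
    (m : ℕ) (hm : m = q ^ 2 - q + 1) (ξ : F)
    (hξ : ξ ^ (m * q ^ 4) + ξ ^ (m * q ^ 2) + ξ ^ m = 0) :
    Nat.card {xy : F × F // xy.2 ^ (q + 1) = xy.1 ^ q + xy.1 ∧
      xy.2 ^ q ^ 2 - xy.2 = ξ ^ m} = q ^ 3 := by
  classical
  have : Fact p.Prime := ⟨hp⟩
  have : CharP F p := by
    apply charP_of_card_eq_prime_pow (f := e * 6)
    rw [hF, hq, pow_mul]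
  have hq1 : 1 < q := by rw [hq]; exact Nat.one_lt_pow he.ne' hp.one_lt
  set φ : F →+* F := iterateFrobenius F p e with hφdef
  have hφ : ∀ x, φ x = x ^ q := by
    intro x; rw [hφdef, iterateFrobenius_def, hq]
  have h2 : ∀ x, φ (φ x) = x ^ q ^ 2 := by intro x; simp only [hφ]; ring
  have h3 : ∀ x, φ (φ (φ x)) = x ^ q ^ 3 := by intro x; simp only [hφ]; ring
  have h4 : ∀ x, φ (φ (φ (φ x))) = x ^ q ^ 4 := by intro x; simp only [hφ]; ring
  have h5 : ∀ x, φ (φ (φ (φ (φ x)))) = x ^ q ^ 5 := by intro x; simp only [hφ]; ring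
  have h6 : ∀ x, φ (φ (φ (φ (φ (φ x))))) = x := by
    intro x
    have : φ (φ (φ (φ (φ (φ x))))) = x ^ q ^ 6 := by simp only [hφ]; ring
    rw [this, ← hF, FiniteField.pow_card]
  let f : F →+ F := φ.toAddMonoidHom
  let A : F →+ F := f.comp f - AddMonoidHom.id F
  let T : F →+ F := f.comp (f.comp (f.comp f)) + (f.comp f + AddMonoidHom.id F)
  let L : F →+ F := f + AddMonoidHom.id F
  let S : F →+ F := f.comp (f.comp (f.comp (f.comp f))) + (-f.comp (f.comp (f.comp f))
    + f.comp (f.comp f) - f.comp f + f - AddMonoidHom.id F)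
  have hA : ∀ x, A x = φ (φ x) - x := fun x => rfl
  have hT : ∀ x, T x = φ (φ (φ (φ x))) + (φ (φ x) + x) := fun x => rfl
  have hL : ∀ x, L x = φ x + x := fun x => rfl
  have hS : ∀ x, S x = φ (φ (φ (φ (φ x)))) + (-φ (φ (φ (φ x))) + φ (φ (φ x)) - φ (φ x) + φ x - x) :=
    fun x => rfl
  clear_value A T L S f
  clear_value φ
  have hlt : ∀ i j : ℕ, i < j → (X ^ q ^ i : F[X]) ∈ degreeLT F (q ^ j) := by
    intro i j hij
    rw [mem_degreeLT, degree_X_pow]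
    exact_mod_cast Nat.pow_lt_pow_right hq1 hij
  have hX : ∀ j : ℕ, 0 < j → (X : F[X]) ∈ degreeLT F (q ^ j) := by
    intro j hj
    simpa using hlt 0 j hj
  have kA : Nat.card A.ker ≤ q ^ 2 := by
    apply aux_roots (q ^ 2) (-X) (mem_degreeLT.1 (neg_mem (hX 2 (by norm_num))))
    intro x
    rw [hA, h2]; simp [sub_eq_add_neg]
  have kT : Nat.card T.ker ≤ q ^ 4 := by
    apply aux_roots (q ^ 4) (X ^ q ^ 2 + X)
      (mem_degreeLT.1 (add_mem (hlt 2 4 (by norm_num)) (hX 4 (by norm_num))))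
    intro x
    rw [hT, h4, h2]; simp
  have kL : Nat.card L.ker ≤ q := by
    have := aux_roots (q ^ 1) X (mem_degreeLT.1 (hX 1 (by norm_num))) L (by
      intro x
      rw [hL, hφ]; simp)
    simpa using this
  have kS : Nat.card S.ker ≤ q ^ 5 := by
    apply aux_roots (q ^ 5) (-X ^ q ^ 4 + X ^ q ^ 3 - X ^ q ^ 2 + X ^ q ^ 1 - X)
      (mem_degreeLT.1 (sub_mem (add_mem (sub_mem (add_mem (neg_mem (hlt 4 5 (by norm_num)))
        (hlt 3 5 (by norm_num))) (hlt 2 5 (by norm_num))) (hlt 1 5 (by norm_num)))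
        (hX 5 (by norm_num))))
    intro x
    rw [hS, h5, h4, h3, h2, hφ]; simp
  have hTA : ∀ x, T (A x) = 0 := by
    intro x
    rw [hT, hA]; simp only [map_sub, h6]; ring
  have hSL : ∀ x, S (L x) = 0 := by
    intro x
    rw [hS, hL]; simp only [map_add, h6]; ring
  have hq0 : 0 < q := by omega
  have cA := aux_exact A T (q ^ 2) (q ^ 4) (by rw [hF]; ring) (by positivity) hTA kA kT
  have cL := aux_exact L S q (q ^ 5) (by rw [hF]; ring) (by positivity) hSL kL kS
  have hTξ : T (ξ ^ m) = 0 := by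
    rw [hT, h4, h2, ← pow_mul, ← pow_mul, ← add_assoc]; exact hξ
  have hmq : m * (q + 1) = q ^ 3 + 1 := by
    obtain ⟨k, rfl⟩ : ∃ k, q = k + 1 := ⟨q - 1, by omega⟩
    have : m = (k + 1) * k + 1 := by
      rw [hm]; congr 1
      rw [Nat.sub_eq_iff_eq_add (by nlinarith)]; ring
    rw [this]; ring
  have hfix : φ (φ (φ (ξ ^ m * φ (ξ ^ m)))) = ξ ^ m * φ (ξ ^ m) := by
    have : ξ ^ m * φ (ξ ^ m) = φ (φ (φ ξ)) * ξ := by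
      rw [hφ (ξ ^ m), h3, ← pow_succ, ← hmq, pow_mul, pow_succ, mul_comm]
    rw [this]; simp only [map_mul, h6]; ring
  have key : ∀ y, A y = ξ ^ m → S (y ^ (q + 1)) = 0 := by
    intro y hy
    rw [hT] at hTξ
    generalize ξ ^ m = a at *
    rw [hA] at hy
    have e2 : φ (φ y) = y + a := by rw [← hy]; ring
    have e : y ^ (q + 1) = φ y * y := by rw [hφ, pow_succ]
    rw [e, hS]
    simp only [map_mul, map_add, e2] at hfix ⊢
    linear_combination hfix + (φ y + φ a) * hTξ
  have e1 : {xy : F × F // xy.2 ^ (q + 1) = xy.1 ^ q + xy.1 ∧ xy.2 ^ q ^ 2 - xy.2 = ξ ^ m} ≃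
      Σ y : {y : F // A y = ξ ^ m}, {x : F // L x = y.1 ^ (q + 1)} :=
    { toFun := fun t => ⟨⟨t.1.2, by rw [hA, h2]; exact t.2.2⟩,
        ⟨t.1.1, by rw [hL, hφ]; exact t.2.1.symm⟩⟩
      invFun := fun t => ⟨(t.2.1, t.1.1), by
        have := t.2.2
        rw [hL, hφ] at this
        exact this.symm, by
        have := t.1.2
        rw [hA, h2] at this
        exact this⟩
      left_inv := fun t => rfl
      right_inv := fun t => rfl }
  rw [Nat.card_congr e1, Nat.card_sigma,
    Finset.sum_congr rfl (fun y _ => cL _ (key y.1 y.2)), Finset.sum_const, Finset.card_univ,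
    ← Nat.card_eq_fintype_card, cA _ hTξ, smul_eq_mul]
  ring
end

section
/- The set Ξ has exactly q^5 - q^3 + q^2 elements. -/
lemma aux_fiber {G H : Type*} [Group G] [Group H] [Finite G] [Finite H] (f : G →* H)
    (hf : Function.Surjective f) (P : H → Prop) :
    Nat.card {g : G // P (f g)} = Nat.card {h : H // P h} * Nat.card f.ker := by
  have e : {g : G // P (f g)} ≃ Σ h : {h : H // P h}, {g : G // f g = h.1} :=
    { toFun := fun g => ⟨⟨f g.1, g.2⟩, ⟨g.1, rfl⟩⟩
      invFun := fun x => ⟨x.2.1, by rw [x.2.2]; exact x.1.2⟩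
      left_inv := fun g => rfl
      right_inv := by
        rintro ⟨⟨h, hh⟩, ⟨g, hg⟩⟩
        dsimp only at hg
        subst hg
        rfl }
  have e2 : (Σ h : {h : H // P h}, {g : G // f g = h.1}) ≃ {h : H // P h} × f.ker :=
    (Equiv.sigmaCongrRight fun h : {h : H // P h} => f.fiberEquivKerOfSurjective hf h.1).trans
      (Equiv.sigmaEquivProd _ _)
  rw [Nat.card_congr (e.trans e2), Nat.card_prod]

lemma aux_units {F : Type*} [Field F] [Finite F] (P : F → Prop) (h0 : P 0) :
    Nat.card {x : F // P x} = Nat.card {u : Fˣ // P u} + 1 := by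
  classical
  have e : {x : F // P x} ≃ Option {u : Fˣ // P u} :=
    { toFun := fun x => if h : x.1 = 0 then none else some ⟨Units.mk0 x.1 h, x.2⟩
      invFun := fun o => o.elim ⟨0, h0⟩ fun u => ⟨u.1, u.2⟩
      left_inv := by
        rintro ⟨x, hx⟩
        by_cases h : x = 0
        · subst h; simp
        · simp [h]
      right_inv := by
        rintro (_ | ⟨u, hu⟩)
        · simp
        · simp }
  rw [Nat.card_congr e, Finite.card_option]

lemma aux_roots_s2 {F : Type*} [Field F] [Finite F] (d : ℕ) (hd : d ∣ Nat.card Fˣ) :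
    Nat.card {u : Fˣ // u ^ d = 1} = d := by
  have := IsCyclic.card_powMonoidHom_ker (G := Fˣ) d
  rw [Nat.gcd_eq_right hd] at this
  exact this

lemma aux_poly {F : Type*} [Field F] [Finite F] (q : ℕ) (hq : 2 ≤ q) :
    Nat.card {y : F // y ^ q ^ 2 + y ^ q + y = 0} ≤ q ^ 2 := by
  classical
  open Polynomial in
  let P : F[X] := X ^ q ^ 2 + X ^ q + X
  have hc : P.coeff 1 = 1 := by
    have h1 : (1:ℕ) ≠ q ^ 2 := by nlinarith
    have h2 : (1:ℕ) ≠ q := by omega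
    simp [P, Polynomial.coeff_X_pow, h1, h2]
  have hP : P ≠ 0 := by
    intro h; rw [h] at hc; simp at hc
  have hdeg : P.natDegree ≤ q ^ 2 := by
    have h1 : 1 ≤ q ^ 2 := by nlinarith
    have h2 : q ≤ q ^ 2 := by nlinarith
    refine Polynomial.natDegree_add_le_of_degree_le
      (Polynomial.natDegree_add_le_of_degree_le ?_ ?_) ?_
    · simp
    · simpa using h2
    · simpa using h1
  have := Fintype.ofFinite F
  calc Nat.card {y : F // y ^ q ^ 2 + y ^ q + y = 0}
      ≤ P.roots.toFinset.card := by
        rw [← Nat.card_eq_finsetCard]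
        refine Nat.card_le_card_of_injective
          (fun y => ⟨y.1, by
            rw [Multiset.mem_toFinset, Polynomial.mem_roots hP]
            simpa [P] using y.2⟩) ?_
        intro a b h
        simpa [Subtype.ext_iff] using h
    _ ≤ Multiset.card P.roots := Multiset.toFinset_card_le _
    _ ≤ P.natDegree := Polynomial.card_roots' P
    _ ≤ q ^ 2 := hdeg

lemma aux_fix {F : Type*} [Field F] [Finite F] (n : ℕ) (hd : n ∣ Nat.card Fˣ) :
    Nat.card {y : F // y ^ (n + 1) = y} = n + 1 := by
  rw [aux_units (fun y : F => y ^ (n + 1) = y) (by simp)]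
  congr 1
  refine Eq.trans ?_ (aux_roots_s2 n hd)
  refine Nat.card_congr (Equiv.subtypeEquivRight fun u => ?_)
  rw [← Units.val_pow_eq_pow_val, Units.val_inj, pow_succ]
  simp

lemma aux_trace {F : Type*} [Field F] [Finite F] (q r : ℕ) (hqr : q = r + 1) (hr : 0 < r)
    (hadd : ∀ x y : F, (x + y) ^ q = x ^ q + y ^ q)
    (h1 : r ∣ Nat.card Fˣ) (h3 : r * (q ^ 2 + q + 1) ∣ Nat.card Fˣ) :
    Nat.card {y : F // y ^ q ^ 2 + y ^ q + y = 0} = q ^ 2 := by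
  apply le_antisymm (aux_poly q (by omega))
  have hq0 : q ≠ 0 := by omega
  let φ : F →+ F :=
    { toFun := fun x => x ^ q, map_zero' := by simp [hq0], map_add' := hadd }
  have φa : ∀ x, φ x = x ^ q := fun _ => rfl
  let t : F →+ F := φ.comp φ + φ + AddMonoidHom.id F
  have ta : ∀ x, t x = x ^ q ^ 2 + x ^ q + x := by
    intro x
    simp [t, φa, ← pow_mul, pow_two]
  let K : AddSubgroup F := (φ.comp (φ.comp φ) - AddMonoidHom.id F).ker
  have memK : ∀ x, x ∈ K ↔ x ^ q ^ 3 = x := by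
    intro x
    have : q ^ 3 = q * q * q := by ring
    simp [K, AddMonoidHom.mem_ker, φa, ← pow_mul, sub_eq_zero, this]
  have hq3 : q ^ 3 = r * (q ^ 2 + q + 1) + 1 := by subst hqr; ring
  have cK : Nat.card K = q ^ 3 := by
    rw [hq3, ← aux_fix _ h3]
    exact Nat.card_congr (Equiv.subtypeEquivRight fun x => by rw [memK, hq3])
  let s : K →+ F := t.comp K.subtype
  have hmul : Nat.card s.ker * Nat.card s.range = q ^ 3 := by
    rw [← cK, ← s.ker.card_mul_index, AddSubgroup.index_ker]
  have hrange : Nat.card s.range ≤ q := by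
    have := aux_fix (F := F) r h1
    rw [← hqr] at this
    rw [← this]
    refine Nat.card_le_card_of_injective (fun y : s.range => ⟨y.1, ?_⟩) ?_
    · obtain ⟨_, ⟨x, hx⟩, rfl⟩ := y
      have hx' := (memK x).1 hx
      change (t x) ^ q = t x
      rw [ta, hadd, hadd, ← pow_mul, ← pow_mul, ← pow_succ, hx']
      ring
    · intro a b h
      exact Subtype.ext (Subtype.mk.inj h)
  have hker : Nat.card s.ker ≤ Nat.card {y : F // y ^ q ^ 2 + y ^ q + y = 0} := by
    refine Nat.card_le_card_of_injective (fun y : s.ker => ⟨y.1.1, ?_⟩) ?_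
    · rw [← ta]; exact y.2
    · intro a b h
      exact Subtype.ext (Subtype.ext (Subtype.mk.inj h))
  refine le_trans ?_ hker
  by_contra! hlt
  have : Nat.card s.ker * Nat.card s.range < q ^ 3 :=
    calc _ ≤ Nat.card s.ker * q := Nat.mul_le_mul_left _ hrange
      _ < q ^ 2 * q := Nat.mul_lt_mul_of_pos_right hlt (by omega)
      _ = q ^ 3 := by ring
  omega

lemma aux_main {F : Type*} [Field F] [Finite F] (q r m : ℕ) (hqr : q = r + 1) (hr : 0 < r)
    (hm : m = q * r + 1)
    (hadd : ∀ x y : F, (x + y) ^ q = x ^ q + y ^ q)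
    (hN : Nat.card Fˣ = r * (q + 1) * (q ^ 2 + q + 1) * m) :
    Nat.card {ξ : F // ξ ^ (m * q ^ 4) + ξ ^ (m * q ^ 2) + ξ ^ m = 0}
      = (r * (q + 1)) * (q + 1) * m + 1 := by
  have hq0 : q ≠ 0 := by omega
  have hm0 : m ≠ 0 := by omega
  rw [aux_units (fun ξ : F => ξ ^ (m * q ^ 4) + ξ ^ (m * q ^ 2) + ξ ^ m = 0)
    (by simp [hq0, hm0])]
  congr 1
  set k := r * (q ^ 2 + q + 1) with hk
  set c := m * (r * (q + 1)) with hc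
  have dk : k ∣ Nat.card Fˣ := ⟨(q + 1) * m, by rw [hN, hk]; ring⟩
  have dc : c ∣ Nat.card Fˣ := ⟨q ^ 2 + q + 1, by rw [hN, hc]; ring⟩
  have dr : r ∣ Nat.card Fˣ := ⟨(q + 1) * (q ^ 2 + q + 1) * m, by rw [hN]; ring⟩
  have hq3 : q ^ 3 = k + 1 := by rw [hk]; subst hqr; ring
  have hq2 : q ^ 2 = r * (q + 1) + 1 := by subst hqr; ring
  -- coprimality
  have hodd : Nat.Coprime m 2 := by
    rw [Nat.coprime_two_right, hm, hqr]
    exact (Nat.even_mul_succ_self r).add_one |> fun h => by rwa [mul_comm] at h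
  have hkm : Nat.Coprime k m := by
    have e1 : k + 2 = (q + 1) * m := by rw [hk, hm]; subst hqr; ring
    have g1 : Nat.gcd k m ∣ m := Nat.gcd_dvd_right _ _
    have g2 : Nat.gcd k m ∣ 2 :=
      (Nat.dvd_add_right (Nat.gcd_dvd_left k m)).1 (e1 ▸ g1.mul_left (q + 1))
    exact Nat.dvd_one.1 (hodd ▸ Nat.dvd_gcd g1 g2)
  have hgcd : Nat.gcd k c = r := by
    have c1 : Nat.Coprime (q ^ 2 + q + 1) (q + 1) := by
      rw [show q ^ 2 + q + 1 = 1 + (q + 1) * q by ring]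
      simp
    have c2 : Nat.Coprime (q ^ 2 + q + 1) m := Nat.Coprime.coprime_mul_left hkm
    rw [hk, hc, show m * (r * (q + 1)) = r * (m * (q + 1)) by ring, Nat.gcd_mul_left,
      (c2.mul_right c1 : Nat.gcd _ _ = 1), mul_one]
  let K : Subgroup Fˣ := (powMonoidHom k : Fˣ →* Fˣ).ker
  let C : Subgroup Fˣ := (powMonoidHom c : Fˣ →* Fˣ).ker
  have memK : ∀ x, x ∈ K ↔ x ^ k = 1 := fun x => Iff.rfl
  have memC : ∀ x, x ∈ C ↔ x ^ c = 1 := fun x => Iff.rfl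
  have cK : Nat.card K = k := aux_roots_s2 k dk
  have cC : Nat.card C = c := aux_roots_s2 c dc
  let f : K × C →* Fˣ := K.subtype.coprod C.subtype
  have fa : ∀ x, f x = x.1.1 * x.2.1 := fun _ => rfl
  have aux : ∀ {x : Fˣ}, x ^ r = 1 → x ^ k.gcd c = 1 := fun h => by rw [hgcd]; exact h
  have cker : Nat.card f.ker = r := by
    rw [← aux_roots_s2 (F := F) r dr]
    refine Nat.card_congr
      { toFun := fun x => ⟨x.1.1.1, ?_⟩
        invFun := fun a => ⟨(⟨a.1, ?_⟩, ⟨a.1⁻¹, ?_⟩), ?_⟩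
        left_inv := ?_
        right_inv := ?_ }
    · obtain ⟨⟨⟨x, hx⟩, ⟨y, hy⟩⟩, h⟩ := x
      have h' : x * y = 1 := h
      have hy' := (memC y).1 hy
      rw [eq_inv_of_mul_eq_one_right h', inv_pow, inv_eq_one] at hy'
      change x ^ r = 1
      rw [← hgcd]
      exact pow_gcd_eq_one.2 ⟨(memK x).1 hx, hy'⟩
    · have := a.2
      exact (pow_gcd_eq_one.1 (aux this)).1
    · have := a.2
      rw [memC, inv_pow, (pow_gcd_eq_one.1 (aux this)).2, inv_one]
    · rw [MonoidHom.mem_ker, fa]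
      simp
    · rintro ⟨⟨⟨x, hx⟩, ⟨y, hy⟩⟩, h⟩
      have h' : x * y = 1 := h
      simp [eq_inv_of_mul_eq_one_right h']
    · intro a; rfl
  have hsurj : Function.Surjective f := by
    rw [← MonoidHom.range_eq_top]
    apply Subgroup.eq_top_of_card_eq
    have h := f.ker.card_mul_index
    rw [Subgroup.index_ker, cker, Nat.card_prod, cK, cC] at h
    apply Nat.eq_of_mul_eq_mul_left hr
    rw [h, hN, hk, hc]; ring
  have key := aux_fiber f hsurj
    (fun u : Fˣ => (u : F) ^ (m * q ^ 4) + (u : F) ^ (m * q ^ 2) + (u : F) ^ m = 0)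
  rw [cker] at key
  -- the K part
  have cZ : Nat.card {y : Fˣ // (y : F) ^ q ^ 2 + (y : F) ^ q + y = 0} = r * (q + 1) := by
    have h1 := aux_trace (F := F) q r hqr hr hadd dr dk
    rw [aux_units (fun y : F => y ^ q ^ 2 + y ^ q + y = 0) (by simp [hq0])] at h1
    omega
  have Zsub : ∀ y : Fˣ, (y : F) ^ q ^ 2 + (y : F) ^ q + y = 0 → y ∈ K := by
    intro y hy
    have h2 : ((y : F) ^ q ^ 2 + (y : F) ^ q + y) ^ q = 0 := by rw [hy]; simp [hq0]
    rw [hadd, hadd, ← pow_mul, ← pow_mul, ← pow_succ] at h2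
    have h3 : (y : F) ^ q ^ 3 = y := by
      have : (y : F) ^ (q * q) = y ^ q ^ 2 := by rw [pow_two]
      rw [this] at h2
      linear_combination h2 - hy
    rw [memK]
    rw [hq3, ← Units.val_pow_eq_pow_val, Units.val_inj, pow_succ] at h3
    simpa using h3
  have cA : Nat.card {a : K // ((a : Fˣ) : F) ^ (m * q ^ 2) + ((a : Fˣ) : F) ^ (m * q)
      + ((a : Fˣ) : F) ^ m = 0} = r * (q + 1) := by
    have hcop : (Nat.card K).Coprime m := by rw [cK]; exact hkm
    rw [← cZ]
    refine Nat.card_congr (((powCoprime hcop).subtypeEquiv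
      (q := fun a : K => ((a : Fˣ) : F) ^ q ^ 2 + ((a : Fˣ) : F) ^ q + ((a : Fˣ) : F) = 0)
      ?_).trans (Equiv.subtypeSubtypeEquivSubtype
        (q := fun y : Fˣ => (y : F) ^ q ^ 2 + (y : F) ^ q + y = 0) (Zsub _)))
    intro a
    simp [powCoprime, pow_mul]
  have split : ∀ x : K × C,
      ((f x : F) ^ (m * q ^ 4) + (f x : F) ^ (m * q ^ 2) + (f x : F) ^ m = 0) ↔
      (((x.1 : Fˣ) : F) ^ (m * q ^ 2) + ((x.1 : Fˣ) : F) ^ (m * q)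
      + ((x.1 : Fˣ) : F) ^ m = 0) := by
    rintro ⟨⟨a, ha⟩, ⟨b, hb⟩⟩
    rw [fa]
    have ha' : (a : F) ^ q ^ 3 = a := by
      rw [hq3, pow_succ, ← Units.val_pow_eq_pow_val, (memK a).1 ha]; simp
    have hb' : ((b : F) ^ m) ^ q ^ 2 = (b : F) ^ m := by
      rw [hq2, pow_succ, ← pow_mul, ← hc, ← Units.val_pow_eq_pow_val, (memC b).1 hb]; simp
    have hb4 : ((b : F) ^ m) ^ q ^ 4 = (b : F) ^ m := by
      rw [show q ^ 4 = q ^ 2 * q ^ 2 by ring, pow_mul, hb', hb']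
    have ha4 : (a : F) ^ (m * q ^ 4) = (a : F) ^ (m * q) := by
      rw [show m * q ^ 4 = q ^ 3 * (m * q) by ring, pow_mul, ha']
    have hbm : (b : F) ^ m ≠ 0 := pow_ne_zero _ b.ne_zero
    simp only [Units.val_mul, mul_pow, ha4]
    rw [pow_mul (b : F), pow_mul (b : F), hb', hb4, ← add_mul, ← add_mul, mul_eq_zero,
      or_iff_left hbm, add_comm ((a : F) ^ (m * q))]
  have e : {x : K × C // (f x : F) ^ (m * q ^ 4) + (f x : F) ^ (m * q ^ 2) + (f x : F) ^ m = 0} ≃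
      {a : K // ((a : Fˣ) : F) ^ (m * q ^ 2) + ((a : Fˣ) : F) ^ (m * q)
      + ((a : Fˣ) : F) ^ m = 0} × C :=
    { toFun := fun x => (⟨x.1.1, (split x.1).1 x.2⟩, x.1.2)
      invFun := fun y => ⟨(y.1.1, y.2), (split _).2 y.1.2⟩
      left_inv := fun _ => rfl
      right_inv := fun _ => rfl }
  rw [Nat.card_congr e, Nat.card_prod, cA, cC] at key
  apply Nat.eq_of_mul_eq_mul_right hr
  rw [← key, hc]; ring

/-- Let `q` be a power of a prime `p`, `F` the finite field with `q^6` elements,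
`m = q^2 - q + 1`, and `Ξ = {ξ ∈ F : ξ^{m q^4} + ξ^{m q^2} + ξ^m = 0}`.
Then `Ξ` has exactly `q^5 - q^3 + q^2` elements. -/
theorem stmt_2 (p e q : ℕ) (hp : p.Prime) (he : 0 < e) (hq : q = p ^ e)
    (F : Type*) [Field F] [Fintype F] (hF : Fintype.card F = q ^ 6)
    (m : ℕ) (hm : m = q ^ 2 - q + 1) :
    Nat.card {ξ : F // ξ ^ (m * q ^ 4) + ξ ^ (m * q ^ 2) + ξ ^ m = 0}
      = q ^ 5 - q ^ 3 + q ^ 2 := by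

  have hq2 : 2 ≤ q := by
    rw [hq]; exact hp.two_le.trans (Nat.le_self_pow he.ne' p)
  obtain ⟨r, hqr⟩ : ∃ r, q = r + 1 := ⟨q - 1, by omega⟩
  have hr : 0 < r := by omega
  have hm' : m = q * r + 1 := by
    rw [hm]
    have : q ^ 2 = q * r + q := by subst hqr; ring
    omega
  have hfact : Fact p.Prime := ⟨hp⟩
  have hchar : CharP F p := by
    have hc : Fintype.card F = p ^ (e * 6) := by rw [hF, hq, pow_mul]
    exact charP_of_card_eq_prime_pow hc
  have hadd : ∀ x y : F, (x + y) ^ q = x ^ q + y ^ q := by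
    intro x y
    rw [hq]; exact add_pow_char_pow x y p e
  have hN : Nat.card Fˣ = r * (q + 1) * (q ^ 2 + q + 1) * m := by
    rw [Nat.card_units, Nat.card_eq_fintype_card, hF, hm']
    have : q ^ 6 = r * (q + 1) * (q ^ 2 + q + 1) * (q * r + 1) + 1 := by subst hqr; ring
    omega
  rw [aux_main q r m hqr hr hm' hadd hN, hm']
  have h1 : q ^ 5 = q ^ 3 + (r * (q + 1)) * q ^ 3 := by subst hqr; ring
  have h2 : (r * (q + 1)) * (q + 1) * (q * r + 1) + 1 = (r * (q + 1)) * q ^ 3 + q ^ 2 := by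
    subst hqr; ring
  omega
end

section
/- In the polynomial ring F[Z] one has the identity ∏_{ξ ∈ Ξ} (Z - ξ) = Z^{q^5 - q^3 + q^2} + Z^{q^5 - q^4 + q^2 - q + 1} + Z; in particular, the polynomial f(Z) = Z^{q^5 - q^3 + q^2} + Z^{q^5 - q^4 + q^2 - q + 1} + Z factorizes completely over F into distinct linear factors whose roots are exactly the elements of Ξ. -/
open Polynomial

theorem aux_exps (q : ℕ) (h2 : 2 ≤ q) : q < q^2 ∧ q^2 < q^3 ∧ q^3 < q^4 ∧ q^4 < q^5 ∧ q^5 < q^6 := by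
  refine ⟨?_, ?_, ?_, ?_, ?_⟩
  · calc q = q^1 := (pow_one q).symm
      _ < q^2 := Nat.pow_lt_pow_right h2 (by norm_num)
  all_goals exact Nat.pow_lt_pow_right h2 (by norm_num)

theorem aux_AB {R : Type*} [CommRing R] (x : R) (q : ℕ) (h2 : 2 ≤ q) :
    x ^ (q ^ 5 - q ^ 3 + q ^ 2) * x ^ q^3 = x^q^5 * x^q^2 ∧
    x ^ (q ^ 5 - q ^ 4 + q ^ 2 - q + 1) * x^q^4 * x^q = x^q^5 * x^q^2 * x := by
  obtain ⟨h1, h2, h3, h4, h5⟩ := aux_exps q h2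
  constructor
  · rw [← pow_add, ← pow_add]; congr 1; omega
  · rw [← pow_add, ← pow_add, ← pow_add, ← pow_succ]; congr 1; omega

theorem aux_dvd (p e q : ℕ) (hp : p.Prime) (hq : q = p ^ e) (h2 : 2 ≤ q)
    (F : Type*) [Field F] [CharP F p] :
    (X ^ (q ^ 5 - q ^ 3 + q ^ 2) + X ^ (q ^ 5 - q ^ 4 + q ^ 2 - q + 1) + X : F[X]) ∣
      X ^ q ^ 6 - X := by
  have := Fact.mk hp
  obtain ⟨hA, hB⟩ := aux_AB (X : F[X]) q h2
  obtain ⟨h1, h2', h3, h4, h5⟩ := aux_exps q h2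
  set f : F[X] := X ^ (q ^ 5 - q ^ 3 + q ^ 2) + X ^ (q ^ 5 - q ^ 4 + q ^ 2 - q + 1) + X with hf
  have hfq : f ^ q = (X ^ (q ^ 5 - q ^ 3 + q ^ 2)) ^ q
      + (X ^ (q ^ 5 - q ^ 4 + q ^ 2 - q + 1)) ^ q + X ^ q := by
    rw [hf]; subst hq
    rw [add_pow_char_pow, add_pow_char_pow]
  have hs : ∀ i, ((X : F[X]) ^ q ^ i) ^ q = X ^ q ^ (i+1) := fun i => by
    rw [← pow_mul, pow_succ]
  have hA' := congrArg (· ^ q) hA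
  have hB' := congrArg (· ^ q) hB
  have hs1 : ((X : F[X]) ^ q) ^ q = X ^ q ^ 2 := by rw [← pow_mul, sq]
  simp only [mul_pow, hs, hs1] at hA' hB'
  norm_num only at hA' hB'
  have hdq : f ∣ f ^ q := dvd_pow_self f (by omega)
  obtain ⟨k, hk⟩ := hdq
  rw [hk] at hfq
  set a := q ^ 5 - q ^ 3 + q ^ 2 - 1 with ha
  set b := q ^ 5 - q ^ 4 + q ^ 2 - q with hb
  have ha1 : q ^ 5 - q ^ 3 + q ^ 2 = a + 1 := by omega
  let g : F[X] := X ^ a + X ^ b + 1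
  have hfg : f = X * g := by
    rw [hf, ha1]; simp only [g]; ring
  have hcop : IsCoprime g X := by
    refine ⟨1, -(X ^ (a-1) + X ^ (b-1)), ?_⟩
    have e1 : (X : F[X]) ^ a = X ^ (a-1) * X := by rw [← pow_succ]; congr 1; omega
    have e2 : (X : F[X]) ^ b = X ^ (b-1) * X := by rw [← pow_succ]; congr 1; omega
    simp only [g]; rw [e1, e2]; ring
  have e6 : (X : F[X]) ^ q ^ 6 = X * X ^ (q ^ 6 - 1) := by rw [← pow_succ']; congr 1; omega
  have key : f ∣ (X ^ q ^ 3 * (X ^ q) ^ 2 * (X ^ q ^ 4) ^ 2) * (X ^ q ^ 6 - X) := by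
    generalize (X : F[X]) ^ (q ^ 5 - q ^ 3 + q ^ 2) = A at *
    generalize (X : F[X]) ^ (b + 1) = B at *
    clear_value f
    generalize (X : F[X]) ^ q ^ 6 = x6 at *
    generalize (X : F[X]) ^ q ^ 5 = x5 at *
    generalize (X : F[X]) ^ q ^ 4 = x4 at *
    generalize (X : F[X]) ^ q ^ 3 = x3 at *
    generalize (X : F[X]) ^ q ^ 2 = x2 at *
    generalize (X : F[X]) ^ q = x1 at *
    generalize (X : F[X]) = x0 at *
    have E1 : x1*x3*x4*f = x5*x2*(x1*x4+x0*x3) + x0*x1*x3*x4 := by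
      rw [hf]; linear_combination x1*x4*hA + x3*hB
    have E2 : x2*x4*x5*(f*k) = x6*x3*(x2*x5+x1*x4)+x1*x2*x4*x5 := by
      rw [hfq]; linear_combination x2*x5*hA' + x4*hB'
    refine ⟨(x1*x4+x0*x3)*x2*x4*x5*k - x6*x3*(x1*x3*x4) - x1*x4*(x1*x3*x4), ?_⟩
    linear_combination (x6*x3 + x1*x4)*E1 - (x1*x4+x0*x3)*E2
  have hg1 : g ∣ X ^ q ^ 6 - X := by
    refine IsCoprime.dvd_of_dvd_mul_left ?_ ((Dvd.intro_left X hfg.symm).trans key)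
    exact ((hcop.pow_right.mul_right hcop.pow_right.pow_right).mul_right hcop.pow_right.pow_right)
  have e7 : (X : F[X]) ^ q ^ 6 - X = X * (X ^ (q ^ 6 - 1) - 1) := by rw [e6]; ring
  rw [e7] at hg1 ⊢
  rw [hfg]
  exact mul_dvd_mul_left _ (hcop.dvd_of_dvd_mul_left hg1)

theorem aux_root (q : ℕ) (h2 : 2 ≤ q) {F : Type*} [Field F] (z : F) (hz : z ^ q ^ 6 = z)
    (m : ℕ) (hm : m = q ^ 2 - q + 1) :
    z ^ (q ^ 5 - q ^ 3 + q ^ 2) + z ^ (q ^ 5 - q ^ 4 + q ^ 2 - q + 1) + z = 0 ↔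
      z ^ (m * q ^ 4) + z ^ (m * q ^ 2) + z ^ m = 0 := by
  obtain ⟨h1, h2', h3, h4, h5⟩ := aux_exps q h2
  by_cases h0 : z = 0
  · subst h0
    have hm0 : m ≠ 0 := by omega
    have hq0 : q ≠ 0 := by omega
    rw [zero_pow, zero_pow, zero_pow (by positivity), zero_pow (by positivity), zero_pow hm0]
    · simp
    · omega
  obtain ⟨hA, hB⟩ := aux_AB z q h2
  have hmq : m + q = q ^ 2 + 1 := by omega
  have c0 : z ^ m * z ^ q = z ^ q ^ 2 * z := by rw [← pow_add, ← pow_succ, hmq]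
  have c2 : z ^ (m * q ^ 2) * z ^ q ^ 3 = z ^ q ^ 4 * z ^ q ^ 2 := by
    rw [← pow_add, ← pow_add]; congr 1
    linear_combination q ^ 2 * hmq
  have c4 : z ^ (m * q ^ 4) * z ^ q ^ 5 = z * z ^ q ^ 4 := by
    nth_rw 3 [← hz]
    rw [← pow_add, ← pow_add]; congr 1
    linear_combination q ^ 4 * hmq
  have n1 : z ^ q ≠ 0 := pow_ne_zero _ h0
  have n2 : z ^ q ^ 2 ≠ 0 := pow_ne_zero _ h0
  have n3 : z ^ q ^ 3 ≠ 0 := pow_ne_zero _ h0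
  have n4 : z ^ q ^ 4 ≠ 0 := pow_ne_zero _ h0
  have n5 : z ^ q ^ 5 ≠ 0 := pow_ne_zero _ h0
  generalize z ^ (q ^ 5 - q ^ 3 + q ^ 2) = A at *
  generalize z ^ (q ^ 5 - q ^ 4 + q ^ 2 - q + 1) = B at *
  generalize z ^ (m * q ^ 4) = y4 at *
  generalize z ^ (m * q ^ 2) = y2 at *
  generalize z ^ m = y0 at *
  generalize z ^ q ^ 5 = x5 at *
  generalize z ^ q ^ 4 = x4 at *
  generalize z ^ q ^ 3 = x3 at *
  generalize z ^ q ^ 2 = x2 at *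
  generalize z ^ q = x1 at *
  have E : (x1 * x3 * x4) * (A + B + z) = (x1 * x3 * x5) * (y4 + y2 + y0) := by
    linear_combination x1*x4*hA + x3*hB - x3*x5*c0 - x1*x5*c2 - x1*x3*c4
  constructor
  · intro h
    rw [h, mul_zero] at E
    exact (mul_eq_zero.1 E.symm).resolve_left (by positivity)
  · intro h
    rw [h, mul_zero] at E
    exact (mul_eq_zero.1 E).resolve_left (by positivity)

/-- Let `q` be a power of a prime `p`, `F` the finite field with `q^6` elements,
`m = q^2 - q + 1`, and `Ξ = {ξ ∈ F : ξ^{m q^4} + ξ^{m q^2} + ξ^m = 0}`.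
In `F[Z]` one has `∏_{ξ ∈ Ξ} (Z - ξ) = Z^{q^5-q^3+q^2} + Z^{q^5-q^4+q^2-q+1} + Z`;
in particular this polynomial splits into distinct linear factors over `F` whose
roots are exactly the elements of `Ξ`. -/
theorem stmt_5 (p e q : ℕ) (hp : p.Prime) (he : 0 < e) (hq : q = p ^ e)
    (F : Type*) [Field F] [Fintype F] [DecidableEq F] (hF : Fintype.card F = q ^ 6)
    (m : ℕ) (hm : m = q ^ 2 - q + 1) :
    ∏ ξ ∈ Finset.univ.filter
        (fun ξ : F => ξ ^ (m * q ^ 4) + ξ ^ (m * q ^ 2) + ξ ^ m = 0),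
      (X - C ξ) =
      X ^ (q ^ 5 - q ^ 3 + q ^ 2) + X ^ (q ^ 5 - q ^ 4 + q ^ 2 - q + 1) + X := by
  have h2 : 2 ≤ q := by
    rw [hq]; exact hp.two_le.trans (Nat.le_self_pow he.ne' p)
  have := Fact.mk hp
  have : CharP F p := charP_of_card_eq_prime_pow (f := e * 6) (by rw [hF, hq, pow_mul])
  have hdvd := aux_dvd p e q hp hq h2 F
  obtain ⟨h1, h2', h3, h4, h5⟩ := aux_exps q h2
  have hroot : ∀ z : F, eval z (X ^ (q ^ 5 - q ^ 3 + q ^ 2) + X ^ (q ^ 5 - q ^ 4 + q ^ 2 - q + 1) + X : F[X]) = 0 ↔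
      z ^ (m * q ^ 4) + z ^ (m * q ^ 2) + z ^ m = 0 := fun z => by
    simp only [eval_add, eval_pow, eval_X]
    exact aux_root q h2 z (by rw [← hF]; exact FiniteField.pow_card z) m hm
  have hmonic : (X ^ (q ^ 5 - q ^ 3 + q ^ 2) + X ^ (q ^ 5 - q ^ 4 + q ^ 2 - q + 1) + X : F[X]).Monic := by
    rw [add_assoc]
    apply monic_X_pow_add
    refine (degree_add_le _ _).trans_lt (max_lt ?_ ?_)
    · rw [degree_X_pow]; norm_cast; omega
    · rw [degree_X]; norm_cast; omega
  generalize (X ^ (q ^ 5 - q ^ 3 + q ^ 2) + X ^ (q ^ 5 - q ^ 4 + q ^ 2 - q + 1) + X : F[X]) = f at *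
  have hne : (X ^ q ^ 6 - X : F[X]) ≠ 0 := by
    rw [← hF]; exact FiniteField.X_pow_card_sub_X_ne_zero F Fintype.one_lt_card
  have hroots : (X ^ q ^ 6 - X : F[X]).roots = Finset.univ.val := by
    rw [← hF]; exact FiniteField.roots_X_pow_card_sub_X F
  have hsp : (X ^ q ^ 6 - X : F[X]).Splits := by
    rw [splits_iff_card_roots, hroots, ← hF, FiniteField.X_pow_card_sub_X_natDegree_eq F Fintype.one_lt_card]
    rfl
  have hfs : f.Splits := hsp.of_dvd hne hdvd
  have hnd : f.roots.Nodup :=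
    Multiset.nodup_of_le (roots.le_of_dvd hne hdvd) (by rw [hroots]; exact Finset.univ.nodup)
  have hfil : Finset.univ.filter
        (fun ξ : F => ξ ^ (m * q ^ 4) + ξ ^ (m * q ^ 2) + ξ ^ m = 0) = ⟨f.roots, hnd⟩ := by
    ext z
    simp [hmonic.ne_zero, ← hroot]
  rw [hfil]
  exact (hfs.eq_prod_roots_of_monic hmonic).symm
end

section
/- The number of triples (x, y, z) ∈ F × F × F satisfying y^{q+1} = x^q + x and z^{q^2 - q + 1} = y^{q^2} - y is exactly q^8 - q^6 + q^5. -/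
@[to_additive]
theorem GK.exact_mul {G : Type*} [CommGroup G] [Finite G] (f g : G →* G)
    (h : ∀ x, f (g x) = 1) (a b : ℕ) (ha : Nat.card f.ker ≤ a) (hb : Nat.card g.ker ≤ b)
    (hab : Nat.card G = a * b) :
    ∀ y, f y = 1 → Nat.card {x // g x = y} = b := by
  have h1 : Nat.card g.range * Nat.card g.ker = Nat.card G := by
    rw [← Subgroup.index_ker, Subgroup.index_mul_card]
  have hle : g.range ≤ f.ker := by
    rintro _ ⟨x, rfl⟩
    exact h x
  have h2 : Nat.card g.range ≤ Nat.card f.ker := Subgroup.card_le_of_le hle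
  have hpos : 0 < Nat.card G := Nat.card_pos
  have hbpos : 0 < b := by
    rcases Nat.eq_zero_or_pos b with rfl | hb0
    · simp at hab; omega
    · exact hb0
  have hapos : 0 < a := by
    rcases Nat.eq_zero_or_pos a with rfl | hb0
    · simp at hab; omega
    · exact hb0
  have h3 : Nat.card g.ker = b := by
    by_contra hne
    have hlt : Nat.card g.ker < b := lt_of_le_of_ne hb hne
    have : Nat.card g.range * Nat.card g.ker < a * b :=
      Nat.mul_lt_mul_of_le_of_lt (h2.trans ha) hlt hapos
    omega
  have h4 : Nat.card g.range = a := by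
    rw [h3, hab] at h1
    exact Nat.eq_of_mul_eq_mul_right hbpos h1
  have h5 : g.range = f.ker :=
    Subgroup.eq_of_le_of_card_ge hle (by omega)
  intro y hy
  have : y ∈ g.range := by rw [h5]; exact hy
  obtain ⟨x, rfl⟩ := this
  rw [← h3]
  refine Nat.card_congr ⟨fun z => ⟨z.1 * x⁻¹, by simp [MonoidHom.mem_ker, z.2]⟩,
    fun z => ⟨z.1 * x, by simp [MonoidHom.mem_ker.1 z.2]⟩, fun z => by simp, fun z => by simp⟩

/-- roots of `q`-linearized polynomials -/
theorem GK.lin_bound {F : Type*} [Field F] [Fintype F] (q n : ℕ) (hq : 2 ≤ q) (c : ℕ → F) :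
    Nat.card {x : F // x ^ q ^ n + ∑ i ∈ Finset.range n, c i * x ^ q ^ i = 0} ≤ q ^ n := by
  classical
  let r : Polynomial F := ∑ i ∈ Finset.range n, Polynomial.C (c i) * Polynomial.X ^ q ^ i
  have hr : r.degree < (q ^ n : ℕ) := by
    refine lt_of_le_of_lt (Polynomial.degree_sum_le _ _) ?_
    rw [Finset.sup_lt_iff (by exact WithBot.bot_lt_coe _)]
    intro i hi
    refine lt_of_le_of_lt (Polynomial.degree_C_mul_X_pow_le _ _) ?_
    exact_mod_cast Nat.pow_lt_pow_right hq (Finset.mem_range.1 hi)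
  let P : Polynomial F := Polynomial.X ^ q ^ n + r
  have hP : P.Monic := Polynomial.monic_X_pow_add hr
  have hd : P.natDegree = q ^ n := by
    show (Polynomial.X ^ q ^ n + r).natDegree = q ^ n
    rw [Polynomial.natDegree_add_eq_left_of_degree_lt (by simpa using hr), Polynomial.natDegree_X_pow]
  refine le_trans ?_ (P.card_roots'.trans hd.le)
  refine le_trans ?_ P.roots.toFinset_card_le
  rw [Nat.card_eq_fintype_card, Fintype.card_subtype]
  refine Finset.card_le_card ?_
  intro x hx
  simp only [Finset.mem_filter, Finset.mem_univ, true_and] at hx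
  simp only [Multiset.mem_toFinset, Polynomial.mem_roots hP.ne_zero, Polynomial.IsRoot]
  simp [P, r, Polynomial.eval_finsetSum, hx]

theorem GK.pow_count {F : Type*} [Field F] [Fintype F] (n k : ℕ) 
    (hnk : Fintype.card F - 1 = n * k) (u : F) (hu : u ≠ 0) (huk : u ^ k = 1) :
    Nat.card {z : F // z ^ n = u} = n := by
  classical
  have hc : Nat.card Fˣ = n * k := by
    rw [Nat.card_eq_fintype_card, Fintype.card_units, hnk]
  have hpos : 0 < Nat.card Fˣ := Nat.card_pos
  have hn : n ≠ 0 := by rintro rfl; simp at hc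
  have hk : k ≠ 0 := by rintro rfl; simp at hc
  have hb : ∀ j : ℕ, j ≠ 0 → Nat.card (powMonoidHom j : Fˣ →* Fˣ).ker ≤ j := by
    intro j hj
    have : NeZero j := ⟨hj⟩
    have := card_rootsOfUnity F j
    exact this
  have key := GK.exact_mul (powMonoidHom k : Fˣ →* Fˣ) (powMonoidHom n) (by
    intro x
    simp only [powMonoidHom_apply]
    rw [← pow_mul, ← hc, pow_card_eq_one']) k n (hb k hk) (hb n hn) (by rw [hc, mul_comm])
    (Units.mk0 u hu) (by ext; simpa using huk)
  refine Eq.trans ?_ key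
  refine Nat.card_congr ⟨fun z => ⟨Units.mk0 z.1 (by
    rintro h0; apply hu; rw [← z.2, h0, zero_pow hn]), ?_⟩, fun z => ⟨z.1.1, ?_⟩, fun z => by simp, fun z => by simp⟩
  · ext; simpa using z.2
  · have := congrArg Units.val z.2
    simpa using this


theorem GK.lin_fiber {F : Type*} [Field F] [Fintype F] (q : ℕ) (hq : 2 ≤ q)
    (hF : Fintype.card F = q ^ 6) (φ : F →+* F) (hφ : ∀ x, φ x = x ^ q)
    (n k : ℕ) (hnk : k + n = 6) (c d : ℕ → F) (f g : F → F)
    (hg : ∀ x, g x = x ^ q ^ n + ∑ i ∈ Finset.range n, c i * x ^ q ^ i)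
    (hf : ∀ x, f x = x ^ q ^ k + ∑ i ∈ Finset.range k, d i * x ^ q ^ i)
    (hfg : ∀ x, f (g x) = 0) (y : F) (hy : f y = 0) :
    Nat.card {x // g x = y} = q ^ n := by
  have hpow : ∀ i : ℕ, ∀ a b : F, (a + b) ^ q ^ i = a ^ q ^ i + b ^ q ^ i := by
    intro i
    induction i with
    | zero => simp
    | succ i ih => 
      intro a b
      rw [pow_succ, pow_mul, ih, ← hφ, map_add, hφ, hφ, ← pow_mul, ← pow_mul]
  have hadd : ∀ (n : ℕ) (c : ℕ → F) (g : F → F)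
    (_ : ∀ x, g x = x ^ q ^ n + ∑ i ∈ Finset.range n, c i * x ^ q ^ i) (a b : F), g (a + b) = g a + g b := by
    intro n c g hg a b
    simp only [hg, hpow, mul_add, Finset.sum_add_distrib]
    ring
  let G : F →+ F := AddMonoidHom.mk' g (hadd n c g hg)
  let H : F →+ F := AddMonoidHom.mk' f (hadd k d f hf)
  have hG : Nat.card G.ker ≤ q ^ n := by
    refine le_trans (le_of_eq ?_) (GK.lin_bound q n hq c)
    refine Nat.card_congr (Equiv.subtypeEquivRight fun x => ?_)
    rw [← hg]
    rfl
  have hH : Nat.card H.ker ≤ q ^ k := by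
    refine le_trans (le_of_eq ?_) (GK.lin_bound q k hq d)
    refine Nat.card_congr (Equiv.subtypeEquivRight fun x => ?_)
    rw [← hf]
    rfl
  exact GK.exact_add H G hfg (q ^ k) (q ^ n) hH hG
    (by rw [Nat.card_eq_fintype_card, hF, ← pow_add, hnk]) y hy

/-- The three linearized fibre counts and the equivalences. -/
theorem GK.facts {F : Type*} [Field F] [Fintype F] (q : ℕ) (hq : 2 ≤ q)
    (hF : Fintype.card F = q ^ 6) (φ : F →+* F) (hφ : ∀ x, φ x = x ^ q) :
    (∀ y u : F, u = y ^ q ^ 2 - y → (u = 0 ∨ u ^ ((q ^ 3 - 1) * (q + 1)) = 1) →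
      Nat.card {x : F // y ^ (q + 1) = x ^ q + x} = q) ∧
    (∀ y u : F, u = y ^ q ^ 2 - y → ¬ (u = 0 ∨ u ^ ((q ^ 3 - 1) * (q + 1)) = 1) →
      Nat.card {x : F // y ^ (q + 1) = x ^ q + x} = 0) ∧
    (∀ u : F, u + u ^ q ^ 2 + u ^ q ^ 4 = 0 → Nat.card {y : F // y ^ q ^ 2 - y = u} = q ^ 2) ∧
    (∀ u : F, u + u ^ q ^ 2 + u ^ q ^ 4 ≠ 0 → Nat.card {y : F // y ^ q ^ 2 - y = u} = 0) ∧
    (∀ v : F, v ^ (q + 1) = 1 → Nat.card {u : F // u + u ^ q ^ 2 + u ^ q ^ 4 = 0 ∧ u ^ q ^ 3 = v * u}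
      = q ^ 2) := by
  have p1 : ∀ x : F, x ^ q = φ x := fun x => (hφ x).symm
  have p2 : ∀ x : F, x ^ q ^ 2 = φ (φ x) := fun x => by rw [pow_succ, pow_mul, pow_one, p1, p1]
  have p3 : ∀ x : F, x ^ q ^ 3 = φ (φ (φ x)) := fun x => by rw [pow_succ, pow_mul, p2, p1]
  have p4 : ∀ x : F, x ^ q ^ 4 = φ (φ (φ (φ x))) := fun x => by rw [pow_succ, pow_mul, p3, p1]
  have p5 : ∀ x : F, x ^ q ^ 5 = φ (φ (φ (φ (φ x)))) := fun x => by rw [pow_succ, pow_mul, p4, p1]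
  have p6 : ∀ x : F, φ (φ (φ (φ (φ (φ x))))) = x := fun x => by
    rw [← p5, ← p1, ← pow_mul, ← pow_succ', ← hF, FiniteField.pow_card]
  have alt : ∀ w : F, (φ (φ (φ (φ (φ w)))) - φ (φ (φ (φ w))) + φ (φ (φ w)) - φ (φ w) + φ w - w = 0) →
      Nat.card {x : F // φ x + x = w} = q := by
    intro w hw
    have := GK.lin_fiber q hq hF φ hφ 1 5 rfl (fun _ => 1) (fun i => (-1) ^ (i + 1)) 
      (fun w => φ (φ (φ (φ (φ w)))) - φ (φ (φ (φ w))) + φ (φ (φ w)) - φ (φ w) + φ w - w)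
      (fun x => φ x + x) (by intro x; simp [p1]) 
      (by intro x; simp [Finset.sum_range_succ, p1, p2, p3, p4, p5]; ring)
      (by intro x; simp only [map_add, p6]; ring) w hw
    simpa using this
  have alt' : ∀ w x : F, φ x + x = w → 
     (φ (φ (φ (φ (φ w)))) - φ (φ (φ (φ w))) + φ (φ (φ w)) - φ (φ w) + φ w - w = 0) := by
    rintro w x rfl
    simp only [map_add, p6]; ring
  have key : ∀ y u w : F, u = φ (φ y) - y → w = φ y * y → 
     ((φ (φ (φ (φ (φ w)))) - φ (φ (φ (φ w))) + φ (φ (φ w)) - φ (φ w) + φ w - w = 0) ↔ 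
       (u = 0 ∨ u ^ ((q ^ 3 - 1) * (q + 1)) = 1)) := by
    rintro y u w hu rfl
    have e1 : (u = 0 ∨ u ^ ((q ^ 3 - 1) * (q + 1)) = 1) ↔ φ u * u = φ (φ (φ (φ u))) * φ (φ (φ u)) := by
      by_cases h0 : u = 0
      · simp [h0]
      · simp only [h0, false_or]
        have h1 : φ (φ (φ (φ u))) * φ (φ (φ u)) = u ^ ((q ^ 3 - 1) * (q + 1)) * (φ u * u) := by
          have hq3 : 1 ≤ q ^ 3 := Nat.one_le_pow _ _ (by omega)
          rw [← p4, ← p3, ← p1, ← pow_succ, ← pow_add, ← pow_add]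
          congr 1
          obtain ⟨t, ht⟩ := Nat.exists_eq_add_of_le hq3
          have : q ^ 4 = q ^ 3 * q := by ring
          rw [this, ht]
          simp
          ring
        have h2 : φ u * u ≠ 0 := mul_ne_zero (by simpa using h0) h0
        rw [h1]
        constructor
        · intro h; rw [h, one_mul]
        · intro h
          exact (mul_right_cancel₀ h2 (by rw [one_mul]; exact h)).symm
    have e2 : (φ u * u = φ (φ (φ (φ u))) * φ (φ (φ u))) ↔ 
        (u * φ (φ (φ (φ (φ u)))) = φ (φ (φ u)) * φ (φ u)) := by
      rw [← φ.injective.eq_iff (a := u * φ (φ (φ (φ (φ u)))))]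
      simp only [map_mul, p6]
    rw [e1, e2, hu]
    simp only [map_mul, map_sub, p6]
    constructor
    · intro h; linear_combination h
    · intro h; linear_combination h
  refine ⟨?_, ?_, ?_, ?_, ?_⟩
  · intro y u hu h
    rw [p2] at hu
    have := alt _ ((key y u _ hu rfl).2 h)
    refine Eq.trans (Nat.card_congr (Equiv.subtypeEquivRight fun x => ?_)) this
    rw [pow_succ, p1, p1, eq_comm]
  · intro y u hu h
    rw [p2] at hu
    rw [Nat.card_eq_zero]
    left
    refine ⟨fun ⟨x, this⟩ => h ((key y u _ hu rfl).1 (alt' _ x ?_))⟩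
    rw [pow_succ, p1, p1] at this
    exact this.symm
  · intro u hu
    simp only [p2, p4] at hu ⊢
    exact GK.lin_fiber q hq hF φ hφ 2 4 rfl (fun i => if i = 0 then -1 else 0)
      (fun i => if i = 0 ∨ i = 2 then 1 else 0) (fun u => u + φ (φ u) + φ (φ (φ (φ u))))
      (fun y => φ (φ y) - y)
      (by intro x; simp [p2, Finset.sum_range_succ]; ring) 
      (by intro x; simp [Finset.sum_range_succ, p2, p4]; ring)
      (by intro x; simp only [map_sub, p6]; ring) u hu
  · intro u hu
    rw [Nat.card_eq_zero]
    left
    refine ⟨fun y => hu ?_⟩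
    rw [← y.2]
    simp only [p2, p4, map_sub, p6]
    ring
  · intro v hv
    have hv1 : φ v * v = 1 := by rw [← p1, ← pow_succ, hv]
    have hv2 : φ (φ v) = v := by
      have := congrArg φ hv1
      simp only [map_mul, map_one] at this
      linear_combination (-φ (φ v)) * hv1 + v * this
    have := GK.lin_fiber q hq hF φ hφ 2 4 rfl (fun i => if i = 0 then 1 else φ v)
      (fun i => if i = 0 then -1 else if i = 1 then φ v else if i = 2 then 0 else - φ v)
      (fun u => φ (φ (φ (φ u))) - φ v * φ (φ (φ u)) + φ v * φ u - u)
      (fun y => φ (φ y) + φ v * φ y + y)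
      (by intro x; simp [p2, p1, Finset.sum_range_succ]; ring) 
      (by intro x; simp [Finset.sum_range_succ, p1, p2, p3, p4]; ring)
      (by 
        intro x; simp only [map_add, map_mul, hv2, p6]
        linear_combination (φ (φ x) - φ (φ (φ (φ x)))) * hv1) 0 (by simp)
    refine Eq.trans (Nat.card_congr (Equiv.subtypeEquivRight fun u => ?_)) this
    simp only [p2, p3, p4]
    constructor
    · rintro ⟨h1, h2⟩
      rw [h2, map_mul] at h1
      linear_combination h1
    · intro h
      have h2 : φ (φ (φ u)) = v * u := by
        have := congrArg φ h
        simp only [map_add, map_mul, hv2, map_zero] at this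
        linear_combination this - v * h + φ u * hv1
      refine ⟨?_, h2⟩
      rw [h2, map_mul]
      linear_combination h

theorem GK.count_S {F : Type*} [Field F] [Fintype F] [DecidableEq F] (q : ℕ) (hq : 2 ≤ q)
    (hF : Fintype.card F = q ^ 6) (φ : F →+* F) (hφ : ∀ x, φ x = x ^ q) :
    (Finset.univ.filter fun u : F => u ≠ 0 ∧ u + u ^ q ^ 2 + u ^ q ^ 4 = 0 ∧ 
      u ^ ((q ^ 3 - 1) * (q + 1)) = 1).card = (q + 1) * (q ^ 2 - 1) := by
  obtain ⟨-, -, -, -, h5⟩ := GK.facts q hq hF φ hφ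
  have hq3 : 1 ≤ q ^ 3 := Nat.one_le_pow _ _ (by omega)
  rw [Finset.card_eq_sum_card_fiberwise (f := fun u => u ^ (q ^ 3 - 1)) 
    (t := Finset.univ.filter fun v : F => v ^ (q + 1) = 1)]
  · rw [Finset.sum_congr rfl (g := fun _ => q ^ 2 - 1), Finset.sum_const, smul_eq_mul]
    · congr 1
      have := GK.pow_count (F := F) (q + 1) ((q ^ 3 - 1) * (q ^ 2 - q + 1)) (by
        rw [hF]
        have h1 : q ≤ q ^ 2 := by nlinarith
        have h2 : 1 ≤ q ^ 6 := Nat.one_le_pow _ _ (by omega)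
        zify [h1, h2, hq3]
        ring) 1 one_ne_zero (one_pow _)
      rwa [Nat.card_eq_fintype_card, Fintype.card_subtype] at this
    · intro v hv
      simp only [Finset.mem_filter, Finset.mem_univ, true_and] at hv
      have := h5 v hv
      rw [Nat.card_eq_fintype_card, Fintype.card_subtype] at this
      refine Eq.trans ?_ (congrArg (fun t => t - 1) this)
      rw [← Finset.card_erase_of_mem (a := (0 : F))]
      · congr 1
        ext u
        simp only [Finset.mem_filter, Finset.mem_univ, true_and, Finset.mem_erase]
        have hs : u ^ q ^ 3 = u ^ (q ^ 3 - 1) * u := by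
          rw [← pow_succ]; congr 1; omega
        constructor
        · rintro ⟨⟨h0, h1, h2⟩, h3⟩
          exact ⟨h0, h1, by rw [hs, h3]⟩
        · rintro ⟨h0, h1, h2⟩
          have h3 : u ^ (q ^ 3 - 1) = v := mul_right_cancel₀ h0 (by rw [← hs, h2])
          exact ⟨⟨h0, h1, by rw [pow_mul, h3, hv]⟩, h3⟩
      · have : q ≠ 0 := by omega
        simp [this]
  · intro u hu
    simp only [Finset.coe_filter, Finset.mem_univ, true_and, Set.mem_ofPred_eq] at hu ⊢
    rw [← pow_mul]
    exact hu.2.2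

theorem stmt_7 (p e q : ℕ) (hp : p.Prime) (he : 0 < e) (hq : q = p ^ e)
    (F : Type*) [Field F] [Fintype F] (hF : Fintype.card F = q ^ 6) :
    Nat.card {t : F × F × F // t.2.1 ^ (q + 1) = t.1 ^ q + t.1 ∧
        t.2.2 ^ (q ^ 2 - q + 1) = t.2.1 ^ q ^ 2 - t.2.1}
      = q ^ 8 - q ^ 6 + q ^ 5 := by
  classical
  have hq2 : 2 ≤ q := by
    rw [hq]
    exact hp.two_le.trans (Nat.le_self_pow (by omega) p)
  haveI : Fact p.Prime := ⟨hp⟩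
  haveI : CharP F p := charP_of_card_eq_prime_pow (f := e * 6) (by rw [hF, hq, pow_mul])
  let φ : F →+* F := iterateFrobenius F p e
  have hφ : ∀ x, φ x = x ^ q := fun x => by rw [hq]; exact iterateFrobenius_def p e x
  have hS := GK.count_S q hq2 hF φ hφ
  obtain ⟨h1, h2, h3, h4, -⟩ := GK.facts q hq2 hF φ hφ
  have hqq : q ≤ q ^ 2 := by nlinarith
  let m := q ^ 2 - q + 1
  let K := (q ^ 3 - 1) * (q + 1)
  have hmK : Fintype.card F - 1 = m * K := by
    have hq3 : 1 ≤ q ^ 3 := Nat.one_le_pow _ _ (by omega)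
    have hq6 : 1 ≤ q ^ 6 := Nat.one_le_pow _ _ (by omega)
    rw [hF]
    simp only [m, K]
    zify [hqq, hq3, hq6]
    ring
  let h : F → ℕ := fun u => if u = 0 then q else if u ^ K = 1 then q * m else 0
  have hprod : ∀ y : F, Nat.card {x : F // y ^ (q + 1) = x ^ q + x} * 
      Nat.card {z : F // z ^ m = y ^ q ^ 2 - y} = h (y ^ q ^ 2 - y) := by
    intro y
    by_cases c0 : y ^ q ^ 2 - y = 0
    · rw [h1 y _ rfl (Or.inl c0), c0]
      have : Nat.card {z : F // z ^ m = 0} = 1 := by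
        have hm : m ≠ 0 := by simp [m]
        simp [pow_eq_zero_iff hm]
      rw [this]
      simp [h]
    · by_cases c1 : (y ^ q ^ 2 - y) ^ K = 1
      · rw [h1 y _ rfl (Or.inr c1), GK.pow_count m K hmK _ c0 c1]
        simp only [h, if_neg c0, if_pos c1]
      · rw [h2 y _ rfl (by simp only [not_or]; exact ⟨c0, c1⟩)]
        simp only [h, if_neg c0, if_neg c1, zero_mul]
  have hequiv : {t : F × F × F // t.2.1 ^ (q + 1) = t.1 ^ q + t.1 ∧
        t.2.2 ^ (q ^ 2 - q + 1) = t.2.1 ^ q ^ 2 - t.2.1} ≃ 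
      Σ y : F, {x : F // y ^ (q + 1) = x ^ q + x} × {z : F // z ^ m = y ^ q ^ 2 - y} :=
    { toFun := fun t => ⟨t.1.2.1, ⟨t.1.1, t.2.1⟩, ⟨t.1.2.2, t.2.2⟩⟩
      invFun := fun s => ⟨(s.2.1.1, s.1, s.2.2.1), s.2.1.2, s.2.2.2⟩
      left_inv := fun t => rfl
      right_inv := fun s => rfl }
  rw [Nat.card_congr hequiv, Nat.card_sigma]
  simp only [Nat.card_prod, hprod]
  rw [← Finset.sum_fiberwise' Finset.univ (fun y : F => y ^ q ^ 2 - y) h]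
  have hin : ∀ u : F, (∑ y ∈ Finset.univ.filter (fun y : F => y ^ q ^ 2 - y = u), h u) =
      (if u = 0 then q ^ 3 else 0) + (if (u ≠ 0 ∧ u + u ^ q ^ 2 + u ^ q ^ 4 = 0 ∧ 
      u ^ ((q ^ 3 - 1) * (q + 1)) = 1) then q ^ 3 * m else 0) := by
    intro u
    have hc : (Finset.univ.filter (fun y : F => y ^ q ^ 2 - y = u)).card = 
        Nat.card {y : F // y ^ q ^ 2 - y = u} := by
      rw [Nat.card_eq_fintype_card, Fintype.card_subtype]
    rw [Finset.sum_const, smul_eq_mul, hc]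
    by_cases ct : u + u ^ q ^ 2 + u ^ q ^ 4 = 0
    · rw [h3 u ct]
      by_cases c0 : u = 0
      · simp [h, c0]; ring
      · by_cases c1 : u ^ K = 1
        · have c2 := c1
          simp only [K] at c2
          simp only [h, if_neg c0, if_pos c1, ct, c2]
          simp [c0]; ring
        · have c2 := c1
          simp only [K] at c2
          simp only [h, if_neg c0, if_neg c1, c2]
          simp
    · rw [h4 u ct]
      have c0 : u ≠ 0 := by
        rintro rfl
        have : q ≠ 0 := by omega
        simp [this] at ct
      simp [ct, c0]
  rw [Finset.sum_congr rfl (fun u _ => hin u), Finset.sum_add_distrib, ← Finset.sum_filter _ (fun _ => q ^ 3 * m),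
    Finset.sum_const, hS]
  simp only [Finset.sum_ite_eq', Finset.mem_univ, if_true, smul_eq_mul, m]
  have a1 : q ^ 6 ≤ q ^ 8 := Nat.pow_le_pow_right (by omega) (by omega)
  have a2 : 1 ≤ q ^ 2 := Nat.one_le_pow _ _ (by omega)
  zify [hqq, a1, a2]
  ring
end

section
/- For every ξ ∈ Ξ, the number of pairs (x, y) ∈ F × F satisfying y^{q+1} = x^q + x and y^{q^2} - y = ξ^m is exactly q^3. -/
/-- The additive polynomial map `x ↦ ∑_{i ≤ k} c i * x^(Q^i)`. -/
noncomputable def addPolyMap {F : Type*} [Field F] (p f : ℕ) [Fact p.Prime] [CharP F p]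
    (k : ℕ) (c : ℕ → F) : F →+ F where
  toFun x := ∑ i ∈ Finset.range (k + 1), c i * x ^ (p ^ f) ^ i
  map_zero' := by
    apply Finset.sum_eq_zero
    intro i _
    rw [zero_pow (pow_ne_zero _ (pow_ne_zero _ (Fact.out : p.Prime).ne_zero)), mul_zero]
  map_add' x y := by
    rw [← Finset.sum_add_distrib]
    apply Finset.sum_congr rfl
    intro i _
    rw [← pow_mul, add_pow_char_pow, mul_add]

theorem addPolyMap_apply {F : Type*} [Field F] (p f : ℕ) [Fact p.Prime] [CharP F p]
    (k : ℕ) (c : ℕ → F) (x : F) :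
    addPolyMap p f k c x = ∑ i ∈ Finset.range (k + 1), c i * x ^ (p ^ f) ^ i := rfl

theorem addPolyMap_ker {F : Type*} [Field F] [Fintype F] (p f : ℕ) [Fact p.Prime] [CharP F p]
    (hf : 0 < f) (k : ℕ) (c : ℕ → F) (hc : c k ≠ 0) :
    Nat.card (addPolyMap p f k c).ker ≤ (p ^ f) ^ k := by
  classical
  have hQ : 1 < p ^ f := Nat.one_lt_pow hf.ne' (Fact.out : p.Prime).one_lt
  set P : Polynomial F := ∑ i ∈ Finset.range (k + 1),
    Polynomial.C (c i) * Polynomial.X ^ (p ^ f) ^ i with hP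
  have hcoef : P.coeff ((p ^ f) ^ k) = c k := by
    rw [hP, Polynomial.finsetSum_coeff, Finset.sum_eq_single k]
    · simp
    · intro i _ hik
      rw [Polynomial.coeff_C_mul, Polynomial.coeff_X_pow, if_neg, mul_zero]
      intro h
      exact hik (Nat.pow_right_injective hQ h).symm
    · simp
  have hP0 : P ≠ 0 := by
    intro h
    rw [h, Polynomial.coeff_zero] at hcoef
    exact hc hcoef.symm
  have hdeg : P.natDegree ≤ (p ^ f) ^ k := by
    apply Polynomial.natDegree_sum_le_of_forall_le
    intro i hi
    refine (Polynomial.natDegree_C_mul_X_pow_le _ _).trans ?_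
    exact Nat.pow_le_pow_right (by omega) (by simp at hi; omega)
  have hsub : ((addPolyMap p f k c).ker : Set F) ⊆ (P.roots.toFinset : Set F) := by
    intro x hx
    have hx' : ∑ i ∈ Finset.range (k + 1), c i * x ^ (p ^ f) ^ i = 0 := hx
    simp only [Finset.mem_coe, Multiset.mem_toFinset, Polynomial.mem_roots hP0,
      Polynomial.IsRoot.def]
    rw [hP, Polynomial.eval_finsetSum]
    simpa using hx'
  calc Nat.card (addPolyMap p f k c).ker
      = Set.ncard ((addPolyMap p f k c).ker : Set F) := rfl
    _ ≤ Set.ncard (P.roots.toFinset : Set F) := Set.ncard_le_ncard hsub (Set.toFinite _)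
    _ = P.roots.toFinset.card := Set.ncard_coe_finset _
    _ ≤ Multiset.card P.roots := Multiset.toFinset_card_le _
    _ ≤ P.natDegree := P.card_roots'
    _ ≤ _ := hdeg

theorem fiber_card {F : Type*} [AddCommGroup F] [Finite F] (L T : F →+ F)
    (hTL : ∀ x, T (L x) = 0) (a b : ℕ) (hb : 0 < b) (hab : a * b = Nat.card F)
    (hL : Nat.card L.ker ≤ a) (hT : Nat.card T.ker ≤ b) (z : F) (hz : T z = 0) :
    Nat.card {x // L x = z} = a := by
  have hle : L.range ≤ T.ker := by
    rintro _ ⟨x, rfl⟩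
    exact hTL x
  have h1 : Nat.card L.ker * Nat.card L.range = Nat.card F := by
    rw [← AddSubgroup.index_ker, AddSubgroup.card_mul_index]
  have h2 : Nat.card L.range ≤ Nat.card T.ker := AddSubgroup.card_le_of_le hle
  have hpos : 0 < Nat.card F := Nat.card_pos
  have ha : 0 < a := Nat.pos_of_ne_zero (by rintro rfl; omega)
  have h3 : Nat.card L.range = b := by
    apply le_antisymm (h2.trans hT)
    by_contra! h
    have : Nat.card L.ker * Nat.card L.range < a * b :=
      lt_of_le_of_lt (Nat.mul_le_mul_right _ hL) (Nat.mul_lt_mul_of_pos_left h ha)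
    omega
  have h4 : Nat.card L.ker = a := by
    rw [h3, ← hab] at h1
    exact Nat.eq_of_mul_eq_mul_right hb h1
  have h5 : L.range = T.ker :=
    AddSubgroup.eq_of_le_of_card_ge hle (by omega)
  have hz' : z ∈ L.range := by rw [h5]; exact hz
  obtain ⟨x₀, rfl⟩ := hz'
  rw [← h4]
  refine Nat.card_congr ⟨fun x => ⟨x.1 - x₀, ?_⟩, fun x => ⟨x.1 + x₀, ?_⟩, ?_, ?_⟩
  · rw [AddMonoidHom.mem_ker, map_sub, x.2, sub_self]
  · rw [map_add, AddMonoidHom.mem_ker.1 x.2, zero_add]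
  · intro x; simp
  · intro x; simp

theorem sum_shift {F : Type*} [AddCommGroup F] (f : ℕ → F) (n : ℕ) (hf : ∀ j, f (j + n) = f j)
    (k : ℕ) : ∑ j ∈ Finset.range n, f (j + k) = ∑ j ∈ Finset.range n, f j := by
  induction k with
  | zero => simp
  | succ k ih =>
    rw [← ih]
    have h1 := Finset.sum_range_succ (fun j => f (j + k)) n
    have h2 := Finset.sum_range_succ' (fun j => f (j + k)) n
    rw [h1] at h2
    have h3 : f (n + k) = f (0 + k) := by rw [add_comm n k, hf, zero_add]
    rw [h3] at h2
    have h4 := add_right_cancel h2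
    rw [h4]
    apply Finset.sum_congr rfl
    intro j _
    congr 1
    omega

theorem sum_range_two_mul {F : Type*} [AddCommGroup F] (f : ℕ → F) (n : ℕ) :
    ∑ i ∈ Finset.range (2 * n), f i = ∑ j ∈ Finset.range n, (f (2 * j) + f (2 * j + 1)) := by
  induction n with
  | zero => simp
  | succ n ih =>
    rw [show 2 * (n + 1) = 2 * n + 1 + 1 by ring, Finset.sum_range_succ, Finset.sum_range_succ, ih,
      Finset.sum_range_succ, add_assoc]

/-- Combinatorial core. `Y i = y^(q^i)`, `Z i = z^(q^i)`. -/
theorem core_sum {F : Type*} [Field F] (Y Z : ℕ → F) (n h : ℕ) (hn : n = 2 * h + 1) (u c : F)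
    (hYper : ∀ i, Y (i + 2 * n) = Y i)
    (hYZ : ∀ i, Y (i + 2) - Y i = Z i)
    (hu : ∀ j, Z (2 * j + n) = u * Z (2 * j))
    (hc : Y n = u * Y 0 + c)
    (htr : ∑ j ∈ Finset.range n, Z (2 * j) = 0) :
    ∑ i ∈ Finset.range (2 * n), (-1) ^ i * (Y i * Y (i + 1)) = 0 := by
  have hZper : ∀ i, Z (i + 2 * n) = Z i := by
    intro i
    rw [← hYZ, ← hYZ, hYper, show i + 2 * n + 2 = i + 2 + 2 * n by ring, hYper]
  have hY : ∀ j, Y (2 * j + n) = u * Y (2 * j) + c := by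
    intro j
    induction j with
    | zero => simpa using hc
    | succ j ih =>
      have h1 := hYZ (2 * j + n)
      have h2 := hYZ (2 * j)
      have h3 := hu j
      rw [show 2 * (j + 1) + n = 2 * j + n + 2 by ring, show 2 * (j + 1) = 2 * j + 2 by ring]
      linear_combination h1 - u * h2 + h3 + ih
  have hS : ∑ j ∈ Finset.range n, Y (2 * j + 1) * Z (2 * j) = 0 := by
    rw [← sum_shift (fun j => Y (2 * j + 1) * Z (2 * j)) n _ h]
    · have e : ∀ j, Y (2 * (j + h) + 1) * Z (2 * (j + h)) =
          u * (Y (2 * (j + (h + 1))) * Y (2 * (j + (h + 1)) + 2 * h)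
            - Y (2 * j) * Y (2 * j + 2 * h)) + c * Z (2 * (j + h)) := by
        intro j
        have h1 := hY j
        have h2 := hYZ (2 * (j + h))
        have h3 := hYper (2 * j)
        rw [show 2 * (j + h) + 1 = 2 * j + n by omega, h1,
          show 2 * (j + (h + 1)) + 2 * h = 2 * j + 2 * n by omega, h3,
          show 2 * (j + (h + 1)) = 2 * (j + h) + 2 by ring, ← h2,
          show 2 * j + 2 * h = 2 * (j + h) by ring]
        ring
      rw [Finset.sum_congr rfl (fun j _ => e j), Finset.sum_add_distrib, ← Finset.mul_sum,
        ← Finset.mul_sum, Finset.sum_sub_distrib,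
        sum_shift (fun j => Z (2 * j)) n _ h, htr,
        sum_shift (fun j => Y (2 * j) * Y (2 * j + 2 * h)) n _ (h + 1)]
      · simp
      · intro j
        rw [show 2 * (j + n) + 2 * h = 2 * j + 2 * h + 2 * n by ring,
          show 2 * (j + n) = 2 * j + 2 * n by ring, hYper, hYper]
      · intro j
        rw [show 2 * (j + n) = 2 * j + 2 * n by ring, hZper]
    · intro j
      rw [show 2 * (j + n) + 1 = 2 * j + 1 + 2 * n by ring,
          show 2 * (j + n) = 2 * j + 2 * n by ring, hYper, hZper]
  rw [sum_range_two_mul]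
  have e : ∀ j, (-1 : F) ^ (2 * j) * (Y (2 * j) * Y (2 * j + 1)) +
      (-1) ^ (2 * j + 1) * (Y (2 * j + 1) * Y (2 * j + 1 + 1)) =
      - (Y (2 * j + 1) * Z (2 * j)) := by
    intro j
    rw [pow_succ, pow_mul, neg_one_sq, one_pow, ← hYZ (2 * j)]
    ring
  rw [Finset.sum_congr rfl (fun j _ => e j), Finset.sum_neg_distrib, hS, neg_zero]

/-- Let `q` be a power of a prime `p`, `n ≥ 5` odd, `m = (q^n+1)/(q+1)`, `F` the
finite field with `q^{2n}` elements, and `Ξ = {ξ ∈ F : ∑_{i=0}^{n-1} (ξ^m)^{q^{2i}} = 0}`.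
For every `ξ ∈ Ξ`, the number of pairs `(x, y) ∈ F × F` satisfying
`y^{q+1} = x^q + x` and `y^{q^2} - y = ξ^m` is exactly `q^3`. -/
theorem stmt_8 (p e q n m : ℕ) (hp : p.Prime) (he : 0 < e) (hq : q = p ^ e)
    (hn : 5 ≤ n) (hodd : Odd n) (hm : (q + 1) * m = q ^ n + 1)
    (F : Type*) [Field F] [Fintype F] (hF : Fintype.card F = q ^ (2 * n))
    (ξ : F) (hξ : ∑ i ∈ Finset.range n, (ξ ^ m) ^ q ^ (2 * i) = 0) :
    Nat.card {xy : F × F // xy.2 ^ (q + 1) = xy.1 ^ q + xy.1 ∧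
      xy.2 ^ q ^ 2 - xy.2 = ξ ^ m} = q ^ 3 := by
  classical
  have : Fact p.Prime := ⟨hp⟩
  have : CharP F p := by
    obtain ⟨r, hr⟩ := CharP.exists F
    obtain ⟨k, hrp, hk⟩ := FiniteField.card F r
    have hdvd : r ∣ p := by
      apply hrp.dvd_of_dvd_pow (n := e * (2 * n))
      rw [pow_mul, ← hq, ← hF, hk]
      exact dvd_pow_self r k.2.ne'
    rwa [← (Nat.prime_dvd_prime_iff_eq hrp hp).1 hdvd]
  have hq0 : 0 < q := hq ▸ pow_pos hp.pos e
  have hfrob : ∀ a : F, a ^ q ^ (2 * n) = a := fun a => by rw [← hF]; exact FiniteField.pow_card a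
  have hsub : ∀ (a b : F) (i : ℕ), (a - b) ^ q ^ i = a ^ q ^ i - b ^ q ^ i := by
    intro a b i
    rw [hq, ← pow_mul, sub_pow_char_pow]
  have hcard : Nat.card F = q ^ (2 * n) := by rw [Nat.card_eq_fintype_card, hF]
  set z : F := ξ ^ m with hz
  -- the four additive maps
  set L := addPolyMap (F := F) p (e * 2) 1 (fun i => if i = 0 then -1 else 1) with hL
  set T := addPolyMap (F := F) p (e * 2) (n - 1) (fun _ => 1) with hT
  set M := addPolyMap (F := F) p e 1 (fun _ => 1) with hM
  set A := addPolyMap (F := F) p e (2 * n - 1) (fun i => (-1) ^ i) with hA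
  have hLx : ∀ x, L x = x ^ q ^ 2 - x := by
    intro x
    rw [hL, addPolyMap_apply, pow_mul, ← hq]
    simp [Finset.sum_range_succ]
    ring
  have hTx : ∀ x, T x = ∑ i ∈ Finset.range n, x ^ q ^ (2 * i) := by
    intro x
    rw [hT, addPolyMap_apply, pow_mul, ← hq, Nat.sub_add_cancel (by omega)]
    simp [pow_mul]
  have hMx : ∀ x, M x = x ^ q + x := by
    intro x
    rw [hM, addPolyMap_apply, ← hq]
    simp [Finset.sum_range_succ]
    ring
  have hAx : ∀ x, A x = ∑ i ∈ Finset.range (2 * n), (-1) ^ i * x ^ q ^ i := by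
    intro x
    rw [hA, addPolyMap_apply, ← hq, Nat.sub_add_cancel (by omega)]
  have hTL : ∀ x, T (L x) = 0 := by
    intro x
    rw [hTx, hLx]
    have : ∀ i, (x ^ q ^ 2 - x) ^ q ^ (2 * i) = x ^ q ^ (2 * (i + 1)) - x ^ q ^ (2 * i) := by
      intro i
      rw [hsub, ← pow_mul, ← pow_add]
      congr 3
      ring
    rw [Finset.sum_congr rfl (fun i _ => this i), Finset.sum_range_sub (fun i => x ^ q ^ (2 * i)),
      hfrob]
    simp
  have hAM : ∀ x, A (M x) = 0 := by
    intro x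
    rw [hAx, hMx]
    have : ∀ i, (-1) ^ i * (x ^ q + x) ^ q ^ i =
        (-((-1) ^ (i + 1) * x ^ q ^ (i + 1))) - (-((-1) ^ i * x ^ q ^ i)) := by
      intro i
      rw [show x ^ q + x = x ^ q - (-x) by ring, hsub]
      have h2 := hsub 0 x i
      rw [zero_pow (pow_pos hq0 i).ne', zero_sub, zero_sub] at h2
      rw [h2, ← pow_mul, ← pow_succ']
      ring
    rw [Finset.sum_congr rfl (fun i _ => this i),
      Finset.sum_range_sub (fun i => -((-1 : F) ^ i * x ^ q ^ i)), hfrob]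
    simp
  have hLfib : ∀ w, T w = 0 → Nat.card {x // L x = w} = q ^ 2 := by
    intro w hw
    refine fiber_card L T hTL (q ^ 2) ((q ^ 2) ^ (n - 1)) (by positivity) ?_ ?_ ?_ w hw
    · rw [hcard, ← pow_succ', pow_mul]; congr 1; omega
    · have := addPolyMap_ker (F := F) p (e * 2) (by omega) 1
        (fun i => if i = 0 then -1 else 1) (by simp)
      rwa [pow_mul, ← hq, pow_one] at this
    · have := addPolyMap_ker (F := F) p (e * 2) (by omega) (n - 1) (fun _ => 1) (by simp)
      rwa [pow_mul, ← hq] at this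
  have hMfib : ∀ w, A w = 0 → Nat.card {x // M x = w} = q := by
    intro w hw
    refine fiber_card M A hAM q (q ^ (2 * n - 1)) (by positivity) ?_ ?_ ?_ w hw
    · rw [hcard, ← pow_succ']; congr 1; omega
    · have := addPolyMap_ker (F := F) p e he 1 (fun _ => 1) (by simp)
      rwa [← hq, pow_one] at this
    · have := addPolyMap_ker (F := F) p e he (2 * n - 1) (fun i => (-1) ^ i) (by simp)
      rwa [← hq] at this
  have hu : ∃ u : F, ∀ j, z ^ q ^ (2 * j + n) = u * z ^ q ^ (2 * j) := by
    by_cases hz0 : z = 0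
    · refine ⟨0, fun j => ?_⟩
      rw [hz0, zero_pow (pow_pos hq0 _).ne', zero_mul]
    · refine ⟨z ^ q ^ n / z, fun j => ?_⟩
      have h1 : (z ^ q ^ n) ^ (q + 1) = z ^ (q + 1) := by
        have h3 : z ^ (q + 1) = ξ ^ q ^ n * ξ := by
          rw [hz, ← pow_mul, mul_comm m, hm, pow_succ]
        rw [← pow_mul, mul_comm, pow_mul, h3, mul_pow, ← pow_mul, ← pow_add q, ← two_mul, hfrob,
          mul_comm]
      set u := z ^ q ^ n / z with hu
      have h2 : u ^ (q + 1) = 1 := by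
        rw [hu, div_pow, h1, div_self (pow_ne_zero _ hz0)]
      have hu0 : u ≠ 0 := by
        intro h
        rw [h, zero_pow (by omega)] at h2
        exact zero_ne_one h2
      have huq : u ^ q = u⁻¹ := by
        rw [pow_succ] at h2
        exact eq_inv_of_mul_eq_one_left h2
      have huj : ∀ j, u ^ q ^ (2 * j) = u := by
        intro j
        induction j with
        | zero => simp
        | succ j ih =>
          rw [show 2 * (j + 1) = 2 * j + 1 + 1 by ring, pow_succ, pow_succ, pow_mul, pow_mul, ih,
            huq, inv_pow, huq, inv_inv]
      have h3 : z ^ q ^ n = u * z := by rw [hu, div_mul_cancel₀ _ hz0]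
      rw [add_comm, pow_add, pow_mul, h3, mul_pow, huj]
  obtain ⟨u, hu⟩ := hu
  obtain ⟨h, hh⟩ := hodd
  have key : ∀ y, L y = z → A (y ^ (q + 1)) = 0 := by
    intro y hy
    rw [hLx] at hy
    rw [hAx]
    have := core_sum (fun i => y ^ q ^ i) (fun i => z ^ q ^ i) n h hh u (y ^ q ^ n - u * y)
      (fun i => by
        change y ^ q ^ (i + 2 * n) = _
        rw [add_comm, pow_add, pow_mul, hfrob])
      (fun i => by
        change y ^ q ^ (i + 2) - y ^ q ^ i = _
        rw [← hy, hsub, ← pow_mul, ← pow_add, add_comm])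
      hu (by simp) hξ
    rw [← this]
    apply Finset.sum_congr rfl
    intro i _
    rw [← pow_mul, ← pow_add]
    congr 2
    ring
  have hequiv : {xy : F × F // xy.2 ^ (q + 1) = xy.1 ^ q + xy.1 ∧ xy.2 ^ q ^ 2 - xy.2 = z} ≃
      Σ y : {y // L y = z}, {x // M x = y.1 ^ (q + 1)} :=
    { toFun := fun s => ⟨⟨s.1.2, by rw [hLx]; exact s.2.2⟩, ⟨s.1.1, by rw [hMx]; exact s.2.1.symm⟩⟩
      invFun := fun s => ⟨(s.2.1, s.1.1), by
        refine ⟨?_, ?_⟩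
        · rw [← hMx]; exact s.2.2.symm
        · rw [← hLx]; exact s.1.2⟩
      left_inv := fun s => rfl
      right_inv := fun s => rfl }
  rw [Nat.card_congr hequiv, Nat.card_sigma,
    Finset.sum_congr rfl (fun y _ => hMfib _ (key y.1 y.2)), Finset.sum_const, Finset.card_univ,
    ← Nat.card_eq_fintype_card, hLfib z (by rw [hTx]; exact hξ), smul_eq_mul]
  ring
end

section
/- The set Ξ has exactly q^{2n-1} - q^n + q^{n-1} elements; consequently Ξ \ {0} has exactly (q^n + 1)(q^{n-1} - 1) elements. -/
open Classical in
theorem fiber_count {G H : Type*} [Group G] [Group H] [Fintype G] [Fintype H] (f : G →* H)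
    (P : H → Prop) :
    (Finset.univ.filter fun g => P (f g)).card
      = Nat.card f.ker * (Finset.univ.filter fun h => h ∈ f.range ∧ P h).card := by
  rw [Finset.card_eq_sum_card_fiberwise (f := f)
    (t := Finset.univ.filter fun h => h ∈ f.range ∧ P h)]
  · rw [Finset.sum_const_nat (m := Nat.card f.ker), mul_comm]
    intro h hh
    simp only [Finset.mem_filter, Finset.mem_univ, true_and] at hh
    have h1 := MonoidHom.card_fiber_eq_of_mem_range f (x := h) (y := 1) hh.1 ⟨1, map_one f⟩
    have h2 : (Finset.univ.filter fun g => f g = 1).card = Nat.card f.ker := by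
      rw [Nat.card_eq_fintype_card, Fintype.card_subtype]
      simp only [MonoidHom.mem_ker]
    rw [← h2, ← h1, Finset.filter_filter]
    congr 1
    ext g
    simp only [Finset.mem_filter, Finset.mem_univ, true_and]
    constructor
    · exact fun h => h.2
    · rintro rfl
      exact ⟨hh.2, rfl⟩
  · intro g hg
    simp only [Finset.coe_filter, Finset.mem_univ, true_and, Set.mem_setOf_eq] at hg ⊢
    exact ⟨⟨g, rfl⟩, hg⟩

/-- `x ↦ x^r y^s` is surjective with fibers of size `|U|` when `r, s` are coprime. -/
theorem two_param_count {U : Type*} [CommGroup U] [Fintype U] (r s : ℕ) (hrs : Nat.Coprime r s)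
    (P Q : U → Prop) (hPQ : ∀ x y, P (x ^ r * y ^ s) ↔ Q y) :
    Nat.card {x // P x} = Nat.card {x // Q x} := by
  classical
  let f : U × U →* U :=
    ((powMonoidHom r).comp (MonoidHom.fst U U)) * ((powMonoidHom s).comp (MonoidHom.snd U U))
  have hf : ∀ x y, f (x, y) = x ^ r * y ^ s := fun x y => rfl
  have hsurj : ∀ u, u ∈ f.range := by
    intro u
    refine ⟨(u ^ (r.gcdA s), u ^ (r.gcdB s)), ?_⟩
    rw [hf, ← zpow_natCast, ← zpow_natCast, ← zpow_mul, ← zpow_mul, ← zpow_add]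
    have := Nat.gcd_eq_gcd_ab r s
    rw [hrs.gcd_eq_one] at this
    rw [mul_comm _ (r : ℤ), mul_comm _ (s : ℤ), ← this]
    simp
  have h1 := fiber_count f (fun _ => True)
  have h2 := fiber_count f P
  simp only [hsurj, true_and, Finset.filter_true, Finset.card_univ, Fintype.card_prod] at h1 h2
  have hU : 0 < Fintype.card U := Fintype.card_pos
  have h3 : Nat.card f.ker = Fintype.card U := (Nat.eq_of_mul_eq_mul_right hU h1).symm
  have h4 : (Finset.univ.filter fun g => P (f g)).card
      = Fintype.card U * (Finset.univ.filter fun y => Q y).card := by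
    rw [← Finset.card_univ, ← Finset.card_product]
    congr 1
    ext ⟨x, y⟩
    simp [hf, hPQ]
  rw [h3] at h2
  have := Nat.eq_of_mul_eq_mul_left hU (h2.symm.trans (by convert h4))
  rw [Nat.card_eq_fintype_card, Nat.card_eq_fintype_card, Fintype.card_subtype,
    Fintype.card_subtype]
  convert this

theorem reindex {M : Type*} [AddCommMonoid M] (n : ℕ) (hodd : Odd n) (g : ℕ → M)
    (hg : ∀ i, g (i + n) = g i) :
    ∑ i ∈ Finset.range n, g (2 * i) = ∑ i ∈ Finset.range n, g i := by
  obtain ⟨k, rfl⟩ := hodd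
  refine Finset.sum_nbij' (fun i => if 2 * i < 2 * k + 1 then 2 * i else 2 * i - (2 * k + 1))
    (fun j => if j % 2 = 0 then j / 2 else (j + (2 * k + 1)) / 2) ?_ ?_ ?_ ?_ ?_
  · intro i hi; simp only [Finset.mem_range] at *; split_ifs <;> omega
  · intro i hi; simp only [Finset.mem_range] at *; split_ifs <;> omega
  · intro i hi; simp only [Finset.mem_range] at *; split_ifs <;> omega
  · intro i hi; simp only [Finset.mem_range] at *; split_ifs <;> omega
  · intro i hi
    simp only [Finset.mem_range] at *
    split_ifs with h
    · rfl
    · rw [← hg (2 * i - (2 * k + 1))]; congr 1; omega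

theorem coprime_geom (q n : ℕ) (hodd : Odd n) :
    Nat.Coprime (∑ i ∈ Finset.range n, q ^ i) (q + 1) := by
  obtain ⟨k, rfl⟩ := hodd
  induction k with
  | zero => simp
  | succ k ih =>
    rw [show 2 * (k + 1) + 1 = (2 * k + 1) + 1 + 1 by ring, Finset.sum_range_succ,
      Finset.sum_range_succ, add_assoc,
      show q ^ (2 * k + 1) + q ^ (2 * k + 1 + 1) = q ^ (2 * k + 1) * (q + 1) by ring]
    simpa using ih

section field
variable {F : Type*} [Field F] [Fintype F]

open Polynomial in
open Classical in
theorem ker_le (q n : ℕ) (hq : 2 ≤ q) :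
    (Finset.univ.filter fun t : F => ∑ i ∈ Finset.range (n + 1), t ^ q ^ i = 0).card ≤ q ^ n := by
  let f : F[X] := ∑ i ∈ Finset.range n, X ^ q ^ i
  have hdeg : f.degree < (q ^ n : ℕ) := by
    refine (Polynomial.degree_sum_le _ _).trans_lt ?_
    rw [Finset.sup_lt_iff (WithBot.bot_lt_coe _)]
    intro i hi
    rw [degree_X_pow]
    exact_mod_cast Nat.pow_lt_pow_right (by omega) (Finset.mem_range.1 hi)
  have hm : (X ^ q ^ n + f).Monic := monic_X_pow_add hdeg
  have hnd : (X ^ q ^ n + f).natDegree = q ^ n := by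
    apply natDegree_eq_of_degree_eq_some
    rw [degree_add_eq_left_of_degree_lt (by rwa [degree_X_pow]), degree_X_pow]
  rw [← hnd]
  apply card_le_degree_of_subset_roots
  intro t ht
  simp only [Finset.mem_val, Finset.mem_filter, Finset.mem_univ, true_and] at ht
  rw [mem_roots hm.ne_zero, IsRoot, ← ht, Finset.sum_range_succ]
  simp [f, eval_finset_sum, add_comm]

open Polynomial in
open Classical in
theorem fix_le (q : ℕ) (hq : 2 ≤ q) :
    (Finset.univ.filter fun t : F => t ^ q = t).card ≤ q := by
  have h := FiniteField.X_pow_card_sub_X_natDegree_eq F (p := q) (by omega)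
  conv_rhs => rw [← h]
  apply card_le_degree_of_subset_roots
  intro t ht
  simp only [Finset.mem_val, Finset.mem_filter, Finset.mem_univ, true_and] at ht
  rw [mem_roots (FiniteField.X_pow_card_sub_X_ne_zero F (by omega)), IsRoot]
  simp [ht]

theorem S_frob (p e n : ℕ) [ExpChar F p] (t : F) :
    (∑ i ∈ Finset.range n, t ^ (p ^ e) ^ i) ^ (p ^ e) + t
      = (∑ i ∈ Finset.range n, t ^ (p ^ e) ^ i) + t ^ (p ^ e) ^ n := by
  rw [← iterateFrobenius_def, map_sum, ← Finset.sum_range_succ, Finset.sum_range_succ']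
  simp [iterateFrobenius_def, ← pow_mul, pow_succ]

open Classical in
/-- Kernel of the trace has exactly `q^n` elements (extension degree `n+1`). -/
theorem ker_card (p e n : ℕ) [ExpChar F p] (hq : 2 ≤ p ^ e)
    (hL : (p ^ e) ^ (n + 1) ≤
      (Finset.univ.filter fun t : F => t ^ (p ^ e) ^ (n + 1) = t).card) :
    (Finset.univ.filter fun t : F => ∑ i ∈ Finset.range (n + 1), t ^ (p ^ e) ^ i = 0).card
      = (p ^ e) ^ n := by
  apply le_antisymm (ker_le _ _ hq)
  let S : F →+ F := ∑ i ∈ Finset.range (n + 1), (iterateFrobenius F p (e * i)).toAddMonoidHom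
  have hS : ∀ t, S t = ∑ i ∈ Finset.range (n + 1), t ^ (p ^ e) ^ i := by
    intro t
    simp [S, AddMonoidHom.finset_sum_apply, iterateFrobenius_def, pow_mul]
  simp only [← hS]
  set K := Finset.univ.filter fun t : F => S t = 0 with hK
  have h1 := Finset.card_le_mul_card_image (f := S)
    (Finset.univ.filter fun t : F => t ^ (p ^ e) ^ (n + 1) = t) K.card (by
      intro b hb
      obtain ⟨a, ha, rfl⟩ := Finset.mem_image.1 hb
      apply Finset.card_le_card_of_injOn (fun x => x - a)
      · intro x hx
        simp at hx
        simp [hK, hx.2]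
      · intro x _ y _ h
        simpa using h)
  have h2 : (Finset.image S (Finset.univ.filter fun t : F => t ^ (p ^ e) ^ (n + 1) = t)).card
      ≤ p ^ e := by
    refine le_trans (Finset.card_le_card ?_) (fix_le (F := F) (p ^ e) hq)
    intro z hz
    obtain ⟨a, ha, rfl⟩ := Finset.mem_image.1 hz
    simp only [Finset.mem_filter, Finset.mem_univ, true_and] at ha ⊢
    have := S_frob (F := F) p e (n + 1) a
    rw [ha, ← hS] at this
    exact add_right_cancel this
  have h3 : (p ^ e) ^ n * p ^ e ≤ K.card * p ^ e := by
    rw [← pow_succ]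
    exact hL.trans (h1.trans (Nat.mul_le_mul_left _ h2))
  exact Nat.le_of_mul_le_mul_right h3 (by omega)

end field

theorem key (p e q n m : ℕ) (hp : p.Prime) (he : 0 < e) (hq : q = p ^ e)
    (hn : 5 ≤ n) (hodd : Odd n) (hm : (q + 1) * m = q ^ n + 1)
    (F : Type*) [Field F] [Fintype F] (hF : Fintype.card F = q ^ (2 * n)) :
    Nat.card {ξ : Fˣ // ∑ i ∈ Finset.range n, ((ξ : F) ^ m) ^ q ^ (2 * i) = 0}
        = (q ^ n + 1) * (q ^ (n - 1) - 1) := by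
  classical
  have hq2 : 2 ≤ q := by
    rw [hq]; exact hp.two_le.trans (Nat.le_self_pow he.ne' p)
  have hqn : 1 ≤ q ^ n := Nat.one_le_pow _ _ (by omega)
  have hchar : CharP F p := by
    rw [CharP.charP_iff_prime_eq_zero hp]
    have := FiniteField.cast_card_eq_zero F
    rw [hF, hq, ← pow_mul] at this
    push_cast at this
    exact pow_eq_zero_iff (by positivity) |>.1 this
  have : Fact p.Prime := ⟨hp⟩
  have hU : Fintype.card Fˣ = (q ^ n - 1) * (q ^ n + 1) := by
    rw [Fintype.card_units, hF, mul_comm 2 n, pow_mul]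
    obtain ⟨a, ha⟩ := Nat.exists_eq_add_of_le hqn
    rw [ha]
    have : (1 + a) ^ 2 = (1 + a - 1) * (1 + a + 1) + 1 := by
      rw [Nat.add_sub_cancel_left]; ring
    omega
  have hUpow : ∀ x : F, x ≠ 0 → x ^ ((q ^ n - 1) * (q ^ n + 1)) = 1 := by
    intro x hx
    rw [← hU, Fintype.card_units]; exact FiniteField.pow_card_sub_one_eq_one x hx
  set r := ∑ i ∈ Finset.range n, q ^ i with hr
  have hr1 : (q - 1) * r = q ^ n - 1 := by
    have := Nat.geomSum_eq hq2 n
    rw [hr, this, Nat.mul_div_cancel']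
    simpa using Nat.sub_dvd_pow_sub_pow q 1 n
  -- step 1
  have step1 := two_param_count (U := Fˣ) r (q + 1) (coprime_geom q n hodd)
    (fun ξ => ∑ i ∈ Finset.range n, ((ξ : F) ^ m) ^ q ^ (2 * i) = 0)
    (fun y => ∑ i ∈ Finset.range n, (((y ^ (q ^ n + 1) : Fˣ) : F)) ^ q ^ (2 * i) = 0) (by
      intro x y
      have hk : ∀ i, (((x : F) ^ (r * m)) ^ q ^ (2 * i)) = (x : F) ^ (r * m) := by
        intro i
        have h1 : ((x : F) ^ (r * m)) ^ (q ^ 2) = (x : F) ^ (r * m) := by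
          have : r * m * q ^ 2 = r * m + (q ^ n - 1) * (q ^ n + 1) := by
            rw [← hr1, ← hm]
            obtain ⟨a, rfl⟩ := Nat.exists_eq_add_of_le hq2
            rw [show 2 + a - 1 = 1 + a by omega]
            ring
          rw [← pow_mul, this, pow_add, hUpow _ x.ne_zero, mul_one]
        induction i with
        | zero => simp
        | succ i ih =>
          rw [show 2 * (i + 1) = 2 * i + 2 by ring, pow_add, pow_mul, ih, h1]
      have : ∀ i, (((x ^ r * y ^ (q + 1) : Fˣ) : F) ^ m) ^ q ^ (2 * i)
          = (x : F) ^ (r * m) * (((y ^ (q ^ n + 1) : Fˣ) : F)) ^ q ^ (2 * i) := by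
        intro i
        rw [← hm]
        conv_rhs => rw [← hk i]
        push_cast
        rw [← mul_pow, mul_pow, ← pow_mul, ← pow_mul]
      simp only [this, ← Finset.mul_sum]
      simp)
  rw [step1, Nat.card_eq_fintype_card, Fintype.card_subtype]
  -- step 2
  have h2 := fiber_count (powMonoidHom (q ^ n + 1) : Fˣ →* Fˣ)
    (fun t => ∑ i ∈ Finset.range n, (t : F) ^ q ^ (2 * i) = 0)
  have hkerc : Nat.card (powMonoidHom (q ^ n + 1) : Fˣ →* Fˣ).ker = q ^ n + 1 := by
    rw [IsCyclic.card_powMonoidHom_ker, Nat.card_eq_fintype_card, hU, Nat.gcd_mul_left_left]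
  have hrangec : Nat.card (powMonoidHom (q ^ n + 1) : Fˣ →* Fˣ).range = q ^ n - 1 := by
    rw [IsCyclic.card_powMonoidHom_range, Nat.card_eq_fintype_card, hU, Nat.gcd_mul_left_left,
      Nat.mul_div_cancel _ (by omega)]
  have hq1 : 0 < q ^ n - 1 := by
    have := Nat.pow_lt_pow_right (show 1 < q by omega) (show 0 < n by omega)
    simp at this; omega
  have hrange : (Finset.univ.filter fun t : Fˣ => t ∈ (powMonoidHom (q ^ n + 1) : Fˣ →* Fˣ).range)
      = Finset.univ.filter fun t : Fˣ => t ^ (q ^ n - 1) = 1 := by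
    apply Finset.eq_of_subset_of_card_le
    · intro t ht
      simp only [Finset.mem_filter, Finset.mem_univ, true_and] at ht ⊢
      obtain ⟨y, rfl⟩ := ht
      rw [powMonoidHom_apply, ← pow_mul, mul_comm, ← hU, pow_card_eq_one]
    · refine (IsCyclic.card_pow_eq_one_le hq1).trans ?_
      rw [← hrangec, Nat.card_eq_fintype_card, Fintype.card_subtype]
  have hfix : ∀ t : Fˣ, t ∈ (powMonoidHom (q ^ n + 1) : Fˣ →* Fˣ).range ↔ (t : F) ^ q ^ n = t := by
    intro t
    have := congrArg (t ∈ ·) hrange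
    simp only [Finset.mem_filter, Finset.mem_univ, true_and, eq_iff_iff] at this
    rw [this, ← Units.val_pow_eq_pow_val, Units.val_inj]
    conv_rhs => rw [show q ^ n = (q ^ n - 1) + 1 by omega, pow_succ]
    simp
  -- the set of units and the set of nonzero elements
  have hunits : ∀ P : F → Prop, P 0 → (Finset.univ.filter fun t : F => P t).card
      = (Finset.univ.filter fun t : Fˣ => P t).card + 1 := by
    intro P h0
    have : (Finset.univ.filter fun t : F => P t)
      = insert 0 ((Finset.univ.filter fun t : Fˣ => P t).map ⟨Units.val, Units.val_injective⟩) := by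
      ext t
      simp only [Finset.mem_filter, Finset.mem_univ, true_and, Finset.mem_insert, Finset.mem_map,
        Function.Embedding.coeFn_mk]
      constructor
      · intro h
        by_cases ht : t = 0
        · exact Or.inl ht
        · exact Or.inr ⟨Units.mk0 t ht, h, rfl⟩
      · rintro (rfl | ⟨u, hu, rfl⟩)
        · exact h0
        · exact hu
    rw [this, Finset.card_insert_of_notMem, Finset.card_map]
    simp
  have hL : (Finset.univ.filter fun t : F => t ^ q ^ n = t).card = q ^ n := by
    rw [hunits (fun t => t ^ q ^ n = t) (by simp; omega)]
    simp only [← hfix]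
    rw [← Fintype.card_subtype, ← Nat.card_eq_fintype_card]
    erw [hrangec]
    omega
  obtain ⟨k, rfl⟩ : ∃ k, n = k + 1 := ⟨n - 1, by omega⟩
  have hker : (Finset.univ.filter fun t : F => ∑ i ∈ Finset.range (k + 1), t ^ q ^ i = 0).card
      = q ^ k := by
    subst hq
    exact ker_card p e k hq2 (by rw [hL])
  rw [hunits (fun t => ∑ i ∈ Finset.range (k + 1), t ^ q ^ i = 0)
    (Finset.sum_eq_zero fun i _ => zero_pow (by positivity))] at hker
  have hset : (Finset.univ.filter fun t : Fˣ => t ∈ (powMonoidHom (q ^ (k + 1) + 1) : Fˣ →* Fˣ).range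
      ∧ ∑ i ∈ Finset.range (k + 1), (t : F) ^ q ^ (2 * i) = 0)
      = Finset.univ.filter fun t : Fˣ => ∑ i ∈ Finset.range (k + 1), (t : F) ^ q ^ i = 0 := by
    ext t
    simp only [Finset.mem_filter, Finset.mem_univ, true_and, hfix]
    have hre : (t : F) ^ q ^ (k + 1) = t →
        ∑ i ∈ Finset.range (k + 1), (t : F) ^ q ^ (2 * i)
        = ∑ i ∈ Finset.range (k + 1), (t : F) ^ q ^ i := fun h =>
      reindex (k + 1) hodd (fun i => (t : F) ^ q ^ i) (fun i => by
        rw [pow_add q i, mul_comm, pow_mul, h])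
    constructor
    · rintro ⟨h, h'⟩
      rwa [← hre h]
    · intro h
      have hs : (t : F) ^ q ^ (k + 1) = t := by
        have := S_frob (F := F) p e (k + 1) (t : F)
        rw [← hq, h, zero_pow (by omega), zero_add, zero_add] at this
        exact this.symm
      exact ⟨hs, by rwa [hre hs]⟩
  have h2' : (Finset.univ.filter fun t : Fˣ =>
      ∑ i ∈ Finset.range (k + 1), (((t ^ (q ^ (k + 1) + 1) : Fˣ) : F)) ^ q ^ (2 * i) = 0).card
      = (q ^ (k + 1) + 1) * (Finset.univ.filter fun t : Fˣ =>
        ∑ i ∈ Finset.range (k + 1), (t : F) ^ q ^ i = 0).card := by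
    rw [← hset]
    rw [hkerc] at h2
    convert h2
    rfl
  rw [Nat.add_sub_cancel, ← hker, Nat.add_sub_cancel]
  exact h2'

theorem stmt_9 (p e q n m : ℕ) (hp : p.Prime) (he : 0 < e) (hq : q = p ^ e)
    (hn : 5 ≤ n) (hodd : Odd n) (hm : (q + 1) * m = q ^ n + 1)
    (F : Type*) [Field F] [Fintype F] (hF : Fintype.card F = q ^ (2 * n)) :
    Nat.card {ξ : F // ∑ i ∈ Finset.range n, (ξ ^ m) ^ q ^ (2 * i) = 0}
        = q ^ (2 * n - 1) - q ^ n + q ^ (n - 1) ∧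
    Nat.card {ξ : F // ξ ≠ 0 ∧ ∑ i ∈ Finset.range n, (ξ ^ m) ^ q ^ (2 * i) = 0}
        = (q ^ n + 1) * (q ^ (n - 1) - 1) := by
  classical
  have hk := key p e q n m hp he hq hn hodd hm F hF
  have hq0 : 0 < q := by rw [hq]; exact pow_pos hp.pos e
  have hm0 : m ≠ 0 := by rintro rfl; simp at hm
  have h2 : Nat.card {ξ : F // ξ ≠ 0 ∧ ∑ i ∈ Finset.range n, (ξ ^ m) ^ q ^ (2 * i) = 0}
        = (q ^ n + 1) * (q ^ (n - 1) - 1) := by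
    rw [← hk]
    refine Nat.card_congr ⟨fun x => ⟨Units.mk0 x.1 x.2.1, x.2.2⟩,
      fun u => ⟨u.1, u.1.ne_zero, u.2⟩, fun x => rfl, fun u => by ext; rfl⟩
  refine ⟨?_, h2⟩
  have h3 : Nat.card {ξ : F // ∑ i ∈ Finset.range n, (ξ ^ m) ^ q ^ (2 * i) = 0}
      = Nat.card {ξ : F // ξ ≠ 0 ∧ ∑ i ∈ Finset.range n, (ξ ^ m) ^ q ^ (2 * i) = 0} + 1 := by
    rw [Nat.card_eq_fintype_card, Nat.card_eq_fintype_card, Fintype.card_subtype,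
      Fintype.card_subtype, ← Finset.card_insert_of_notMem (a := (0 : F)) (by simp)]
    congr 1
    ext t
    simp only [Finset.mem_filter, Finset.mem_univ, true_and, Finset.mem_insert]
    constructor
    · intro h
      by_cases ht : t = 0
      · exact Or.inl ht
      · exact Or.inr ⟨ht, h⟩
    · rintro (rfl | h)
      · exact Finset.sum_eq_zero fun i _ => by rw [zero_pow hm0, zero_pow (by positivity)]
      · exact h.2
  rw [h3, h2]
  obtain ⟨k, rfl⟩ : ∃ k, n = k + 1 := ⟨n - 1, by omega⟩
  have hk1 : 1 ≤ q ^ k := Nat.one_le_pow _ _ hq0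
  have h4 : q ^ (k + 1) ≤ q ^ (2 * (k + 1) - 1) := Nat.pow_le_pow_right hq0 (by omega)
  have h5 : q ^ (2 * (k + 1) - 1) = q ^ (k + 1) * q ^ k := by
    rw [← pow_add]; congr 1; omega
  rw [h5] at h4
  rw [Nat.add_sub_cancel, h5]
  zify [hk1, h4]
  ring
end

section
/- In the polynomial ring F[Z] one has the identity ∏_{ξ ∈ Ξ} (Z - ξ) = Z · p(Z^{(q^n+1)(q-1)}); in particular, the polynomial f(Z) = Z · p(Z^{(q^n+1)(q-1)}) factorizes completely over F into distinct linear factors whose roots are exactly the elements of Ξ. -/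
open Polynomial

theorem aux_S (r i : ℕ) :
    (∑ j ∈ Finset.range i, (r+1) ^ (2 * j)) * ((r + 2) * r) + 1 = (r+1) ^ (2 * i) := by
  induction i with
  | zero => simp
  | succ i ih =>
    rw [Finset.sum_range_succ, show 2 * (i+1) = 2 * i + 2 by ring, pow_add, ← ih]
    ring

theorem aux_M (r k : ℕ) :
    ((∑ j ∈ Finset.range k, (r+1) ^ (2 * j)) + ∑ j ∈ Finset.range k, (r+1) ^ (2 * j + 1)) * r + 1
      = (r+1) ^ (2 * k) := by
  induction k with
  | zero => simp
  | succ i ih =>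
    rw [Finset.sum_range_succ, Finset.sum_range_succ, show 2 * (i+1) = 2 * i + 2 by ring,
      pow_add _ _ 2, pow_add _ _ 1, ← ih]
    ring

theorem aux_T (r k : ℕ) :
    ((∑ j ∈ Finset.range (k+1), (r+1) ^ (2 * j)) +
      ∑ j ∈ Finset.range k, (r+1) ^ (2 * j + 1)) * r + 1 = (r+1) ^ (2 * k + 1) := by
  rw [Finset.sum_range_succ, pow_succ, ← aux_M r k]
  ring

theorem aux_add {F : Type*} [Field F] (r k : ℕ) (w : F)
    (h1 : w ^ (r+1) ^ (2*k+1) = w)  (l : ℕ) :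
    w ^ (∑ j ∈ Finset.range (k+1+l), (r+1) ^ (2 * j)) =
      w ^ (∑ j ∈ Finset.range (k+1), (r+1) ^ (2 * j)) *
        w ^ (∑ j ∈ Finset.range l, (r+1) ^ (2 * j + 1)) := by
  induction l with
  | zero => simp
  | succ l ih =>
    rw [← add_assoc, Finset.sum_range_succ, pow_add, ih, Finset.sum_range_succ _ l, pow_add,
      show 2 * (k+1+l) = (2*k+1) + (2*l+1) by ring, pow_add (r+1) (2*k+1), pow_mul, h1]
    ring

theorem aux_key {F : Type*} [Field F] (r k : ℕ) (w : F)
    (h1 : w ^ (r+1) ^ (2*(k+1)+1) = w)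
    (hT : w ^ ((∑ j ∈ Finset.range (k+1+1), (r+1) ^ (2 * j)) +
      ∑ j ∈ Finset.range (k+1), (r+1) ^ (2 * j + 1)) = 1) :
    w ^ (∑ j ∈ Finset.range (k+1), (r+1) ^ (2 * j + 1)) *
      ∑ i ∈ Finset.range (2*(k+1)+1), w ^ (∑ j ∈ Finset.range i, (r+1) ^ (2 * j)) =
    1 + ∑ i ∈ Finset.range (k+1),
            w ^ ((∑ j ∈ Finset.range (i + 1), (r+1) ^ (2 * j))
              + ∑ j ∈ Finset.range (k+1), (r+1) ^ (2 * j + 1))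
        + ∑ i ∈ Finset.range (k+1), w ^ (∑ j ∈ Finset.range (i + 1), (r+1) ^ (2 * j + 1)) := by
  rw [show 2*(k+1)+1 = (k+1+1) + (k+1) by ring,
    Finset.sum_range_add (fun i => w ^ (∑ j ∈ Finset.range i, (r+1) ^ (2 * j))) (k+1+1) (k+1), mul_add]
  have e2 : w ^ (∑ j ∈ Finset.range (k+1), (r+1) ^ (2 * j + 1)) *
      ∑ l ∈ Finset.range (k+1), w ^ (∑ j ∈ Finset.range (k+1+1+l), (r+1) ^ (2 * j)) =
      ∑ l ∈ Finset.range (k+1), w ^ (∑ j ∈ Finset.range l, (r+1) ^ (2 * j + 1)) := by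
    rw [Finset.mul_sum]
    refine Finset.sum_congr rfl fun l _ => ?_
    rw [aux_add r (k+1) w h1 l, ← mul_assoc, ← pow_add, add_comm, hT, one_mul]
  rw [e2, Finset.sum_range_succ' _ (k+1), 
    Finset.sum_range_succ' (fun l => w ^ (∑ j ∈ Finset.range l, (r+1) ^ (2 * j + 1))) k, mul_add, Finset.mul_sum,
    Finset.sum_range_succ (fun i => w ^ (∑ j ∈ Finset.range (i + 1), (r+1) ^ (2 * j + 1))) k]
  have e3 : ∀ i, w ^ (∑ j ∈ Finset.range (k+1), (r+1) ^ (2 * j + 1)) *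
      w ^ (∑ j ∈ Finset.range (i+1), (r+1) ^ (2 * j)) =
      w ^ ((∑ j ∈ Finset.range (i + 1), (r+1) ^ (2 * j))
              + ∑ j ∈ Finset.range (k+1), (r+1) ^ (2 * j + 1)) := by
    intro i; rw [← pow_add, add_comm]
  simp only [e3, Finset.range_zero, Finset.sum_empty, pow_zero, mul_one]
  ring

theorem aux_sum {F : Type*} [Field F] (r m N n : ℕ) (ξ : F) (hN : N = (r+2) * m * r) :
    ∑ i ∈ Finset.range n, (ξ ^ m) ^ (r+1) ^ (2 * i) =
      ξ ^ m * ∑ i ∈ Finset.range n, (ξ ^ N) ^ (∑ j ∈ Finset.range i, (r+1) ^ (2 * j)) := by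
  rw [Finset.mul_sum]
  refine Finset.sum_congr rfl fun i _ => ?_
  rw [← pow_mul, ← pow_mul, ← pow_add, ← aux_S, hN]
  congr 1
  ring

theorem aux_P {F : Type*} [Field F] (r k : ℕ) (P : F[X])
    (hP : P = 1
        + ∑ i ∈ Finset.range (k+1),
            X ^ ((∑ j ∈ Finset.range (i + 1), (r+1) ^ (2 * j))
              + ∑ j ∈ Finset.range (k+1), (r+1) ^ (2 * j + 1))
        + ∑ i ∈ Finset.range (k+1), X ^ (∑ j ∈ Finset.range (i + 1), (r+1) ^ (2 * j + 1))) :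
    P.Monic ∧ P.natDegree = (∑ j ∈ Finset.range (k + 1), (r+1) ^ (2 * j))
              + ∑ j ∈ Finset.range (k+1), (r+1) ^ (2 * j + 1) := by
  set M := (∑ j ∈ Finset.range (k + 1), (r+1) ^ (2 * j))
              + ∑ j ∈ Finset.range (k+1), (r+1) ^ (2 * j + 1) with hM
  have hSpos : 0 < ∑ j ∈ Finset.range (k + 1), (r+1) ^ (2 * j) :=
    Finset.sum_pos (fun _ _ => by positivity) (by simp)
  set R : F[X] := 1 + ∑ i ∈ Finset.range k,
            X ^ ((∑ j ∈ Finset.range (i + 1), (r+1) ^ (2 * j))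
              + ∑ j ∈ Finset.range (k+1), (r+1) ^ (2 * j + 1))
        + ∑ i ∈ Finset.range (k+1), X ^ (∑ j ∈ Finset.range (i + 1), (r+1) ^ (2 * j + 1)) with hR
  have hPR : P = X ^ M + R := by
    rw [hP, hR, Finset.sum_range_succ _ k, ← hM]; ring
  have hS : ∀ a b, a < b → ∑ j ∈ Finset.range a, (r+1) ^ (2 * j) <
      ∑ j ∈ Finset.range b, (r+1) ^ (2 * j) := by
    intro a b hab
    refine Finset.sum_lt_sum_of_subset (i := a) (by simpa using hab.le) (by simpa) (by simp)
      (by positivity) (fun _ _ _ => by positivity)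
  have hdeg : R.degree < M := by
    rw [hR]
    have hb : (⊥ : WithBot ℕ) < (M : WithBot ℕ) := WithBot.bot_lt_coe M
    refine (degree_add_le _ _).trans_lt (max_lt ((degree_add_le _ _).trans_lt (max_lt ?_ ?_)) ?_)
    · rw [degree_one]; exact_mod_cast (by omega : 0 < M)
    · refine (degree_sum_le _ _).trans_lt ((Finset.sup_lt_iff hb).2 fun i hi => ?_)
      rw [degree_X_pow]
      have := hS (i+1) (k+1) (by simpa using hi)
      exact_mod_cast (by omega)
    · refine (degree_sum_le _ _).trans_lt ((Finset.sup_lt_iff hb).2 fun i hi => ?_)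
      rw [degree_X_pow]
      have : ∑ j ∈ Finset.range (i+1), (r+1) ^ (2 * j + 1) ≤
        ∑ j ∈ Finset.range (k+1), (r+1) ^ (2 * j + 1) := by
        refine Finset.sum_le_sum_of_subset ?_
        simp at hi ⊢; omega
      exact_mod_cast (by omega)
  refine ⟨hPR ▸ monic_X_pow_add hdeg, ?_⟩
  rw [hPR, natDegree_add_eq_left_of_degree_lt (by rwa [degree_X_pow]), natDegree_X_pow]

theorem aux_pow {F : Type*} [Field F] [Fintype F] [DecidableEq F] (d : ℕ) (hd : 0 < d) (a : F) :
    (Finset.univ.filter fun x : F => x ^ d = a).card ≤ d := by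
  refine le_trans ?_ (card_nthRoots d a)
  refine le_trans (Finset.card_le_card (t := (nthRoots d a).toFinset) ?_)
    (Multiset.toFinset_card_le _)
  intro x hx
  simpa [mem_nthRoots hd] using hx

theorem aux_fib {F : Type*} [Field F] [Fintype F] [DecidableEq F] (s : Finset F) (d : ℕ)
    (g : F → F) (hg : ∀ x ∈ s, ∀ y ∈ s, g (x - y) = g x - g y) (hs : ∀ x ∈ s, ∀ y ∈ s, x - y ∈ s)
    (hk : (s.filter fun x => g x = 0).card ≤ d) : s.card ≤ d * (s.image g).card := by
  refine Finset.card_le_mul_card_image s d fun b hb => ?_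
  obtain ⟨x, hx, rfl⟩ := Finset.mem_image.1 hb
  refine le_trans (Finset.card_le_card_of_injOn (fun y => y - x) ?_ ?_) hk
  · intro y hy
    simp only [Finset.coe_filter, Set.mem_setOf_eq] at hy ⊢
    exact ⟨hs _ hy.1 _ hx, by rw [hg _ hy.1 _ hx, hy.2, sub_self]⟩
  · intro y _ z _ h
    simpa using h

theorem aux_poly_s10 {F : Type*} [Field F] [Fintype F] [DecidableEq F] (f : F[X]) (d : ℕ)
    (hf : f ≠ 0) (hd : f.natDegree ≤ d) :
    (Finset.univ.filter fun x : F => f.eval x = 0).card ≤ d := by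
  refine le_trans ?_ ((card_roots' f).trans hd)
  refine le_trans (Finset.card_le_card (t := f.roots.toFinset) ?_)
    (Multiset.toFinset_card_le _)
  intro x hx
  simpa [hf] using hx

theorem aux_frob {F : Type*} [Field F] [Fintype F] [DecidableEq F] (s : Finset F) (Q : ℕ) (hQ : 1 < Q)
    (c : F) : (s.filter fun x : F => x ^ Q + c * x = 0).card ≤ Q := by
  have h : (X ^ Q + C c * X : F[X]).natDegree = Q := by
    rw [natDegree_add_eq_left_of_natDegree_lt, natDegree_X_pow]
    rw [natDegree_X_pow]
    refine lt_of_le_of_lt (natDegree_C_mul_le _ _) (by simpa)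
  refine le_trans (Finset.card_le_card ?_) (aux_poly_s10 (X ^ Q + C c * X) Q ?_ h.le)
  · intro x hx
    simp only [Finset.mem_filter, Finset.mem_univ, true_and, eval_add, eval_pow, eval_X,
      eval_mul, eval_C] at hx ⊢
    exact hx.2
  · intro h0
    rw [h0] at h
    simp at h; omega

theorem aux_two {F : Type*} [Field F] (q k : ℕ) (x : F) (h2 : x ^ q ^ 2 = x)
    (hn : x ^ q ^ (2 * k + 1) = x) : x ^ q = x := by
  have : ∀ j, x ^ q ^ (2 * j) = x := by
    intro j
    induction j with
    | zero => simp
    | succ j ih => rw [mul_add, pow_add, pow_mul, ih, mul_one, h2]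
  rw [pow_succ, pow_mul, this] at hn
  exact hn

theorem aux_A {F : Type*} [Field F] [Fintype F] [DecidableEq F] (q k : ℕ) (hq : 1 < q)
    (hsub : ∀ j, ∀ x y : F, (x - y) ^ q ^ j = x ^ q ^ j - y ^ q ^ j)
    (hF : Fintype.card F = q ^ (2 * (2 * k + 1))) :
    q ^ (2 * k) ≤ (Finset.univ.filter fun c : F => c ^ q ^ (2 * k + 1) = c ∧
      ∑ i ∈ Finset.range (2 * k + 1), c ^ q ^ (2 * i) = 0).card := by
  have hQ : ∀ x : F, x ^ q ^ (2 * (2 * k + 1)) = x := fun x => by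
    rw [← hF]; exact FiniteField.pow_card x
  have hadd : ∀ j, ∀ x y : F, (x + y) ^ q ^ j = x ^ q ^ j + y ^ q ^ j := by
    intro j x y
    have := hsub j (x + y) y
    rw [add_sub_cancel_right] at this
    rw [this]; ring
  set n := 2 * k + 1 with hn
  set B := Finset.univ.filter fun b : F => b ^ q ^ n = b with hB
  have hBc : q ^ n ≤ B.card := by
    have h1 := aux_fib (Finset.univ : Finset F) (q ^ n) (fun x => x ^ q ^ n + 1 * x)
      (by intro x _ y _; simp only [hsub]; ring) (by simp)
      (aux_frob _ _ (Nat.one_lt_pow (by omega) hq) _)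
    rw [Finset.card_univ, hF, two_mul, pow_add] at h1
    have h2 := Nat.le_of_mul_le_mul_left h1 (by positivity)
    refine h2.trans (Finset.card_le_card ?_)
    intro y hy
    obtain ⟨x, -, rfl⟩ := Finset.mem_image.1 hy
    simp only [hB, Finset.mem_filter, Finset.mem_univ, true_and, one_mul]
    rw [hadd, ← pow_mul, ← pow_add, ← two_mul, hQ, add_comm]
  have h1 := aux_fib B q (fun x => x ^ q ^ 2 - x)
      (by intro x _ y _; simp only [hsub]; ring)
      (by
        intro x hx y hy
        simp only [hB, Finset.mem_filter, Finset.mem_univ, true_and] at hx hy ⊢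
        rw [hsub, hx, hy]) (by
        refine le_trans (Finset.card_le_card ?_) (aux_frob Finset.univ q hq (-1))
        intro x hx
        simp only [hB, Finset.mem_filter, Finset.mem_univ, true_and] at hx ⊢
        rw [aux_two q k x (sub_eq_zero.1 hx.2) hx.1]; ring)
  have h2 : q * q ^ (2 * k) ≤ q * (B.image fun x => x ^ q ^ 2 - x).card := by
    refine le_trans ?_ h1
    rw [← pow_succ']; exact hBc
  have h3 := Nat.le_of_mul_le_mul_left h2 (by positivity)
  refine h3.trans (Finset.card_le_card ?_)
  intro y hy
  obtain ⟨x, hx, rfl⟩ := Finset.mem_image.1 hy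
  simp only [hB, Finset.mem_filter, Finset.mem_univ, true_and] at hx ⊢
  constructor
  · rw [hsub, hx, ← pow_mul, mul_comm, pow_mul, hx]
  · have : ∀ i, (x ^ q ^ 2 - x) ^ q ^ (2 * i) = x ^ q ^ (2 * (i + 1)) - x ^ q ^ (2 * i) := by
      intro i
      rw [hsub, ← pow_mul, ← pow_add]
      congr 3; ring
    simp only [this]
    rw [Finset.sum_range_sub (fun i => x ^ q ^ (2 * i)), hQ]
    simp

theorem aux_solve {F : Type*} [Field F] [Fintype F] [DecidableEq F] (a b : ℕ) (hb : 0 < b)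
    (hab : Fintype.card F = a * b + 1) (c : F) (hc0 : c ≠ 0) (hc : c ^ b = 1) :
    ∃ d : F, d ^ a = c := by
  obtain ⟨g, hg⟩ := IsCyclic.exists_generator (α := Fˣ)
  have ho : orderOf g = a * b := by
    rw [orderOf_eq_card_of_forall_mem_zpowers hg, Nat.card_eq_fintype_card, Fintype.card_units, hab]
    simp
  obtain ⟨t, ht⟩ := (mem_powers_iff_mem_zpowers).2 (hg (Units.mk0 c hc0))
  simp only at ht
  have h1 : g ^ (t * b) = 1 := by
    rw [pow_mul, ht]; ext; simpa using hc
  have h2 := orderOf_dvd_of_pow_eq_one h1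
  rw [ho] at h2
  obtain ⟨s, rfl⟩ := Nat.dvd_of_mul_dvd_mul_right hb h2
  refine ⟨((g ^ s : Fˣ) : F), ?_⟩
  rw [← Units.val_pow_eq_pow_val, ← pow_mul, mul_comm, ht]; simp

theorem aux_count {F : Type*} [Field F] [Fintype F] [DecidableEq F] (a b : ℕ)
    (ha : 0 < a) (hb : 0 < b)
    (hab : Fintype.card F = a * b + 1) (d : F) (hd : d ≠ 0) :
    a ≤ (Finset.univ.filter fun x : F => x ^ a = d ^ a).card := by
  obtain ⟨g, hg⟩ := IsCyclic.exists_generator (α := Fˣ)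
  have ho : orderOf g = a * b := by
    rw [orderOf_eq_card_of_forall_mem_zpowers hg, Nat.card_eq_fintype_card, Fintype.card_units, hab]
    simp
  have ho' : orderOf (g ^ b) = a := by
    rw [orderOf_pow_of_dvd hb.ne' (by rw [ho]; exact dvd_mul_left _ _), ho, Nat.mul_div_cancel _ hb]
  rw [← Finset.card_range a]
  conv_lhs => rw [Finset.card_range, ← Finset.card_range a]
  refine Finset.card_le_card_of_injOn (fun i => d * (((g ^ b) ^ i : Fˣ) : F)) ?_ ?_
  · intro i _
    simp only [Finset.coe_filter, Finset.mem_univ, true_and, Set.mem_setOf_eq]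
    rw [mul_pow, ← Units.val_pow_eq_pow_val, ← pow_mul, mul_comm i, pow_mul]
    conv_lhs => rw [← ho']
    simp [pow_orderOf_eq_one, ho']
    rw [← ho'] 
    rw [← Units.val_pow_eq_pow_val, ← Units.val_pow_eq_pow_val, pow_orderOf_eq_one]
    simp
  · intro i hi j hj h
    have h' := Units.ext (mul_left_cancel₀ hd h)
    rw [Finset.coe_range, Set.mem_Iio] at hi hj
    exact pow_injOn_Iio_orderOf (by rw [ho']; exact hi) (by rw [ho']; exact hj) h'

theorem stmt_10 (p e q n m k : ℕ) (hp : p.Prime) (he : 0 < e) (hq : q = p ^ e)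
    (hn : 5 ≤ n) (hodd : Odd n) (hm : (q + 1) * m = q ^ n + 1) (hk : n = 2 * k + 1)
    (F : Type*) [Field F] [Fintype F] [DecidableEq F]
    (hF : Fintype.card F = q ^ (2 * n)) (P : Polynomial F)
    (hP : P = 1
        + ∑ i ∈ Finset.range k,
            X ^ ((∑ j ∈ Finset.range (i + 1), q ^ (2 * j))
              + ∑ j ∈ Finset.range k, q ^ (2 * j + 1))
        + ∑ i ∈ Finset.range k, X ^ (∑ j ∈ Finset.range (i + 1), q ^ (2 * j + 1))) :
    ∏ ξ ∈ Finset.univ.filter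
        (fun ξ : F => ∑ i ∈ Finset.range n, (ξ ^ m) ^ q ^ (2 * i) = 0),
      (X - C ξ) = X * P.comp (X ^ ((q ^ n + 1) * (q - 1))) := by
  have hq1 : 1 < q := by rw [hq]; exact Nat.one_lt_pow he.ne' hp.one_lt
  have hsub : ∀ j, ∀ x y : F, (x - y) ^ q ^ j = x ^ q ^ j - y ^ q ^ j := by
    obtain ⟨p', hp'⟩ := CharP.exists F
    obtain ⟨t, hpr, hcard⟩ := FiniteField.card F p'
    have : p' = p := by
      have h1 : p' ∣ p ^ (e * (2 * n)) := by
        rw [pow_mul, ← hq, ← hF, hcard]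
        exact dvd_pow_self _ t.pos.ne'
      exact (Nat.prime_dvd_prime_iff_eq hpr hp).1 (hpr.dvd_of_dvd_pow h1)
    subst this
    haveI := Fact.mk hp
    intro j x y
    rw [hq, ← pow_mul, sub_pow_char_pow]
  obtain ⟨r, rfl⟩ : ∃ r, q = r + 1 := ⟨q - 1, by omega⟩
  obtain ⟨k, rfl⟩ : ∃ k', k = k' + 1 := ⟨k - 1, by omega⟩
  subst hk
  have hr : 0 < r := by omega
  rw [Nat.add_sub_cancel]
  obtain ⟨hPm, hPd⟩ := aux_P r k P hP
  have hMr := aux_M r (k+1)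
  have hTr := aux_T r (k+1)
  rw [← hPd] at hMr
  set T := (∑ j ∈ Finset.range (k+1+1), (r+1) ^ (2 * j)) +
      ∑ j ∈ Finset.range (k+1), (r+1) ^ (2 * j + 1) with hT
  set n := 2 * (k + 1) + 1 with hn'
  set N := ((r+1) ^ n + 1) * r with hN
  have hNpos : 0 < N := by positivity
  have hNm : N = (r+2) * m * r := by rw [hN, ← hm]
  have hmpos : 0 < m := by
    rcases Nat.eq_zero_or_pos m with h | h
    · subst h; simp at hm
    · exact h
  have hTpos : 0 < T := by
    rcases Nat.eq_zero_or_pos T with h | h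
    · rw [h, zero_mul, zero_add] at hTr
      have := Nat.one_lt_pow (n := n) (by omega) hq1
      omega
    · exact h
  have hNT : Fintype.card F = N * T + 1 := by
    rw [hF, two_mul, pow_add, hN, ← hTr]; ring
  have hcardn : Fintype.card F = ((r+1)^n + 1) * (T * r) + 1 := by
    rw [hNT, hN]; ring
  have hfm : (X * P.comp (X ^ N)).Monic :=
    monic_X.mul (hPm.comp (monic_X_pow N) (by rw [natDegree_X_pow]; exact hNpos.ne'))
  have hfd : (X * P.comp (X ^ N)).natDegree = 1 + P.natDegree * N := by
    rw [monic_X.natDegree_mul (hPm.comp (monic_X_pow N) (by rw [natDegree_X_pow]; exact hNpos.ne')),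
      natDegree_X, natDegree_comp, natDegree_X_pow]
  set Ξ := Finset.univ.filter
        (fun ξ : F => ∑ i ∈ Finset.range n, (ξ ^ m) ^ (r+1) ^ (2 * i) = 0) with hΞ
  have hpow1 : ∀ x : F, x ≠ 0 → x ^ (N * T) = 1 := by
    intro x hx
    have := FiniteField.pow_card_sub_one_eq_one x hx
    rwa [hNT, Nat.add_sub_cancel] at this
  have hroot : ∀ ξ ∈ Ξ, (X * P.comp (X ^ N)).IsRoot ξ := by
    intro ξ hξ
    rw [IsRoot.def, eval_mul, eval_X, eval_comp, eval_pow, eval_X]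
    rcases eq_or_ne ξ 0 with h0 | h0
    · rw [h0, zero_mul]
    have hwT : (ξ ^ N) ^ T = 1 := by rw [← pow_mul]; exact hpow1 ξ h0
    have hkey := aux_key r k (ξ ^ N) (by
      rw [← hn', ← hTr, pow_succ, pow_mul, hwT, one_pow, one_mul]) hwT
    simp only [hΞ, Finset.mem_filter, Finset.mem_univ, true_and] at hξ
    rw [aux_sum r m N n ξ hNm] at hξ
    rw [(mul_eq_zero.1 hξ).resolve_left (pow_ne_zero _ h0), mul_zero] at hkey
    rw [hP]
    simp only [eval_add, eval_one, eval_finset_sum, eval_pow, eval_X]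
    rw [← hkey, mul_zero]
  have hdvd : ∏ ξ ∈ Ξ, (X - C ξ) ∣ X * P.comp (X ^ N) := by
    refine Finset.prod_dvd_of_coprime ?_ fun ξ hξ => dvd_iff_isRoot.2 (hroot ξ hξ)
    intro a _ b _ hab
    exact pairwise_coprime_X_sub_C Function.injective_id hab
  have h0Ξ : (0 : F) ∈ Ξ := by
    simp only [hΞ, Finset.mem_filter, Finset.mem_univ, true_and]
    refine Finset.sum_eq_zero fun i _ => ?_
    rw [zero_pow hmpos.ne', zero_pow (by positivity)]
  have hA := aux_A (F := F) (r+1) (k+1) hq1 hsub hF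
  set A := Finset.univ.filter fun c : F => c ^ (r+1) ^ (2 * (k+1) + 1) = c ∧
      ∑ i ∈ Finset.range (2 * (k+1) + 1), c ^ (r+1) ^ (2 * i) = 0 with hAdef
  have hcount := Finset.card_mul_le_card_mul (s := A.erase 0) (t := Ξ.erase 0)
    (fun c ξ : F => ξ ^ N = c ^ ((r+2) * r)) (m := N) (n := r) (by
      intro c hc
      simp only [hAdef, Finset.mem_erase, Finset.mem_filter, Finset.mem_univ, true_and] at hc
      obtain ⟨hc0, hcn, hcs⟩ := hc
      obtain ⟨d, hd⟩ := aux_solve ((r+1)^n+1) (T*r) (by positivity) hcardn c hc0 (by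
        rw [← hn', ← hTr, pow_succ] at hcn
        exact mul_right_cancel₀ hc0 (hcn.trans (one_mul c).symm))
      have hd0 : d ≠ 0 := by
        rintro rfl
        rw [zero_pow (by positivity)] at hd
        exact hc0 hd.symm
      refine (aux_count N T hNpos hTpos hNT (d ^ (r+2)) (pow_ne_zero _ hd0)).trans
        (Finset.card_le_card ?_)
      intro x hx
      simp only [Finset.mem_filter, Finset.mem_univ, true_and] at hx
      have hx' : x ^ N = c ^ ((r+2) * r) := by
        rw [hx, ← hd, ← pow_mul, ← pow_mul, hN]
        congr 1; ring
      have hx0 : x ≠ 0 := by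
        rintro rfl
        rw [zero_pow hNpos.ne'] at hx'
        exact pow_ne_zero _ hc0 hx'.symm
      simp only [Finset.mem_bipartiteAbove, Finset.mem_erase]
      refine ⟨⟨hx0, ?_⟩, hx'⟩
      simp only [hΞ, Finset.mem_filter, Finset.mem_univ, true_and]
      rw [aux_sum r m N n x hNm, hx']
      have hc2 := aux_sum r 1 ((r+2)*1*r) n c rfl
      simp only [pow_one, mul_one] at hc2
      rw [← hn', hc2] at hcs
      rw [(mul_eq_zero.1 hcs).resolve_left hc0, mul_zero]) (by
      intro ξ hξ
      rcases Finset.eq_empty_or_nonempty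
        ((A.erase 0).bipartiteBelow (fun c ξ : F => ξ ^ N = c ^ ((r+2) * r)) ξ) with h | ⟨c, hc⟩
      · rw [h]; simp
      refine le_trans (Finset.card_le_card ?_) (aux_pow r hr (c ^ r))
      intro x hx
      simp only [hAdef, Finset.mem_bipartiteBelow, Finset.mem_erase, Finset.mem_filter,
        Finset.mem_univ, true_and] at hc hx ⊢
      obtain ⟨⟨hc0, hcn, -⟩, hcx⟩ := hc
      obtain ⟨⟨hx0, hxn, -⟩, hxx⟩ := hx
      have hu : (x / c) ^ (r+1) = x / c := by
        refine aux_two (r+1) (k+1) _ ?_ (by rw [div_pow, hxn, hcn])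
        rw [show (r+1)^2 = (r+2)*r+1 by ring, pow_succ, div_pow, ← hxx, ← hcx, div_self, one_mul]
        rw [hcx]; exact pow_ne_zero _ hc0
      have hne : x / c ≠ 0 := div_ne_zero hx0 hc0
      rw [pow_succ] at hu
      have hu1 := mul_right_cancel₀ hne (hu.trans (one_mul _).symm)
      rw [div_pow, div_eq_one_iff_eq (pow_ne_zero _ hc0)] at hu1
      exact hu1)
  have hcard : 1 + P.natDegree * N ≤ Ξ.card := by
    have h1 : (Ξ.erase 0).card + 1 = Ξ.card := Finset.card_erase_add_one h0Ξ
    have h2 : P.natDegree * r ≤ (A.erase 0).card := by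
      have := Finset.pred_card_le_card_erase (s := A) (a := 0)
      omega
    have h3 : P.natDegree * N * r ≤ (Ξ.erase 0).card * r := by
      refine le_trans ?_ hcount
      calc P.natDegree * N * r = P.natDegree * r * N := by ring
        _ ≤ _ := Nat.mul_le_mul_right _ h2
    have h4 := Nat.le_of_mul_le_mul_right h3 hr
    omega
  refine Eq.symm <| eq_of_monic_of_dvd_of_natDegree_le (monic_prod_of_monic _ _ fun ξ _ => monic_X_sub_C ξ)
    hfm hdvd ?_
  rw [hfd, natDegree_prod_of_monic _ _ fun ξ _ => monic_X_sub_C ξ]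
  simpa using hcard
end

section
/- The set 𝒜 has exactly 4(2^n + 1)(2^{n-1} - 1)/3 elements. -/
section aux
variable {F : Type*} [Field F]

lemma aux_cube (q k : ℕ) (hq : q = 3 * k + 2) (x : F) (hx : x ^ q = x) :
    (x ^ (2 * k + 1)) ^ 3 = x := by
  by_cases h0 : x = 0
  · simp [h0]
  · have : (x ^ (2 * k + 1)) ^ 3 * x = x * x := by
      calc _ = x ^ q * x ^ q := by rw [hq]; ring
        _ = _ := by rw [hx]
    exact mul_right_cancel₀ h0 this

lemma aux_cube_inj (q k : ℕ) (hq : q = 3 * k + 2) (x y : F) (hx : x ^ q = x) (hy : y ^ q = y)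
    (h : x ^ 3 = y ^ 3) : x = y := by
  rw [← aux_cube q k hq x hx, ← aux_cube q k hq y hy]
  rw [← pow_mul, ← pow_mul, mul_comm, pow_mul, pow_mul, h]

lemma aux_cube_root_one (w : F) (hw : w ^ 2 + w + 1 = 0) (x y : F) (h : x ^ 3 = y ^ 3) :
    x = y ∨ x = y * w ∨ x = y * w ^ 2 := by
  have : (x - y) * ((x - y * w) * (x - y * w ^ 2)) = 0 := by
    linear_combination h + (-y*x^2+w*y^2*x - y^3 *(w-1)) * hw
  rcases mul_eq_zero.1 this with h | h
  · left; linear_combination h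
  · rcases mul_eq_zero.1 h with h | h
    · right; left; linear_combination h
    · right; right; linear_combination h

lemma aux_roots_s13 [CharP F 2] [Fintype F] [DecidableEq F] (q k : ℕ) (hq : q = 3 * k + 2)
    (w : F) (hw : w ^ 2 + w + 1 = 0) (c y : F) (hc0 : c ≠ 0) (hc : c ^ q = c)
    (hy : y ^ 6 + y ^ 3 + c = 0) :
    (Finset.univ.filter (fun y : F => y ^ 6 + y ^ 3 + c = 0)).card = 6 := by
  have h2 : (2 : F) = 0 := CharP.cast_eq_zero F 2
  have hy0 : y ≠ 0 := by
    rintro rfl; apply hc0; simpa using hy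
  have hw3 : w ^ 3 = 1 := by linear_combination (w - 1) * hw
  have hw0 : w ≠ 0 := by rintro rfl; simp at hw
  have hw1 : w ≠ 1 := by
    rintro rfl
    have : (1 : F) = 0 := by linear_combination hw - h2
    exact one_ne_zero this
  have hw2 : w ^ 2 ≠ 1 := by
    intro h
    apply hw0; linear_combination hw - h - h2
  have hww : w ^ 2 ≠ w := by
    intro h
    apply hw1; apply mul_left_cancel₀ hw0; linear_combination h
  obtain ⟨z, hz⟩ : ∃ z : F, z ^ 3 = y ^ 3 + 1 := by
    refine ⟨c ^ (2 * k + 1) / y, ?_⟩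
    rw [div_pow, aux_cube q k hq c hc, div_eq_iff (pow_ne_zero 3 hy0)]
    linear_combination hy - (y^6+y^3) * h2
  have hz0 : z ≠ 0 := by
    rintro rfl
    apply hc0
    linear_combination hy + y^3 * hz
  have hne : ∀ a b : F, a ^ 3 = 1 → b ^ 3 = 1 → y * a ≠ z * b := by
    intro a b ha hb h
    have : y ^ 3 = z ^ 3 := by
      calc y ^ 3 = (y * a) ^ 3 := by rw [mul_pow, ha, mul_one]
        _ = (z * b) ^ 3 := by rw [h]
        _ = z ^ 3 := by rw [mul_pow, hb, mul_one]
    exact one_ne_zero (α := F) (by linear_combination -hz - this)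
  have hw23 : (w ^ 2) ^ 3 = 1 := by rw [← pow_mul, mul_comm, pow_mul, hw3, one_pow]
  have key : (Finset.univ.filter (fun y : F => y ^ 6 + y ^ 3 + c = 0)) =
      (({1, w, w ^ 2} : Finset F).image (fun a => y * a)) ∪
      (({1, w, w ^ 2} : Finset F).image (fun a => z * a)) := by
    ext x
    simp only [Finset.mem_filter, Finset.mem_univ, true_and, Finset.mem_union, Finset.mem_image,
      Finset.mem_insert, Finset.mem_singleton, exists_eq_or_imp, exists_eq_left, mul_one]
    constructor
    · intro h
      have : (x ^ 3 - y ^ 3) * (x ^ 3 - z ^ 3) = 0 := by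
        linear_combination h - hy + (y^3-x^3) * hz + (y^6 - x^3*y^3 - x^3 + y^3) * h2
      rcases mul_eq_zero.1 this with h | h
      · left
        rcases aux_cube_root_one w hw x y (by linear_combination h) with h | h | h <;> simp [h]
      · right
        rcases aux_cube_root_one w hw x z (by linear_combination h) with h | h | h <;> simp [h]
    · have hz6 : z ^ 6 + z ^ 3 + c = 0 := by
        linear_combination hy + (z^3 + y^3+1+1) * hz + (y^3+1) * h2
      have e : ∀ a b : F, a ^ 6 + a ^ 3 + c = 0 → b ^ 3 = 1 →
          (a * b) ^ 6 + (a * b) ^ 3 + c = 0 := by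
        intro a b ha hb
        linear_combination ha + (a^6*(b^3+1) + a^3) * hb
      rintro ((rfl | rfl | rfl) | (rfl | rfl | rfl))
      · exact hy
      · exact e _ _ hy hw3
      · exact e _ _ hy hw23
      · exact hz6
      · exact e _ _ hz6 hw3
      · exact e _ _ hz6 hw23
  have c3 : ({1, w, w ^ 2} : Finset F).card = 3 := by
    rw [Finset.card_eq_three]
    exact ⟨_, _, _, hw1.symm, hw2.symm, hww.symm, rfl⟩
  rw [key, Finset.card_union_of_disjoint, Finset.card_image_of_injective,
    Finset.card_image_of_injective, c3]
  · exact mul_right_injective₀ hz0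
  · exact mul_right_injective₀ hy0
  · have hc : ∀ a ∈ ({1, w, w ^ 2} : Finset F), a ^ 3 = 1 := by
      simp [hw3, hw23]
    rw [Finset.disjoint_left]
    intro x hx hx'
    obtain ⟨a, ha, rfl⟩ := Finset.mem_image.1 hx
    obtain ⟨b, hb, h⟩ := Finset.mem_image.1 hx'
    exact hne a b (hc a ha) (hc b hb) h.symm

/-- the count of the set of `y` for which `y^6+y^3` is a nonzero element of the subfield -/
lemma aux_Y [CharP F 2] [Fintype F] [DecidableEq F] (q k : ℕ) (hq : q = 3 * k + 2)
    (σ : F →+* F) (hσ : ∀ x, σ x = x ^ q) (hσσ : ∀ x, σ (σ x) = x)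
    (hK : (Finset.univ.filter (fun x : F => x ^ q = x)).card = q)
    (w : F) (hw : w ^ 2 + w + 1 = 0) :
    (Finset.univ.filter
      (fun y : F => y ^ 6 + y ^ 3 ≠ 0 ∧ (y ^ 6 + y ^ 3) ^ q = y ^ 6 + y ^ 3)).card
      = 4 * (q - 2) := by
  have h2 : (2 : F) = 0 := CharP.cast_eq_zero F 2
  have hw3 : w ^ 3 = 1 := by linear_combination (w - 1) * hw
  have hw0 : w ≠ 0 := by rintro rfl; simp at hw
  have hw1 : w ≠ 1 := by
    rintro rfl
    have : (1 : F) = 0 := by linear_combination hw - h2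
    exact one_ne_zero this
  have hw2 : w ^ 2 ≠ 1 := by
    intro h
    apply hw0; linear_combination hw - h - h2
  have hww : w ^ 2 ≠ w := by
    intro h
    apply hw1; apply mul_left_cancel₀ hw0; linear_combination h
  have hw23 : (w ^ 2) ^ 3 = 1 := by rw [← pow_mul, mul_comm, pow_mul, hw3, one_pow]
  have c3 : ({1, w, w ^ 2} : Finset F).card = 3 := by
    rw [Finset.card_eq_three]
    exact ⟨_, _, _, hw1.symm, hw2.symm, hww.symm, rfl⟩
  have hw3' : ∀ a ∈ ({1, w, w ^ 2} : Finset F), a ^ 3 = 1 := by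
      simp [hw3, hw23]
  have hσw : σ w = w ^ 2 := by
    rw [hσ, hq, pow_add, pow_mul, hw3, one_pow, one_mul]
  set K1 : Finset F := Finset.univ.filter (fun x : F => x ^ q = x ∧ x ≠ 0 ∧ x ≠ 1) with hK1
  have hK1c : K1.card = q - 2 := by
    have : K1 = (Finset.univ.filter (fun x : F => x ^ q = x)) \ {0, 1} := by
      ext x; simp [hK1]
    rw [this, Finset.card_sdiff_of_subset, hK, Finset.card_pair zero_ne_one]
    intro x hx
    have : q ≠ 0 := by omega
    simp only [Finset.mem_insert, Finset.mem_singleton] at hx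
    rcases hx with rfl | rfl <;> simp [this]
  set Y1 : Finset F := Finset.univ.filter (fun y : F => σ (y ^ 3) = y ^ 3 ∧ y ^ 3 ≠ 0 ∧ y ^ 3 ≠ 1)
    with hY1
  set Y2 : Finset F := Finset.univ.filter (fun y : F => σ (y ^ 3) = y ^ 3 + 1) with hY2
  have hY1c : Y1.card = 3 * (q - 2) := by
    rw [← c3, ← hK1c, ← Finset.card_product]
    symm
    refine Finset.card_bij (fun p _ => p.1 * p.2) ?_ ?_ ?_
    · rintro ⟨a, r⟩ h
      obtain ⟨ha, hr⟩ := Finset.mem_product.1 h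
      have ha := hw3' a ha
      simp only [hK1, Finset.mem_filter, Finset.mem_univ, true_and] at hr
      simp only [hY1, Finset.mem_filter, Finset.mem_univ, true_and]
      rw [mul_pow, ha, one_mul, map_pow, hσ, hr.1]
      refine ⟨rfl, pow_ne_zero _ hr.2.1, ?_⟩
      intro h
      exact hr.2.2 (aux_cube_inj q k hq r 1 hr.1 (one_pow _) (by rw [h, one_pow]))
    · rintro ⟨a, r⟩ h ⟨b, s⟩ h' heq
      obtain ⟨ha, hr⟩ := Finset.mem_product.1 h
      obtain ⟨hb, hs⟩ := Finset.mem_product.1 h'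
      have ha := hw3' a ha
      have hb := hw3' b hb
      simp only [hK1, Finset.mem_filter, Finset.mem_univ, true_and] at hr hs
      simp only at heq
      have : r = s := by
        apply aux_cube_inj q k hq r s hr.1 hs.1
        have := congrArg (· ^ 3) heq
        simpa [mul_pow, ha, hb] using this
      subst this
      rw [mul_right_cancel₀ hr.2.1 heq]
    · intro y hy
      simp only [hY1, Finset.mem_filter, Finset.mem_univ, true_and] at hy
      obtain ⟨h1, h20, h3⟩ := hy
      set r := (y ^ 3) ^ (2 * k + 1) with hr
      have hrK : r ^ q = r := by rw [← hσ, hr, map_pow, h1]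
      have hr3 : r ^ 3 = y ^ 3 := aux_cube q k hq (y ^ 3) (by rw [← hσ, h1])
      have hr0 : r ≠ 0 := by
        intro h; apply h20; rw [← hr3, h]; simp
      have hr1 : r ≠ 1 := by
        intro h; apply h3; rw [← hr3, h]; simp
      have hrm : r ∈ K1 := by simp [hK1, hrK, hr0, hr1]
      rcases aux_cube_root_one w hw y r hr3.symm with h | h | h
      · exact ⟨(1, r), by simp [hrm], by simp [h]⟩
      · exact ⟨(w, r), by simp [hrm], by simp [h, mul_comm]⟩
      · exact ⟨(w ^ 2, r), by simp [hrm], by simp [h, mul_comm]⟩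
  have hY2c : Y2.card = q - 2 := by
    rw [← hK1c]
    have hfact : ∀ y : F, y ^ 3 + σ y ^ 3 =
        (y + σ y) * (w * y + w ^ 2 * σ y) * ((y + σ y) + (w * y + w ^ 2 * σ y)) := by
      intro y
      have e : w * y + w ^ 2 * σ y = w * (y + σ y) + σ y := by
        linear_combination σ y * hw - (w * σ y + σ y) * h2
      rw [e]
      linear_combination -(y + σ y) ^ 3 * hw +
        (y ^ 3 + y ^ 2 * σ y - w * (y + σ y) ^ 2 * σ y) * h2
    have hu : ∀ y : F, σ (y + σ y) = y + σ y := by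
      intro y; rw [map_add, hσσ, add_comm]
    have hv : ∀ y : F, σ (w * y + w ^ 2 * σ y) = w * y + w ^ 2 * σ y := by
      intro y; rw [map_add, map_mul, map_mul, hσσ, map_pow, hσw]
      linear_combination w * y * hw3
    have hyuv : ∀ y : F, y = w ^ 2 * (y + σ y) + (w * y + w ^ 2 * σ y) := by
      intro y
      linear_combination -y * hw + (y - w^2 * σ y) * h2
    have hY2' : ∀ y ∈ Y2, (y + σ y) * (w * y + w ^ 2 * σ y) *
        ((y + σ y) + (w * y + w ^ 2 * σ y)) = 1 := by
      intro y hy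
      simp only [hY2, Finset.mem_filter, Finset.mem_univ, true_and, map_pow] at hy
      rw [← hfact, hy]; linear_combination y ^ 3 * h2
    refine Finset.card_bij (fun y _ => (w * y + w ^ 2 * σ y) / (y + σ y)) ?_ ?_ ?_
    · intro y hy
      have h := hY2' y hy
      have h1 := hu y
      have h3 := hv y
      generalize y + σ y = u at *
      generalize w * y + w ^ 2 * σ y = v at *
      have hu0 : u ≠ 0 := by rintro rfl; simp at h
      have hv0 : v ≠ 0 := by rintro rfl; simp at h
      simp only [hK1, Finset.mem_filter, Finset.mem_univ, true_and]
      refine ⟨by rw [← hσ, map_div₀, h1, h3], div_ne_zero hv0 hu0, ?_⟩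
      rw [Ne, div_eq_one_iff_eq hu0]
      rintro rfl
      apply one_ne_zero (α := F)
      linear_combination -h + v^3 * h2
    · intro y hy y' hy' heq
      have h := hY2' y hy
      have h1 := hu y
      have e1 := hyuv y
      have h' := hY2' y' hy'
      have h1' := hu y'
      have e1' := hyuv y'
      generalize y + σ y = u at *
      generalize w * y + w ^ 2 * σ y = v at *
      generalize y' + σ y' = u' at *
      generalize w * y' + w ^ 2 * σ y' = v' at *
      have hu0 : u ≠ 0 := by rintro rfl; simp at h
      have hu0' : u' ≠ 0 := by rintro rfl; simp at h'
      obtain ⟨s, rfl⟩ : ∃ s, v = u * s := ⟨v / u, by field_simp⟩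
      obtain ⟨s', rfl⟩ : ∃ s, v' = u' * s := ⟨v' / u', by field_simp⟩
      rw [mul_div_cancel_left₀ _ hu0, mul_div_cancel_left₀ _ hu0'] at heq
      subst heq
      have hs : s * (1 + s) ≠ 0 := by
        intro h0
        apply one_ne_zero (α := F)
        linear_combination -h + u ^ 3 * h0
      have : u = u' := by
        apply aux_cube_inj q k hq u u' (by rw [← hσ, h1]) (by rw [← hσ, h1'])
        apply mul_right_cancel₀ hs
        linear_combination h - h'
      rw [e1, e1', this]
    · intro s hs
      simp only [hK1, Finset.mem_filter, Finset.mem_univ, true_and] at hs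
      obtain ⟨hsq, hs0, hs1⟩ := hs
      have hs2 : s + s ^ 2 ≠ 0 := by
        intro h
        have : s * (s - 1) = 0 := by linear_combination h - s * h2
        rcases mul_eq_zero.1 this with h | h
        · exact hs0 h
        · exact hs1 (by linear_combination h)
      have hσs : σ s = s := by rw [hσ, hsq]
      set c := (s + s ^ 2)⁻¹ with hc
      have hcσ : σ c = c := by rw [hc, map_inv₀, map_add, map_pow, hσs]
      set u := c ^ (2 * k + 1) with hud
      have huσ : σ u = u := by rw [hud, map_pow, hcσ]
      have hu3 : u ^ 3 = c := aux_cube q k hq c (by rw [← hσ, hcσ])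
      have hu3' : u ^ 3 * (s + s ^ 2) = 1 := by rw [hu3, hc, inv_mul_cancel₀ hs2]
      have hu0 : u ≠ 0 := by intro h; rw [h] at hu3'; simp at hu3'
      have hσy : σ (u * (w ^ 2 + s)) = u * (w + s) := by
        rw [map_mul, map_add, huσ, hσs, map_pow, hσw]
        linear_combination u * w * hw3
      have eu : u * (w ^ 2 + s) + u * (w + s) = u := by
        linear_combination u * hw + (u * s - u) * h2
      have ev : w * (u * (w ^ 2 + s)) + w ^ 2 * (u * (w + s)) = u * s := by
        linear_combination 2 * u * hw3 + u * s * hw + (u - u * s) * h2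
      refine ⟨u * (w ^ 2 + s), ?_, ?_⟩
      · simp only [hY2, Finset.mem_filter, Finset.mem_univ, true_and]
        have := hfact (u * (w ^ 2 + s))
        rw [map_pow]
        rw [hσy, eu, ev] at *
        linear_combination this + hu3' - (u * (w ^ 2 + s)) ^ 3 * h2
      · rw [hσy, eu, ev, mul_div_cancel_left₀ _ hu0]
  have hdis : Disjoint Y1 Y2 := by
    rw [Finset.disjoint_left]
    intro y hy hy'
    simp only [hY1, hY2, Finset.mem_filter, Finset.mem_univ, true_and] at hy hy'
    rw [hy.1] at hy'
    simp at hy'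
  have : (Finset.univ.filter
      (fun y : F => y ^ 6 + y ^ 3 ≠ 0 ∧ (y ^ 6 + y ^ 3) ^ q = y ^ 6 + y ^ 3)) = Y1 ∪ Y2 := by
    ext y
    simp only [hY1, hY2, Finset.mem_filter, Finset.mem_univ, true_and, Finset.mem_union]
    have e6 : y ^ 6 = (y ^ 3) ^ 2 := by ring
    rw [← hσ, e6, map_add, map_pow σ (y ^ 3) 2]
    generalize y ^ 3 = t
    have a1 : t ^ 2 + t ≠ 0 ↔ t ≠ 0 ∧ t ≠ 1 := by
      have : t ^ 2 + t = t * (t - 1) := by linear_combination t * h2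
      rw [this, mul_ne_zero_iff, sub_ne_zero]
    have a2 : σ t ^ 2 + σ t = t ^ 2 + t ↔ σ t = t ∨ σ t = t + 1 := by
      rw [← sub_eq_zero (b := t), ← sub_eq_zero (b := t + 1), ← mul_eq_zero,
        ← sub_eq_zero (b := t ^ 2 + t)]
      have : (σ t - t) * (σ t - (t + 1)) = σ t ^ 2 + σ t - (t ^ 2 + t) := by
        linear_combination (t ^ 2 + t - σ t * t - σ t) * h2
      rw [this]
    rw [a1, a2]
    constructor
    · rintro ⟨h, h' | h'⟩
      · exact Or.inl ⟨h', h⟩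
      · exact Or.inr h'
    · rintro (⟨h', h⟩ | h)
      · exact ⟨h, Or.inl h'⟩
      · refine ⟨⟨?_, ?_⟩, Or.inr h⟩
        · rintro rfl; simp at h
        · rintro rfl
          rw [map_one] at h; simp at h
  rw [this, Finset.card_union_of_disjoint hdis, hY1c, hY2c]
  omega

lemma aux_ker [Fintype F] [DecidableEq F] (d e : ℕ) (hd : Fintype.card F = d * e + 1) (h0 : d ≠ 0) :
    (Finset.univ.filter (fun x : F => x ^ d = 1)).card = d := by
  have h1 := IsCyclic.card_powMonoidHom_ker (G := Fˣ) d
  have h3 : Nat.card Fˣ = d * e := by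
    rw [Nat.card_units, Nat.card_eq_fintype_card, hd]; simp
  rw [h3, Nat.gcd_eq_right (Dvd.intro _ rfl)] at h1
  have h4 : Nat.card (powMonoidHom d : Fˣ →* Fˣ).ker
      = Nat.card {x : F // x ^ d = 1} := by
    refine Nat.card_congr ⟨fun u => ⟨(u : Fˣ), ?_⟩, fun x => ⟨Units.mk0 x.1 ?_, ?_⟩, ?_, ?_⟩
    · have := u.2
      rw [MonoidHom.mem_ker, powMonoidHom_apply] at this
      rw [← Units.val_pow_eq_pow_val, this, Units.val_one]
    · intro h
      have := x.2
      rw [h, zero_pow h0] at this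
      exact zero_ne_one this
    · rw [MonoidHom.mem_ker, powMonoidHom_apply]
      ext
      simpa using x.2
    · intro u; ext; simp
    · intro x; ext; simp
  rw [h4, Nat.card_eq_fintype_card, Fintype.card_subtype] at h1
  exact h1

lemma aux_surj [Fintype F] (q : ℕ) (hq : 2 ≤ q) (hF : Fintype.card F = q ^ 2)
    (c : F) (hc0 : c ≠ 0) (hc : c ^ q = c) : ∃ b : F, b ^ (q + 1) = c := by
  obtain ⟨r, rfl⟩ : ∃ r, q = r + 1 := ⟨q - 1, by omega⟩
  obtain ⟨g, hg⟩ := IsCyclic.exists_generator (α := Fˣ)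
  have hord := orderOf_eq_card_of_forall_mem_zpowers hg
  rw [Nat.card_units, Nat.card_eq_fintype_card, hF] at hord
  have hord' : orderOf g = r * (r + 2) := by
    rw [hord]
    have : (r + 1) ^ 2 = r * (r + 2) + 1 := by ring
    omega
  obtain ⟨k, hk⟩ := (mem_powers_iff_mem_zpowers.2 (hg (Units.mk0 c hc0)))
  simp only at hk
  have h1 : (g ^ k) ^ r = 1 := by
    rw [hk]; ext
    simp only [Units.val_pow_eq_pow_val, Units.val_mk0, Units.val_one]
    apply mul_right_cancel₀ hc0
    rw [one_mul, ← pow_succ, hc]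
  rw [← pow_mul, ← orderOf_dvd_iff_pow_eq_one, hord', mul_comm k] at h1
  have h3 := Nat.dvd_of_mul_dvd_mul_left (by omega) h1
  obtain ⟨m, rfl⟩ := h3
  refine ⟨((g ^ m : Fˣ) : F), ?_⟩
  have := congrArg (Units.val) hk
  rw [Units.val_mk0] at this
  rw [← this, ← Units.val_pow_eq_pow_val, ← pow_mul, mul_comm]

/-- in a field with `q^2` elements, each norm fibre has `q+1` elements -/
lemma aux_norm [Fintype F] [DecidableEq F] (q : ℕ) (hq : 2 ≤ q) (hF : Fintype.card F = q ^ 2)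
    (c : F) (hc0 : c ≠ 0) (hc : c ^ q = c) :
    (Finset.univ.filter (fun a : F => a ^ (q + 1) = c)).card = q + 1 := by
  obtain ⟨b, hb⟩ := aux_surj q hq hF c hc0 hc
  have hb0 : b ≠ 0 := by
    rintro rfl
    simp at hb; exact hc0 hb.symm
  have hk := aux_ker (F := F) (q + 1) (q - 1) (by
    rw [hF]
    obtain ⟨r, rfl⟩ : ∃ r, q = r + 1 := ⟨q - 1, by omega⟩
    simp only [Nat.add_sub_cancel]; ring) (by omega)
  refine Eq.trans ?_ hk
  symm
  refine Finset.card_bij (fun a _ => b * a) ?_ ?_ ?_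
  · intro a ha
    simp only [Finset.mem_filter, Finset.mem_univ, true_and] at ha ⊢
    rw [mul_pow, ha, hb, mul_one]
  · intro a _ a' _ h
    exact mul_left_cancel₀ hb0 h
  · intro a ha
    simp only [Finset.mem_filter, Finset.mem_univ, true_and] at ha
    refine ⟨a / b, ?_, ?_⟩
    · simp only [Finset.mem_filter, Finset.mem_univ, true_and]
      rw [div_pow, ha, hb, div_self hc0]
    · field_simp

lemma aux_K [Fintype F] [DecidableEq F] (q : ℕ) (hq : 2 ≤ q) (hF : Fintype.card F = q ^ 2) :
    (Finset.univ.filter (fun x : F => x ^ q = x)).card = q := by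
  obtain ⟨r, rfl⟩ : ∃ r, q = r + 1 := ⟨q - 1, by omega⟩
  have hk := aux_ker (F := F) r (r + 2) (by rw [hF]; ring) (by omega)
  have : (Finset.univ.filter (fun x : F => x ^ (r + 1) = x)) =
      insert 0 (Finset.univ.filter (fun x : F => x ^ r = 1)) := by
    ext x
    simp only [Finset.mem_filter, Finset.mem_univ, true_and, Finset.mem_insert]
    by_cases h : x = 0
    · simp [h]
    · rw [pow_succ, mul_eq_right₀ h]; simp [h]
  rw [this, Finset.card_insert_of_notMem, hk]
  have : r ≠ 0 := by omega
  simp [this]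

end aux

theorem stmt_13 (n : ℕ) (hn : 3 ≤ n) (hodd : Odd n)
    (F : Type*) [Field F] [Fintype F] (hF : Fintype.card F = 2 ^ (2 * n)) :
    3 * Nat.card {a : F // a ≠ 0 ∧
        Nat.card {y : F // y ^ 6 + y ^ 3 + a ^ (2 ^ n + 1) = 0} = 6}
      = 4 * (2 ^ n + 1) * (2 ^ (n - 1) - 1) := by
  classical
  obtain ⟨q, hqdef⟩ : ∃ q, q = 2 ^ n := ⟨_, rfl⟩
  have hcard : Fintype.card F = q ^ 2 := by rw [hF, hqdef, ← pow_mul, mul_comm]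
  have hchar : CharP F 2 := by
    apply (CharP.charP_iff_prime_eq_zero Nat.prime_two).2
    have h : ((Fintype.card F : ℕ) : F) = 0 := Nat.cast_card_eq_zero F
    rw [hF, Nat.cast_pow] at h
    exact pow_eq_zero_iff (by omega) |>.1 h
  have h2 : (2 : F) = 0 := CharP.cast_eq_zero F 2
  obtain ⟨k, hk⟩ : ∃ k, q = 3 * k + 2 := by
    obtain ⟨m, rfl⟩ := hodd
    have : 2 ^ (2 * m + 1) % 3 = 2 := by
      rw [pow_succ, pow_mul, Nat.mul_mod, Nat.pow_mod]; simp
    rw [← hqdef] at this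
    exact ⟨q / 3, by omega⟩
  have hq2 : 2 ≤ q := by omega
  have hσ : ∀ x : F, iterateFrobenius F 2 n x = x ^ q := by
    intro x; rw [iterateFrobenius_def, hqdef]
  have hpc : ∀ x : F, (x ^ q) ^ q = x := by
    intro x; rw [← pow_mul, ← sq, ← hcard, FiniteField.pow_card]
  have hσσ : ∀ x : F, iterateFrobenius F 2 n (iterateFrobenius F 2 n x) = x := by
    intro x; rw [hσ, hσ, hpc]
  obtain ⟨w, hw⟩ : ∃ w : F, w ^ 2 + w + 1 = 0 := by
    have h3 := aux_ker (F := F) 3 ((k + 1) * (3 * k + 1)) (by rw [hcard, hk]; ring) (by omega)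
    obtain ⟨w, hw, hw1⟩ := Finset.exists_mem_ne
      (s := Finset.univ.filter (fun x : F => x ^ 3 = 1)) (by omega) (1 : F)
    simp only [Finset.mem_filter, Finset.mem_univ, true_and] at hw
    refine ⟨w, mul_left_cancel₀ (sub_ne_zero.2 hw1) ?_⟩
    linear_combination hw
  have hK := aux_K (F := F) q hq2 hcard
  have hY := aux_Y q k hk _ hσ hσσ hK w hw
  rw [← hqdef]
  have hqn : q = 2 * 2 ^ (n - 1) := by rw [hqdef, ← pow_succ']; congr 1; omega
  have hcq : ∀ a : F, (a ^ (q + 1)) ^ q = a ^ (q + 1) := by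
    intro a
    rw [pow_succ, mul_pow, hpc, mul_comm]
  have hA : Nat.card {a : F // a ≠ 0 ∧ Nat.card {y : F // y ^ 6 + y ^ 3 + a ^ (q + 1) = 0} = 6}
      = (Finset.univ.filter (fun a : F => a ≠ 0 ∧
        (Finset.univ.filter (fun y : F => y ^ 6 + y ^ 3 + a ^ (q + 1) = 0)).card = 6)).card := by
    rw [Nat.card_eq_fintype_card, Fintype.card_subtype]
    congr 1
    ext a
    simp only [Finset.mem_filter, Finset.mem_univ, true_and, Nat.card_eq_fintype_card,
      Fintype.card_subtype]
  rw [hA]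
  have hdc := Finset.sum_card_bipartiteAbove_eq_sum_card_bipartiteBelow
    (s := Finset.univ.filter (fun a : F => a ≠ 0)) (t := (Finset.univ : Finset F))
    (fun a y => y ^ 6 + y ^ 3 + a ^ (q + 1) = 0)
  have hL : ∑ a ∈ Finset.univ.filter (fun a : F => a ≠ 0),
      (Finset.bipartiteAbove (fun a y : F => y ^ 6 + y ^ 3 + a ^ (q + 1) = 0)
        Finset.univ a).card =
      6 * (Finset.univ.filter (fun a : F => a ≠ 0 ∧
        (Finset.univ.filter (fun y : F => y ^ 6 + y ^ 3 + a ^ (q + 1) = 0)).card = 6)).card := by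
    rw [← Finset.filter_filter, Finset.card_filter, Finset.mul_sum]
    apply Finset.sum_congr rfl
    intro a ha
    simp only [Finset.mem_filter, Finset.mem_univ, true_and] at ha
    rw [Finset.bipartiteAbove]
    split_ifs with h
    · rw [h, mul_one]
    · rw [mul_zero, Finset.card_eq_zero, Finset.filter_eq_empty_iff]
      intro y _ hy
      exact h (aux_roots_s13 q k hk w hw _ y (pow_ne_zero _ ha) (hcq a) hy)
  have hR : ∑ y : F, (Finset.bipartiteBelow (fun a y : F => y ^ 6 + y ^ 3 + a ^ (q + 1) = 0)
        (Finset.univ.filter (fun a : F => a ≠ 0)) y).card = (q + 1) * (4 * (q - 2)) := by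
    rw [← hY, Finset.card_filter, Finset.mul_sum]
    apply Finset.sum_congr rfl
    intro y _
    rw [Finset.bipartiteBelow, Finset.filter_filter]
    have hiff : ∀ a : F, y ^ 6 + y ^ 3 + a ^ (q + 1) = 0 ↔ a ^ (q + 1) = y ^ 6 + y ^ 3 := by
      intro a
      constructor
      · intro h; linear_combination h - (y ^ 6 + y ^ 3) * h2
      · intro h; linear_combination h + (y ^ 6 + y ^ 3) * h2
    split_ifs with h
    · refine Eq.trans ?_ ((aux_norm q hq2 hcard _ h.1 h.2).trans (mul_one _).symm)
      congr 1
      ext a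
      simp only [Finset.mem_filter, Finset.mem_univ, true_and, hiff]
      constructor
      · exact fun h => h.2
      · intro h'
        refine ⟨?_, h'⟩
        rintro rfl
        apply h.1
        rw [← h']; simp
    · rw [mul_zero, Finset.card_eq_zero, Finset.filter_eq_empty_iff]
      rintro a _ ⟨ha, hy⟩
      rw [hiff] at hy
      apply h
      rw [← hy]
      exact ⟨pow_ne_zero _ ha, hcq a⟩
  rw [hL, hR] at hdc
  have e : q - 2 = 2 * (2 ^ (n - 1) - 1) := by omega
  rw [e] at hdc
  have : (q + 1) * (4 * (2 * (2 ^ (n - 1) - 1))) = 2 * (4 * (q + 1) * (2 ^ (n - 1) - 1)) := by ring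
  omega
end

section
/- In the polynomial ring F[X] one has the identity ∏_{a ∈ 𝒜} (X - a) = X^{36} + X^{27} + X^{18} + 1, and the formal derivative of X^{36} + X^{27} + X^{18} + 1 over F equals X^{26}. -/
open Polynomial

/-- In characteristic 2, if `b^4 + b^3 + b^2 + 1 = 0` then `z^2 + z + b` divides `z^21 - 1`. -/
lemma quad_dvd {R : Type*} [CommRing R] (h2 : (2 : R) = 0) (z b : R)
    (hb : b ^ 4 + b ^ 3 + b ^ 2 + 1 = 0) : z ^ 2 + z + b ∣ z ^ 21 - 1 := by
  refine ⟨z^19 + z^18 + z^17 * b + z^17 + z^16 + z^15 * b^2 + z^15 * b + z^15 + z^14 * b^2 + z^14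
      + z^13 * b^3 + z^13 * b + z^13 + z^12 + z^11 * b^4 + z^11 * b^2 + z^11 * b + z^11 + z^10
      * b^4 + z^10 * b^2 + z^10 + z^9 * b^5 + z^9 * b^4 + z^9 * b^3 + z^9 * b + z^9 + z^8 *
      b^4 + z^8 + z^7 * b^6 + z^7 * b^5 + z^7 * b^2 + z^7 * b + z^7 + z^6 * b^6 + z^6 * b^2 +
      z^6 + z^5 * b^7 + z^5 * b^3 + z^5 * b + z^5 + z^4 + z^3 * b^8 + z^3 * b^4 + z^3 * b^2 +
      z^3 * b + z^3 + z^2 * b^8 + z^2 * b^4 + z^2 * b^2 + z^2 + z * b^9 + z * b^8 + z * b^5 +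
      z * b^4 + z * b^3 + z * b + z + b^8 + b^4 + 1, ?_⟩
  linear_combination (z * b^6 + z * b + z + b^5 + b^4 + b^2 + b + 1) * hb +
      (- z^20 - z^19 * b - z^19 - z^18 * b - z^18 - z^17 * b^2 - z^17 * b - z^17 - z^16 * b^2 -
      z^16 * b - z^16 - z^15 * b^3 - z^15 * b^2 - z^15 * b - z^15 - z^14 * b^3 - z^14 * b -
      z^14 - z^13 * b^4 - z^13 * b^2 - z^13 * b - z^13 - z^12 * b^4 - z^12 * b^2 - z^12 * b -
      z^12 - z^11 * b^5 - z^11 * b^4 - z^11 * b^3 - z^11 * b^2 - z^11 * b - z^11 - z^10 * b^5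
      - z^10 * b^4 - z^10 * b^3 - z^10 * b - z^10 - z^9 * b^6 - z^9 * b^5 - z^9 * b^4 - z^9 *
      b^2 - z^9 * b - z^9 - z^8 * b^6 - z^8 * b^5 - z^8 * b^2 - z^8 * b - z^8 - z^7 * b^7 -
      z^7 * b^6 - z^7 * b^3 - z^7 * b^2 - z^7 * b - z^7 - z^6 * b^7 - z^6 * b^3 - z^6 * b -
      z^6 - z^5 * b^8 - z^5 * b^4 - z^5 * b^2 - z^5 * b - z^5 - z^4 * b^8 - z^4 * b^4 - z^4 *
      b^2 - z^4 * b - z^4 - z^3 * b^9 - z^3 * b^8 - z^3 * b^5 - z^3 * b^4 - z^3 * b^3 - z^3 *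
      b^2 - z^3 * b - z^3 - z^2 * b^9 - z^2 * b^8 - z^2 * b^5 - z^2 * b^4 - z^2 * b^3 - z^2 *
      b - z^2 - z * b^10 - z * b^9 - z * b^8 - z * b^6 - z * b^5 - 2 * z * b^4 - z * b^3 - z *
      b^2 - z * b - z - b^9 - b^8 - b^7 - b^6 - 2 * b^5 - 2 * b^4 - b^3 - b^2 - b - 1) * h2

/-- In characteristic 2, `z^21 = 1`, `b = z^2 + z`, `b^7 = 1` force
`b^4 + b^3 + b^2 + 1 = 0`. -/
lemma quartic_of_root {R : Type*} [CommRing R] (h2 : (2 : R) = 0) (z b : R)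
    (hz : z ^ 21 = 1) (hzb : z ^ 2 + z + b = 0) (hb : b ^ 7 = 1) :
    b ^ 4 + b ^ 3 + b ^ 2 + 1 = 0 := by
  obtain rfl : b = z ^ 2 + z := by linear_combination hzb - (z ^ 2 + z) * h2
  linear_combination (z^5 + z^2 + z + 1) * hz +
      (z^12 + z^11 + z^9 + z^6 + z^4 + z^3 + z) * hb +
      (- z^26 - 4 * z^25 - 14 * z^24 - 29 * z^23 - 39 * z^22 - 39 * z^21 - 32 * z^20 - 25 *
      z^19 - 22 * z^18 - 25 * z^17 - 32 * z^16 - 39 * z^15 - 42 * z^14 - 39 * z^13 - 31 * z^12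
      - 21 * z^11 - 11 * z^10 - 3 * z^9 + 2 * z^7 + 4 * z^6 + 4 * z^5 + 3 * z^4 + 2 * z^3 +
      z^2 + z + 1) * h2

section

variable {F : Type*} [Field F] [Fintype F] [DecidableEq F]

lemma two_zero (hF : Fintype.card F = 64) : (2 : F) = 0 := by
  have h : ((Fintype.card F : ℕ) : F) = 0 := FiniteField.cast_card_eq_zero F
  rw [hF] at h
  have h' : (2 : F) ^ 6 = 0 := by
    rw [← h]
    norm_num
  exact pow_eq_zero_iff (by norm_num) |>.mp h'

lemma roots_of_dvd (hF : Fintype.card F = 64) {p : F[X]} (hp : p.Monic)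
    (hd : p ∣ X ^ 64 - X) :
    p.roots = (Finset.univ.filter (fun a : F => p.eval a = 0)).val ∧
      p = ∏ a ∈ Finset.univ.filter (fun a : F => p.eval a = 0), (X - C a) := by
  have hne : (X ^ 64 - X : F[X]) ≠ 0 := FiniteField.X_pow_card_sub_X_ne_zero F (by norm_num)
  have hr : (X ^ 64 - X : F[X]).roots = Finset.univ.val := by
    rw [← hF]
    exact FiniteField.roots_X_pow_card_sub_X F
  have hs : (X ^ 64 - X : F[X]).Splits := by
    rw [splits_iff_card_roots, hr,
      FiniteField.X_pow_card_sub_X_natDegree_eq F (by norm_num), ← hF]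
    rfl
  have hnd : p.roots.Nodup :=
    Multiset.nodup_of_le (Polynomial.roots.le_of_dvd hne hd) (hr ▸ Finset.univ.nodup)
  have key : p.roots = (Finset.univ.filter (fun a : F => p.eval a = 0)).val := by
    refine (Multiset.Nodup.ext hnd (Finset.nodup _)).2 fun a => ?_
    simp [hp.ne_zero]
  refine ⟨key, ?_⟩
  have := (hs.of_dvd hne hd).eq_prod_roots_of_monic hp
  rw [key] at this
  exact this

lemma mem_iff (hF : Fintype.card F = 64) (a : F) :
    (a ≠ 0 ∧ Nat.card {y : F // y ^ 6 + y ^ 3 + a ^ 9 = 0} = 6) ↔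
      (X ^ 36 + X ^ 27 + X ^ 18 + 1 : F[X]).eval a = 0 := by
  have h2 := two_zero hF
  have h63 : ∀ x : F, x ≠ 0 → x ^ 63 = 1 := fun x hx => by
    have := FiniteField.pow_card_sub_one_eq_one x hx
    rwa [hF] at this
  have hev : (X ^ 36 + X ^ 27 + X ^ 18 + 1 : F[X]).eval a
      = (a ^ 9) ^ 4 + (a ^ 9) ^ 3 + (a ^ 9) ^ 2 + 1 := by
    simp [← pow_mul]
  rw [hev]
  constructor
  · rintro ⟨ha, hc⟩
    have : Nonempty {y : F // y ^ 6 + y ^ 3 + a ^ 9 = 0} := by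
      by_contra hn
      rw [not_nonempty_iff] at hn
      rw [Nat.card_of_isEmpty] at hc
      omega
    obtain ⟨y, hy⟩ := this
    have hy0 : y ≠ 0 := by
      rintro rfl
      apply ha
      simpa using hy
    refine quartic_of_root h2 (y ^ 3) (a ^ 9) ?_ ?_ ?_
    · rw [← pow_mul]
      exact h63 y hy0
    · rw [← pow_mul]
      exact hy
    · rw [← pow_mul]
      exact h63 a ha
  · intro hb
    refine ⟨?_, ?_⟩
    · rintro rfl
      simp at hb
    · have hm : (X ^ 6 + X ^ 3 + C (a ^ 9) : F[X]).Monic := by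
        monicity!
      have hdeg : (X ^ 6 + X ^ 3 + C (a ^ 9) : F[X]).natDegree = 6 := by
        compute_degree!
      have h2' : (2 : F[X]) = 0 := (map_ofNat C 2).symm.trans ((congrArg C h2).trans C_0)
      have hd : (X ^ 6 + X ^ 3 + C (a ^ 9) : F[X]) ∣ X ^ 64 - X := by
        have h1 := quad_dvd h2' (X ^ 3 : F[X]) (C (a ^ 9)) (by
          have := congrArg (C : F → F[X]) hb
          simpa only [map_add, map_pow, map_one, map_zero] using this)
        have h3 : (X ^ 6 + X ^ 3 + C (a ^ 9) : F[X])
            = (X ^ 3) ^ 2 + X ^ 3 + C (a ^ 9) := by ring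
        have h4 : (X ^ 64 - X : F[X]) = ((X ^ 3) ^ 21 - 1) * X := by ring
        rw [h3, h4]
        exact h1.mul_right X
      obtain ⟨-, hprod⟩ := roots_of_dvd hF hm hd
      have hcard := congrArg natDegree hprod
      rw [hdeg, natDegree_prod_of_monic _ _ (fun i _ => monic_X_sub_C i)] at hcard
      rw [Nat.card_eq_fintype_card, Fintype.card_subtype]
      simpa using hcard.symm

end

/-- Let `F` be the finite field with `64` elements and
`𝒜 = {a ∈ F \ {0} : Y^6 + Y^3 + a^9 ∈ F[Y] has exactly 6 distinct roots in F}`.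
Then `∏_{a ∈ 𝒜} (X - a) = X^36 + X^27 + X^18 + 1` in `F[X]`, and the formal
derivative of `X^36 + X^27 + X^18 + 1` over `F` equals `X^26`. -/
theorem stmt_15 (F : Type*) [Field F] [Fintype F] [DecidableEq F]
    (hF : Fintype.card F = 64) :
    ∏ a ∈ Finset.univ.filter (fun a : F => a ≠ 0 ∧
        Nat.card {y : F // y ^ 6 + y ^ 3 + a ^ 9 = 0} = 6), (X - C a)
      = X ^ 36 + X ^ 27 + X ^ 18 + 1 ∧
    derivative ((X : F[X]) ^ 36 + X ^ 27 + X ^ 18 + 1) = X ^ 26 := by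
  have h2 := two_zero hF
  have h2' : (2 : F[X]) = 0 := (map_ofNat C 2).symm.trans ((congrArg C h2).trans C_0)
  constructor
  · have hm : (X ^ 36 + X ^ 27 + X ^ 18 + 1 : F[X]).Monic := by
      monicity!
    have hd : (X ^ 36 + X ^ 27 + X ^ 18 + 1 : F[X]) ∣ X ^ 64 - X := by
      refine ⟨X * (X ^ 27 + X ^ 18 + 1), ?_⟩
      linear_combination (-(X ^ 55 + X ^ 46 + X ^ 37 + X ^ 28 + X ^ 19 + X : F[X])) * h2'
    obtain ⟨-, hprod⟩ := roots_of_dvd hF hm hd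
    rw [hprod]
    refine Finset.prod_congr ?_ fun _ _ => rfl
    ext a
    simp only [Finset.mem_filter, Finset.mem_univ, true_and]
    exact mem_iff hF a
  · simp only [derivative_add, derivative_X_pow, derivative_one, map_natCast]
    push_cast
    linear_combination (18 * X ^ 35 + 13 * X ^ 26 + 9 * X ^ 17 : F[X]) * h2'
end

section
/- In the polynomial ring F[X] one has the identity ∏_{a ∈ 𝒜} (X - a) = X^{660} + X^{627} + X^{594} + X^{528} + X^{495} + X^{396} + X^{363} + X^{330} + X^{132} + X^{66} + 1, and the formal derivative of this polynomial over F equals X^{626} + X^{494} + X^{362}. -/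
open Polynomial

theorem aux_pow_s16 {R : Type*} [CommRing R] (h2 : (2 : R) = 0) (z c : R) (hz : z ^ 2 + z + c = 0) :
    z ^ 11 = (c ^ 5 + c ^ 4 + c ^ 3 + c + 1) * z + (c ^ 5 + c ^ 3 + c) ∧
    z ^ 32 = z + (c + c ^ 2 + c ^ 4 + c ^ 8 + c ^ 16) := by
  have dbl : ∀ x : R, 2 * x = 0 := fun x => by rw [h2, zero_mul]
  have sq : ∀ x y : R, (x + y) ^ 2 = x ^ 2 + y ^ 2 := fun x y => by
    linear_combination dbl (x * y)
  have e2 : z ^ 2 = z + c := by linear_combination hz - dbl (z + c)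
  have e4 : z ^ 4 = z + (c + c ^ 2) := by
    rw [show z ^ 4 = (z ^ 2) ^ 2 by ring, e2, sq, e2]; ring
  have e8 : z ^ 8 = z + (c + c ^ 2 + c ^ 4) := by
    rw [show z ^ 8 = (z ^ 4) ^ 2 by ring, e4, sq, sq, e2]; ring
  have e16 : z ^ 16 = z + (c + c ^ 2 + c ^ 4 + c ^ 8) := by
    rw [show z ^ 16 = (z ^ 8) ^ 2 by ring, e8, sq, sq, sq, e2]; ring
  have e32 : z ^ 32 = z + (c + c ^ 2 + c ^ 4 + c ^ 8 + c ^ 16) := by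
    rw [show z ^ 32 = (z ^ 16) ^ 2 by ring, e16, sq, sq, sq, sq, e2]; ring
  refine ⟨?_, e32⟩
  have e3 : z ^ 3 = (1 + c) * z + c := by
    linear_combination (z + 1) * e2
  have : z ^ 11 = (z + (c + c ^ 2 + c ^ 4)) * ((1 + c) * z + c) := by
    rw [← e8, ← e3]; ring
  rw [this]
  linear_combination (1 + c) * e2 + dbl (c * z + c ^ 2 * z) + dbl (c ^ 2)

/-- If the key polynomial vanishes at `c`, then `z ^ 341 = 1` for the roots `z` of `z^2 + z + c`. -/
theorem aux_back {F R : Type*} [Field F] [CommRing R] [Algebra F R] (h2 : (2 : F) = 0)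
    (c : F) (hc : c ^ 31 = 1)
    (hP : (1 + c + c ^ 3 + c ^ 7 + c ^ 15) * (c ^ 5 + c ^ 4 + c ^ 3 + c + 1) = 0)
    (z : R) (hz : z ^ 2 + z + algebraMap F R c = 0) : z ^ 341 = 1 := by
  have h2R : (2 : R) = 0 := by
    rw [← map_ofNat (algebraMap F R) 2, h2, map_zero]
  have hcR : (algebraMap F R c) ^ 31 = 1 := by rw [← map_pow, hc, map_one]
  obtain ⟨h11, h32⟩ := aux_pow_s16 h2R z _ hz
  have hunit : z * (-(z + 1) * (algebraMap F R c) ^ 30) = 1 := by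
    linear_combination hcR - (algebraMap F R c) ^ 30 * hz
  have h33 : c + c ^ 2 + c ^ 4 + c ^ 8 + c ^ 16 = 0 → z ^ 341 = 1 := by
    intro h
    have h' := congrArg (algebraMap F R) h
    simp only [map_add, map_pow, map_zero] at h'
    rw [h', add_zero] at h32
    have h31 : z ^ 31 = 1 := by
      linear_combination (-(z + 1) * (algebraMap F R c) ^ 30) * h32 + (1 - z ^ 31) * hunit
    rw [show z ^ 341 = (z ^ 31) ^ 11 by ring, h31, one_pow]
  rcases mul_eq_zero.mp hP with h | h
  · exact h33 (by linear_combination c * h)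
  · by_cases hT : c + c ^ 2 + c ^ 4 + c ^ 8 + c ^ 16 = 0
    · exact h33 hT
    · have hT1 : c + c ^ 2 + c ^ 4 + c ^ 8 + c ^ 16 = 1 := by
        have : (c + c ^ 2 + c ^ 4 + c ^ 8 + c ^ 16) * (c + c ^ 2 + c ^ 4 + c ^ 8 + c ^ 16 - 1)
            = 0 := by grind
        rcases mul_eq_zero.mp this with h | h
        · exact absurd h hT
        · exact sub_eq_zero.mp h
      have hB : c ^ 10 * (c ^ 5 + c ^ 3 + c) = 1 := by
        have : (c ^ 10 * (c ^ 5 + c ^ 3 + c) - 1) ^ 2 = 0 := by grind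
        exact sub_eq_zero.mp (pow_eq_zero_iff (two_ne_zero)|>.mp this)
      have hA' := congrArg (algebraMap F R) h
      have hT' := congrArg (algebraMap F R) hT1
      have hB' := congrArg (algebraMap F R) hB
      simp only [map_add, map_mul, map_pow, map_zero, map_one] at hA' hB' hT'
      rw [hT'] at h32
      rw [hA', zero_mul, zero_add] at h11
      have e33 : z ^ 33 = algebraMap F R c := by
        linear_combination z * h32 + hz - algebraMap F R c * h2R
      rw [show z ^ 341 = (z ^ 33) ^ 10 * z ^ 11 by ring, e33, h11, hB']

theorem aux_fwd {F : Type*} [Field F] (h2 : (2 : F) = 0)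
    (c : F) (hc : c ^ 31 = 1) (z : F) (hz : z ^ 2 + z + c = 0) (h341 : z ^ 341 = 1) :
    (1 + c + c ^ 3 + c ^ 7 + c ^ 15) * (c ^ 5 + c ^ 4 + c ^ 3 + c + 1) = 0 := by
  have hc0 : c ≠ 0 := by rintro rfl; simp at hc
  obtain ⟨h11, h32⟩ := aux_pow_s16 h2 z _ hz
  have hz' : (z + 1) ^ 2 + (z + 1) + c = 0 := by linear_combination hz + (z + 1) * h2
  obtain ⟨h11', h32'⟩ := aux_pow_s16 h2 (z + 1) _ hz'
  by_cases hT : c + c ^ 2 + c ^ 4 + c ^ 8 + c ^ 16 = 0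
  · have : c * (1 + c + c ^ 3 + c ^ 7 + c ^ 15) = 0 := by linear_combination hT
    rw [(mul_eq_zero.mp this).resolve_left hc0, zero_mul]
  · have hT1 : c + c ^ 2 + c ^ 4 + c ^ 8 + c ^ 16 = 1 := by
      have : (c + c ^ 2 + c ^ 4 + c ^ 8 + c ^ 16) * (c + c ^ 2 + c ^ 4 + c ^ 8 + c ^ 16 - 1)
          = 0 := by
        clear hT h32 h32' h11 h11' hz hz' h341 hc0
        grind
      rcases mul_eq_zero.mp this with h | h
      · exact absurd h hT
      · exact sub_eq_zero.mp h
    rw [hT1] at h32 h32'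
    have e33 : z ^ 33 = c := by
      linear_combination z * h32 + hz - c * h2
    have e33' : (z + 1) ^ 33 = c := by
      linear_combination (z + 1) * h32' + hz' - c * h2
    have h341' : (z + 1) ^ 341 = 1 := by
      rw [← h32, ← pow_mul, mul_comm, pow_mul, h341, one_pow]
    rw [show z ^ 341 = (z ^ 33) ^ 10 * z ^ 11 by ring, e33, h11] at h341
    rw [show (z + 1) ^ 341 = ((z + 1) ^ 33) ^ 10 * (z + 1) ^ 11 by
      rw [← pow_mul, ← pow_add], e33', h11'] at h341'
    have : c ^ 10 * (c ^ 5 + c ^ 4 + c ^ 3 + c + 1) = 0 := by linear_combination h341' - h341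
    rw [(mul_eq_zero.mp this).resolve_left (pow_ne_zero _ hc0), mul_zero]

theorem aux_key_s16 {R : Type*} [CommRing R] (h2 : (2 : R) = 0) (c : R) :
    c ^ 20 + c ^ 19 + c ^ 18 + c ^ 16 + c ^ 15 + c ^ 12 + c ^ 11 + c ^ 10 + c ^ 4 + c ^ 2 + 1 =
    (1 + c + c ^ 3 + c ^ 7 + c ^ 15) * (c ^ 5 + c ^ 4 + c ^ 3 + c + 1) := by
  linear_combination -(c + c ^ 3 + c ^ 4 + c ^ 5 + c ^ 6 + c ^ 7 + c ^ 8) * h2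

theorem aux_div {R : Type*} [CommRing R] (h2 : (2 : R) = 0) (c : R) :
    (c ^ 20 + c ^ 19 + c ^ 18 + c ^ 16 + c ^ 15 + c ^ 12 + c ^ 11 + c ^ 10 + c ^ 4 + c ^ 2 + 1) *
    (c ^ 11 + c ^ 10 + c ^ 8 + c ^ 6 + c ^ 2 + 1) = c ^ 31 - 1 := by
  linear_combination (1 + 1*c^2 + 1*c^4 + 1*c^6 + 1*c^8 + 2*c^10 + 1*c^11 + 2*c^12 + 1*c^13
    + 1*c^14 + 1*c^15 + 1*c^16 + 1*c^17 + 2*c^18 + 1*c^19 + 2*c^20 + 2*c^21 + 2*c^22 + 1*c^23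
    + 1*c^24 + 1*c^25 + 2*c^26 + 1*c^27 + 1*c^28 + 1*c^29 + 1*c^30) * h2

theorem aux_dvd_s16 {R : Type*} [CommRing R] (h2 : (2 : R) = 0) (c : R) :
    (c ^ 20 + c ^ 19 + c ^ 18 + c ^ 16 + c ^ 15 + c ^ 12 + c ^ 11 + c ^ 10 + c ^ 4 + c ^ 2 + 1) ∣
      c ^ 31 - 1 :=
  Dvd.intro _ (aux_div h2 c)

theorem aux_dvd_big {R : Type*} [CommRing R] (h2 : (2 : R) = 0) (x : R) (n : ℕ)
    (hn : n = 1024) :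
    (x ^ 660 + x ^ 627 + x ^ 594 + x ^ 528 + x ^ 495 + x ^ 396 + x ^ 363
        + x ^ 330 + x ^ 132 + x ^ 66 + 1) ∣ x ^ n - x := by
  have h1 := aux_dvd_s16 h2 (x ^ 33)
  simp only [← pow_mul, Nat.reduceMul] at h1
  obtain ⟨k, hk⟩ : ∃ k : ℕ, k = 1023 := ⟨_, rfl⟩
  rw [← hk] at h1
  have hn' : n = k + 1 := by omega
  have e : x ^ n - x = (x ^ k - 1) * x := by
    rw [hn', sub_mul, one_mul, ← pow_succ]
  rw [e]
  exact Dvd.dvd.mul_right h1 x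

/-- A monic divisor of `X ^ q - X` is the product over its roots. -/
theorem aux_prod {F : Type*} [Field F] [Fintype F] [DecidableEq F] (f : F[X]) (hm : f.Monic)
    (hd : f ∣ X ^ Fintype.card F - X) :
    f.roots.Nodup ∧ f.Splits ∧ ∏ a ∈ f.roots.toFinset, (X - C a) = f := by
  have hne : (X ^ Fintype.card F - X : F[X]) ≠ 0 :=
    FiniteField.X_pow_card_sub_X_ne_zero F Fintype.one_lt_card
  have hnd : f.roots.Nodup := by
    refine Multiset.nodup_of_le (Polynomial.roots.le_of_dvd hne hd) ?_
    rw [FiniteField.roots_X_pow_card_sub_X]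
    exact Finset.univ.nodup
  have hs : f.Splits := by
    refine Polynomial.Splits.of_dvd ?_ hne hd
    rw [splits_iff_card_roots, FiniteField.roots_X_pow_card_sub_X,
      FiniteField.X_pow_card_sub_X_natDegree_eq F Fintype.one_lt_card]
    rfl
  refine ⟨hnd, hs, ?_⟩
  rw [Finset.prod, Multiset.toFinset_val, hnd.dedup]
  exact (hs.eq_prod_roots_of_monic hm).symm

theorem aux_mem {F : Type*} [Field F] [Fintype F] [DecidableEq F]
    (hF : Fintype.card F = 1024) (h2 : (2 : F) = 0) (a : F) :
    (a ≠ 0 ∧ Nat.card {y : F // y ^ 6 + y ^ 3 + a ^ 33 = 0} = 6) ↔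
    a ^ 660 + a ^ 627 + a ^ 594 + a ^ 528 + a ^ 495 + a ^ 396 + a ^ 363
        + a ^ 330 + a ^ 132 + a ^ 66 + 1 = 0 := by
  have hP : a ^ 660 + a ^ 627 + a ^ 594 + a ^ 528 + a ^ 495 + a ^ 396 + a ^ 363
        + a ^ 330 + a ^ 132 + a ^ 66 + 1 = (1 + a ^ 33 + (a ^ 33) ^ 3 + (a ^ 33) ^ 7 + (a ^ 33) ^ 15) * ((a ^ 33) ^ 5 + (a ^ 33) ^ 4 + (a ^ 33) ^ 3 + a ^ 33 + 1) := by
    rw [← aux_key_s16 h2 (a ^ 33)]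
    simp only [← pow_mul, Nat.reduceMul]
  rw [hP]
  have h1023 : ∀ x : F, x ≠ 0 → x ^ 1023 = 1 := fun x hx => by
    have := FiniteField.pow_card_sub_one_eq_one x hx
    rwa [hF] at this
  by_cases ha : a = 0
  · subst ha; simp
  have hc : (a ^ 33) ^ 31 = 1 := by rw [← pow_mul]; exact h1023 a ha
  have hc0 : a ^ 33 ≠ 0 := pow_ne_zero _ ha
  generalize a ^ 33 = c at hc hc0
  simp only [ne_eq, ha, not_false_eq_true, true_and]
  constructor
  · intro h
    have hne : Nonempty {y : F // y ^ 6 + y ^ 3 + c = 0} := by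
      by_contra hh
      rw [not_nonempty_iff] at hh
      simp at h
    obtain ⟨y, hy⟩ := hne
    have hy0 : y ≠ 0 := by
      rintro rfl
      exact hc0 (by simpa using hy)
    exact aux_fwd h2 c hc (y ^ 3) (by linear_combination hy)
      (by rw [← pow_mul]; exact h1023 y hy0)
  · intro h
    let f : F[X] := X ^ 6 + X ^ 3 + C c
    have hdeg : f.natDegree = 6 := by simp only [f]; compute_degree!
    have hm : f.Monic := by simp only [f]; monicity!
    have hd : f ∣ X ^ Fintype.card F - X := by
      rw [hF, ← AdjoinRoot.mk_eq_zero]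
      have hr : (AdjoinRoot.root f) ^ 6 + (AdjoinRoot.root f) ^ 3 + algebraMap F _ c = 0 := by
        have h0 : AdjoinRoot.mk f (X ^ 6 + X ^ 3 + C c) = 0 := AdjoinRoot.mk_self (f := f)
        simpa only [map_add, map_pow, AdjoinRoot.mk_X, AdjoinRoot.mk_C, AdjoinRoot.algebraMap_eq] using h0
      have := aux_back h2 c hc h ((AdjoinRoot.root f) ^ 3) (by linear_combination hr)
      simp only [map_sub, map_pow, AdjoinRoot.mk_X]
      rw [← pow_mul] at this
      rw [pow_succ, this, one_mul, sub_self]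
    obtain ⟨hnd, hs, -⟩ := aux_prod f hm hd
    have hcard : f.roots.toFinset.card = 6 := by
      rw [Multiset.toFinset_card_of_nodup hnd, ← hs.natDegree_eq_card_roots, hdeg]
    refine (Nat.subtype_card f.roots.toFinset fun y => ?_).trans hcard
    rw [Multiset.mem_toFinset, mem_roots hm.ne_zero]
    simp [f]

/-- Let `F` be the finite field with `1024` elements and
`𝒜 = {a ∈ F \ {0} : Y^6 + Y^3 + a^33 ∈ F[Y] has exactly 6 distinct roots in F}`.
Then `∏_{a ∈ 𝒜} (X - a) = X^660 + X^627 + X^594 + X^528 + X^495 + X^396 + X^363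
+ X^330 + X^132 + X^66 + 1` in `F[X]`, and the formal derivative of this
polynomial over `F` equals `X^626 + X^494 + X^362`. -/
theorem stmt_16 (F : Type*) [Field F] [Fintype F] [DecidableEq F]
    (hF : Fintype.card F = 1024) :
    ∏ a ∈ Finset.univ.filter (fun a : F => a ≠ 0 ∧
        Nat.card {y : F // y ^ 6 + y ^ 3 + a ^ 33 = 0} = 6), (X - C a)
      = X ^ 660 + X ^ 627 + X ^ 594 + X ^ 528 + X ^ 495 + X ^ 396 + X ^ 363
        + X ^ 330 + X ^ 132 + X ^ 66 + 1 ∧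
    derivative ((X : F[X]) ^ 660 + X ^ 627 + X ^ 594 + X ^ 528 + X ^ 495
        + X ^ 396 + X ^ 363 + X ^ 330 + X ^ 132 + X ^ 66 + 1)
      = X ^ 626 + X ^ 494 + X ^ 362 := by
  have h2 : (2 : F) = 0 := by
    have h : ((1024 : ℕ) : F) = 0 := by rw [← hF]; exact FiniteField.cast_card_eq_zero F
    have : (2 : F) ^ 10 = 0 := by rw [← h]; norm_num
    exact pow_eq_zero_iff (by norm_num) |>.mp this
  have h2X : (2 : F[X]) = 0 := by
    rw [← map_ofNat (C : F →+* F[X]) 2, h2, map_zero]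
  constructor
  · set Q : F[X] := X ^ 660 + X ^ 627 + X ^ 594 + X ^ 528 + X ^ 495 + X ^ 396 + X ^ 363
        + X ^ 330 + X ^ 132 + X ^ 66 + 1 with hQ
    have hm : Q.Monic := by rw [hQ]; monicity!
    have hd : Q ∣ X ^ Fintype.card F - X := by
      rw [hQ]
      have h := aux_dvd_big (R := F[X]) h2X X _ hF
      convert h using 1
    obtain ⟨-, -, hp⟩ := aux_prod Q hm hd
    refine Eq.trans (Finset.prod_congr ?_ fun _ _ => rfl) hp
    ext a
    rw [Finset.mem_filter, Multiset.mem_toFinset, mem_roots hm.ne_zero, aux_mem hF h2]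
    rw [IsRoot.def, hQ]
    simp only [eval_add, eval_pow, eval_X, eval_one, Finset.mem_univ, true_and]
  · simp only [derivative_add, derivative_X_pow, derivative_one]
    have ev : ∀ n : ℕ, ((2 * n : ℕ) : F) = 0 := fun n => by push_cast; rw [h2, zero_mul]
    have od : ∀ n : ℕ, ((2 * n + 1 : ℕ) : F) = 1 := fun n => by push_cast; rw [h2]; ring
    rw [show ((660 : ℕ) : F) = 0 from ev 330, show ((627 : ℕ) : F) = 1 from od 313,
      show ((594 : ℕ) : F) = 0 from ev 297, show ((528 : ℕ) : F) = 0 from ev 264,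
      show ((495 : ℕ) : F) = 1 from od 247, show ((396 : ℕ) : F) = 0 from ev 198,
      show ((363 : ℕ) : F) = 1 from od 181, show ((330 : ℕ) : F) = 0 from ev 165,
      show ((132 : ℕ) : F) = 0 from ev 66, show ((66 : ℕ) : F) = 0 from ev 33]
    simp
end
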